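/- Fix λ ∈ ℝ. For n ≥ 1 set p_n := (1 + λ·n^{−1/3})/n, q_n := 1 − p_n, N := n(n−1)/2, and P_n := Σ_G p_n^{e(G)}·q_n^{N−e(G)}·(1/2)^{X(G)}, where the sum is over all simple graphs G on the vertex set {1,…,n}. Then the series defining c(λ) converges absolutely, c(λ) > 0, and n^{1/12}·P_n → c(λ) as n → ∞. (P_n is the probability that the random system x_i + x_j = b_e over 𝔽₂, with underlying Bernoulli random graph G(n,p_n) and independent uniform 𝔽₂ right-hand sides b_e, is solvable.) -/

import Mathlib

open Filter

/-- Number of edges of a simple graph. -/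
noncomputable def edgeCount {V : Type*} (G : SimpleGraph V) : ℕ := G.edgeSet.ncard

/-- Number of connected components of a simple graph. -/
noncomputable def numComponents {V : Type*} (G : SimpleGraph V) : ℕ :=
  Nat.card G.ConnectedComponent

/-- `X(G) = e(G) - v(G) + c(G)`, as an integer. -/
noncomputable def XG {V : Type*} [Fintype V] (G : SimpleGraph V) : ℤ :=
  (edgeCount G : ℤ) - Fintype.card V + numComponents G

/-- `ε_r = (6r)! / (2^{5r} 3^{2r} (3r)! (2r)!)`. -/
noncomputable def epsr (r : ℕ) : ℝ :=
  ((6 * r).factorial : ℝ) /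
    (2 ^ (5 * r) * 3 ^ (2 * r) * ((3 * r).factorial : ℝ) * ((2 * r).factorial : ℝ))

/-- `A(y,λ) = (e^{-λ³/6}/3^{(y+1)/3}) Σ_{k≥0} (3^{2/3}λ/2)^k/k! · 1/Γ((y+1-2k)/3)`;
Mathlib's `Real.Gamma` vanishes at nonpositive integers, so `(Real.Gamma z)⁻¹ = 0` there. -/
noncomputable def Afun (y μ : ℝ) : ℝ :=
  Real.exp (-μ ^ 3 / 6) / (3 : ℝ) ^ ((y + 1) / 3) *
    ∑' k : ℕ, ((3 : ℝ) ^ ((2 : ℝ) / 3) * μ / 2) ^ k / k.factorial *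
      (Real.Gamma ((y + 1 - 2 * k) / 3))⁻¹

/-- The probability that the random Boolean system on the Bernoulli random graph
`G(n, p)` with `p = (1 + λ n^{-1/3})/n` and uniform right-hand sides is solvable:
`P_n = Σ_G p^{e(G)} (1-p)^{N - e(G)} (1/2)^{X(G)}`, `N = n(n-1)/2`. -/
noncomputable def solvProb (lam : ℝ) (n : ℕ) : ℝ :=
  ∑ G : SimpleGraph (Fin n),
    ((1 + lam * (n : ℝ) ^ (-(1 : ℝ) / 3)) / n) ^ edgeCount G *
      (1 - (1 + lam * (n : ℝ) ^ (-(1 : ℝ) / 3)) / n) ^ (n * (n - 1) / 2 - edgeCount G) *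
      (1 / 2 : ℝ) ^ XG G

namespace RandomXor
open PowerSeries Finset

theorem ode_unique {R : Type*} [CommRing R] [Algebra ℝ R] (Y W : PowerSeries R)
    (h0 : coeff 0 W = 0) (hW : derivative R W = W * Y) : W = 0 := by
  have key : ∀ n, ∀ k ≤ n, coeff k W = 0 := by
    intro n
    induction n with
    | zero => intro k hk; obtain rfl : k = 0 := by omega
              exact h0
    | succ n ih =>
      intro k hk
      rcases Nat.lt_or_ge k (n+1) with h | h
      · exact ih k (by omega)
      obtain rfl : k = n + 1 := by omega
      have h1 := congrArg (coeff n) hW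
      rw [coeff_derivative, coeff_mul, Finset.sum_eq_zero] at h1
      · have h2 : (algebraMap ℝ R (n + 1)) * coeff (n+1) W = 0 := by
          rw [mul_comm]; simpa using h1
        have h3 : algebraMap ℝ R ((n+1 : ℝ)⁻¹ * (n + 1)) * coeff (n+1) W = 0 := by
          rw [map_mul, mul_assoc, h2, mul_zero]
        rwa [inv_mul_cancel₀ (by positivity), map_one, one_mul] at h3
      · intro x hx
        rw [ih x.1 (by have := HasAntidiagonal.mem_antidiagonal.1 hx; omega), zero_mul]
  ext n
  simpa using key n n le_rfl

theorem ode_unique' {R : Type*} [CommRing R] [Algebra ℝ R] (Y A B : PowerSeries R)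
    (h0 : coeff 0 A = coeff 0 B) (hA : derivative R A = A * Y) (hB : derivative R B = B * Y) :
    A = B := by
  rw [← sub_eq_zero]
  apply ode_unique Y
  · rw [map_sub, h0, sub_self]
  · simp [hA, hB, sub_mul]

theorem exists_exp {R : Type*} [CommRing R] [Algebra ℝ R] (L : PowerSeries R)
    (h0 : coeff 0 L = 0) : ∃ E : PowerSeries R, coeff 0 E = 1 ∧
      derivative R E = E * derivative R L := by
  let _ : Algebra ℚ R := Algebra.compHom R (algebraMap ℚ ℝ)
  have hs : HasSubst L := HasSubst.of_constantCoeff_zero' (by simpa using h0)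
  refine ⟨(PowerSeries.exp R).subst L, ?_, ?_⟩
  · have h1 : PowerSeries.exp R = 1 + X * PowerSeries.mk (fun n => coeff (n+1) (PowerSeries.exp R)) := by
      ext n
      cases n <;> simp
    rw [h1]
    rw [subst_add hs, subst_mul hs, subst_X hs]
    have : (1 : PowerSeries R).subst L = 1 := by
      rw [← coe_substAlgHom hs]; simp
    rw [this]
    have h0' : constantCoeff L = 0 := by simpa using h0
    simp [h0']
  · rw [derivative_subst hs, derivative_exp]

theorem coeff_nonneg_of_ode {R : Type*} [CommRing R] [Algebra ℝ R] (Y E : PowerSeries R)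
    (P : R → Prop) (hadd : ∀ a b, P a → P b → P (a + b)) (hmul : ∀ a b, P a → P b → P (a * b))
    (h0 : P 0) (hsm : ∀ (c : ℝ) a, 0 ≤ c → P a → P (c • a))
    (hE0 : P (coeff 0 E)) (hY : ∀ n, P (coeff n Y)) (hE : derivative R E = E * Y) (n : ℕ) :
    P (coeff n E) := by
  induction n using Nat.strong_induction_on with
  | _ n ih =>
    cases n with
    | zero => exact hE0
    | succ n =>
      have h1 := congrArg (coeff n) hE
      rw [coeff_derivative, coeff_mul] at h1
      have h2 : coeff (n+1) E = ((n+1:ℝ)⁻¹) • ∑ x ∈ antidiagonal n, coeff x.1 E * coeff x.2 Y := by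
        rw [← h1]
        have : coeff (n+1) E * ((n:R)+1) = (n+1:ℝ) • coeff (n+1) E := by
          rw [Algebra.smul_def]; simp [mul_comm]
        rw [this, smul_smul, inv_mul_cancel₀ (by positivity), one_smul]
      rw [h2]
      apply hsm _ _ (by positivity)
      apply Finset.sum_induction _ P hadd h0
      intro x hx
      exact hmul _ _ (ih _ (by have := HasAntidiagonal.mem_antidiagonal.1 hx; omega)) (hY _)

/-- Solve a recursion whose `r`-th step only uses earlier values. -/
theorem exists_strong_rec {R : Type*} [Zero R] (F : ℕ → (ℕ → R) → R) :
    ∃ L : ℕ → R, ∀ r, L r = F r (fun i => if i < r then L i else 0) := by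
  classical
  let L : ℕ → R := WellFounded.fix (Nat.lt_wfRel.wf)
    (fun r (ih : ∀ i, i < r → R) => F r (fun i => if h : i < r then ih i h else 0))
  refine ⟨L, fun r => ?_⟩
  conv_lhs => rw [show L = WellFounded.fix (Nat.lt_wfRel.wf)
    (fun r (ih : ∀ i, i < r → R) => F r (fun i => if h : i < r then ih i h else 0)) from rfl]
  rw [WellFounded.fix_eq]
  congr 1

end RandomXor

namespace RandomXor
open PowerSeries

theorem derivative_mul' {R : Type*} [CommRing R] (F G : PowerSeries R) :
    derivative R (F * G) = F • derivative R G + G • derivative R F := (derivative R).leibniz F G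

/-- Coefficientwise differentiation of a power series over `ℝ⟦X⟧`. -/
noncomputable def coeffDeriv : Derivation ℝ (PowerSeries (PowerSeries ℝ)) (PowerSeries (PowerSeries ℝ)) :=
  Derivation.mk'
    { toFun := fun F => PowerSeries.mk fun r => derivative ℝ (coeff r F)
      map_add' := by intro F G; ext r; simp
      map_smul' := by intro c F; ext r; simp }
    (by
      intro F G
      ext1 r
      simp only [LinearMap.coe_mk, AddHom.coe_mk, coeff_mk, map_add, coeff_mul, smul_eq_mul, map_sum,
        Derivation.leibniz]
      rw [Finset.sum_add_distrib]
      congr 1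
      rw [← Finset.Nat.sum_antidiagonal_swap]
      rfl)

theorem coeff_coeffDeriv (F : PowerSeries (PowerSeries ℝ)) (r : ℕ) :
    coeff r (coeffDeriv F) = derivative ℝ (coeff r F) := by
  simp [coeffDeriv]

/-- `∂_s`. -/
noncomputable def sDeriv : Derivation ℝ (PowerSeries (PowerSeries ℝ)) (PowerSeries (PowerSeries ℝ)) :=
  Derivation.mk'
    { toFun := fun F => derivative (PowerSeries ℝ) F
      map_add' := by intro F G; simp
      map_smul' := by
        intro c F; ext1 r
        simp [coeff_derivative] }
    (by
      intro F G
      exact derivative_mul' F G)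

theorem sDeriv_apply (F : PowerSeries (PowerSeries ℝ)) :
    sDeriv F = derivative (PowerSeries ℝ) F := rfl

theorem coeffDeriv_sDeriv (F : PowerSeries (PowerSeries ℝ)) :
    coeffDeriv (sDeriv F) = sDeriv (coeffDeriv F) := by
  ext1 r
  rw [coeff_coeffDeriv, sDeriv_apply, sDeriv_apply, coeff_derivative, coeff_derivative,
    coeff_coeffDeriv]
  have : ((r : PowerSeries ℝ) + 1) = ((r + 1 : ℕ) : PowerSeries ℝ) := by push_cast; rfl
  rw [this, Derivation.leibniz, Derivation.map_natCast]
  simp [mul_comm]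

/-- The inner variable as a series. -/
noncomputable def zeta : PowerSeries (PowerSeries ℝ) := C X

/-- `ζ (s ∂_s + (1 + ζ) ∂_ζ)`. -/
noncomputable def thetaD : Derivation ℝ (PowerSeries (PowerSeries ℝ)) (PowerSeries (PowerSeries ℝ)) :=
  zeta • ((X : PowerSeries (PowerSeries ℝ)) • sDeriv + (1 + zeta) • coeffDeriv)

/-- `s ∂_s + ζ ∂_ζ`. -/
noncomputable def eulerD : Derivation ℝ (PowerSeries (PowerSeries ℝ)) (PowerSeries (PowerSeries ℝ)) :=
  (X : PowerSeries (PowerSeries ℝ)) • sDeriv + zeta • coeffDeriv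

theorem coeff_X_mul_sDeriv (F : PowerSeries (PowerSeries ℝ)) (r : ℕ) :
    coeff r (X * sDeriv F) = (r : ℝ) • coeff r F := by
  rw [sDeriv_apply]
  cases r with
  | zero => simp
  | succ r =>
    rw [coeff_succ_X_mul, coeff_derivative, Algebra.smul_def]
    simp [mul_comm]

theorem coeff_zeta_mul (F : PowerSeries (PowerSeries ℝ)) (r : ℕ) :
    coeff r (zeta * F) = X * coeff r F := by
  rw [zeta, coeff_C_mul]

theorem coeff_thetaD (F : PowerSeries (PowerSeries ℝ)) (r : ℕ) :
    coeff r (thetaD F) = X * ((r : ℝ) • coeff r F + (1 + X) * derivative ℝ (coeff r F)) := by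
  simp only [thetaD, Derivation.smul_apply, Derivation.add_apply, smul_eq_mul, coeff_zeta_mul,
    map_add, coeff_X_mul_sDeriv, add_mul, one_mul, coeff_coeffDeriv]

theorem coeff_eulerD (F : PowerSeries (PowerSeries ℝ)) (r m : ℕ) :
    coeff m (coeff r (eulerD F)) = (r + m : ℝ) * coeff m (coeff r F) := by
  simp only [eulerD, Derivation.smul_apply, Derivation.add_apply, smul_eq_mul, coeff_zeta_mul,
    map_add, coeff_X_mul_sDeriv, coeff_coeffDeriv]
  rw [add_mul]
  congr 1
  cases m with
  | zero => simp
  | succ m => rw [coeff_succ_X_mul, coeff_derivative]; push_cast; ring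

/-- All coefficients are nonnegative. -/
def NN1 (F : PowerSeries ℝ) : Prop := ∀ m, 0 ≤ coeff m F
/-- All coefficients are nonnegative. -/
def NN2 (F : PowerSeries (PowerSeries ℝ)) : Prop := ∀ r, NN1 (coeff r F)

theorem NN1.add {F G : PowerSeries ℝ} (hF : NN1 F) (hG : NN1 G) : NN1 (F + G) := fun m => by
  rw [map_add]; exact add_nonneg (hF m) (hG m)
theorem NN1.mul {F G : PowerSeries ℝ} (hF : NN1 F) (hG : NN1 G) : NN1 (F * G) := fun m => by
  rw [coeff_mul]; exact Finset.sum_nonneg fun x _ => mul_nonneg (hF _) (hG _)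
theorem NN1.smul {c : ℝ} {F : PowerSeries ℝ} (hc : 0 ≤ c) (hF : NN1 F) : NN1 (c • F) := fun m => by
  rw [coeff_smul]; exact mul_nonneg hc (hF m)
theorem NN1.zero : NN1 0 := fun m => by simp
theorem NN1.one : NN1 1 := fun m => by rw [coeff_one]; split <;> norm_num
theorem NN1.X : NN1 X := fun m => by rw [coeff_X]; split <;> norm_num
theorem NN1.deriv {F : PowerSeries ℝ} (hF : NN1 F) : NN1 (derivative ℝ F) := fun m => by
  rw [coeff_derivative]; exact mul_nonneg (hF _) (by positivity)

theorem NN2.add {F G : PowerSeries (PowerSeries ℝ)} (hF : NN2 F) (hG : NN2 G) : NN2 (F + G) :=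
  fun m => by rw [map_add]; exact (hF m).add (hG m)
theorem NN2.mul {F G : PowerSeries (PowerSeries ℝ)} (hF : NN2 F) (hG : NN2 G) : NN2 (F * G) :=
  fun m => by
    rw [coeff_mul]
    exact Finset.sum_induction _ NN1 (fun _ _ => NN1.add) NN1.zero
      (fun x _ => (hF _).mul (hG _))
theorem NN2.theta {F : PowerSeries (PowerSeries ℝ)} (hF : NN2 F) : NN2 (thetaD F) :=
  fun r => by
    rw [coeff_thetaD]
    exact NN1.X.mul (((hF r).smul (by positivity)).add ((NN1.one.add NN1.X).mul (hF r).deriv))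
theorem NN2.zetaC : NN2 zeta := fun r => by
  rw [zeta, coeff_C]; split
  · exact NN1.X
  · exact NN1.zero
theorem NN2.smul {c : ℝ} {F : PowerSeries (PowerSeries ℝ)} (hc : 0 ≤ c) (hF : NN2 F) :
    NN2 (c • F) := fun r => by
  rw [coeff_smul]; exact (hF r).smul hc

/-- Right-hand side of the Riccati equation. -/
noncomputable def ricc (F : PowerSeries (PowerSeries ℝ)) : PowerSeries (PowerSeries ℝ) :=
  thetaD (thetaD F) + thetaD F * thetaD F + (2 : ℝ) • (zeta * thetaD F)
    + ((1 / 2 : ℝ) • zeta + (5 / 4 : ℝ) • (zeta * zeta))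

theorem NN2.ricc {F : PowerSeries (PowerSeries ℝ)} (hF : NN2 F) : NN2 (ricc F) :=
  ((hF.theta.theta.add (hF.theta.mul hF.theta)).add
    (NN2.smul (by norm_num) (NN2.zetaC.mul hF.theta))).add
    ((NN2.smul (by norm_num) NN2.zetaC).add (NN2.smul (by norm_num) (NN2.zetaC.mul NN2.zetaC)))

theorem coeff_ricc_congr {F G : PowerSeries (PowerSeries ℝ)} (r : ℕ)
    (h : ∀ i ≤ r, coeff i F = coeff i G) : coeff r (RandomXor.ricc F) = coeff r (RandomXor.ricc G) := by
  have h1 : ∀ i ≤ r, coeff i (thetaD F) = coeff i (thetaD G) := by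
    intro i hi; rw [coeff_thetaD, coeff_thetaD, h i hi]
  have h2 : ∀ i ≤ r, coeff i (thetaD (thetaD F)) = coeff i (thetaD (thetaD G)) := by
    intro i hi; rw [coeff_thetaD, coeff_thetaD (thetaD G), h1 i hi]
  have h3 : coeff r (thetaD F * thetaD F) = coeff r (thetaD G * thetaD G) := by
    rw [coeff_mul, coeff_mul]
    refine Finset.sum_congr rfl fun x hx => ?_
    have := Finset.HasAntidiagonal.mem_antidiagonal.1 hx
    rw [h1 _ (by omega), h1 _ (by omega)]
  simp only [RandomXor.ricc, map_add, coeff_smul, coeff_zeta_mul, h3, h1 r le_rfl, h2 r le_rfl]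

theorem exists_riccati : ∃ L : PowerSeries (PowerSeries ℝ), coeff 0 L = 0 ∧ NN2 L ∧
    eulerD L = (1 / 2 : ℝ) • (X * ricc L) := by
  obtain ⟨L, hL⟩ := exists_strong_rec (R := PowerSeries ℝ) (fun r prev =>
    match r with
    | 0 => 0
    | r + 1 => PowerSeries.mk fun m =>
        ((r + 1 + m : ℝ)⁻¹ * (1 / 2)) * coeff m (coeff r (ricc (PowerSeries.mk prev))))
  have hcut : ∀ r, coeff r (ricc (PowerSeries.mk fun i => if i < r + 1 then L i else 0))
      = coeff r (ricc (PowerSeries.mk L)) := by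
    intro r
    apply coeff_ricc_congr
    intro i hi
    have : i < r + 1 := by omega
    rw [coeff_mk, coeff_mk, if_pos this]
  refine ⟨PowerSeries.mk L, ?_, ?_, ?_⟩
  · rw [coeff_mk, hL 0]
  · intro r
    rw [coeff_mk]
    induction r using Nat.strong_induction_on with
    | _ r ih =>
      rw [hL r]
      cases r with
      | zero => exact NN1.zero
      | succ r =>
        intro m
        rw [coeff_mk]
        refine mul_nonneg (by positivity) ?_
        apply NN2.ricc
        intro i
        rw [coeff_mk]
        split
        · exact ih _ ‹_›
        · exact NN1.zero
  · ext r m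
    rw [coeff_eulerD, coeff_smul, coeff_smul, coeff_mk, hL r]
    cases r with
    | zero => simp
    | succ r =>
      rw [coeff_succ_X_mul]
      simp only [coeff_mk, hcut]
      push_cast
      have : (r + 1 + m : ℝ) ≠ 0 := by positivity
      rw [smul_eq_mul, ← mul_assoc, ← mul_assoc, mul_inv_cancel₀ this, one_mul]

/-- The linear operator corresponding to `ricc`. -/
theorem exists_two_var : ∃ E P : PowerSeries (PowerSeries ℝ), coeff 0 E = 1 ∧ coeff 0 P = 1 ∧
    NN2 E ∧ NN2 P ∧ P * P = E ∧ eulerD E = (1 / 2 : ℝ) • (X * (thetaD (thetaD E)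
      + (2 : ℝ) • (zeta * thetaD E) + ((1 / 2 : ℝ) • zeta + (5 / 4 : ℝ) • (zeta * zeta)) * E)) := by
  obtain ⟨L, hL0, hLn, hL⟩ := exists_riccati
  obtain ⟨E, hE0, hE⟩ := exists_exp L hL0
  obtain ⟨P, hP0, hP⟩ := exists_exp ((1 / 2 : ℝ) • L) (by simpa using hL0)
  have hPs : derivative (PowerSeries ℝ) P = (1 / 2 : ℝ) • (P * derivative (PowerSeries ℝ) L) := by
    rw [hP, ← sDeriv_apply, Derivation.map_smul, mul_smul_comm, sDeriv_apply]
  have hdn : NN2 (derivative (PowerSeries ℝ) L) := by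
    intro r
    rw [coeff_derivative]
    refine (hLn _).mul ?_
    have : ((r : PowerSeries ℝ) + 1) = (r + 1 : ℝ) • (1 : PowerSeries ℝ) := by
      rw [Algebra.smul_def]; simp
    rw [this]; exact NN1.one.smul (by positivity)
  have nn : ∀ (Y E : PowerSeries (PowerSeries ℝ)), NN2 Y → coeff 0 E = 1 →
      derivative _ E = E * Y → NN2 E := fun Y E hY h0 h n =>
    coeff_nonneg_of_ode Y E NN1 (fun _ _ => NN1.add) (fun _ _ => NN1.mul) NN1.zero
      (fun c a hc ha => ha.smul hc) (h0 ▸ NN1.one) hY h n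
  refine ⟨E, P, hE0, hP0, nn _ _ hdn hE0 hE, ?_, ?_, ?_⟩
  · refine nn _ _ (NN2.smul (c := 1/2) (by norm_num) hdn) hP0 ?_
    rw [hPs, mul_smul_comm]
  · refine ode_unique' (derivative _ L) _ _ ?_ ?_ hE
    · rw [coeff_mul]; simp [hE0]
      have : constantCoeff P = 1 := by simpa using hP0
      rw [this]; simp
    · rw [← sDeriv_apply, Derivation.leibniz, sDeriv_apply, hPs]
      simp only [smul_eq_mul, Algebra.mul_smul_comm]
      rw [← mul_assoc, ← add_smul]; norm_num
  · have hs : sDeriv E = E * sDeriv L := hE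
    have hd : coeffDeriv E = E * coeffDeriv L := by
      rw [← sub_eq_zero]
      apply ode_unique (derivative _ L)
      · rw [map_sub, coeff_mul, coeff_coeffDeriv, hE0]
        have h' : constantCoeff (coeffDeriv L) = 0 := by
          have := coeff_coeffDeriv L 0
          rw [hL0] at this; simpa using this
        simp [h', show (1 : PowerSeries ℝ) = C 1 by simp, -map_one]
      · have h1 := coeffDeriv_sDeriv E
        have h2 := coeffDeriv_sDeriv L
        rw [hs, Derivation.leibniz] at h1
        rw [← sDeriv_apply, ← sDeriv_apply, map_sub, Derivation.leibniz, ← h1, hs, h2]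
        simp only [smul_eq_mul]; ring
    have ht : thetaD E = E * thetaD L := by
      simp only [thetaD, Derivation.smul_apply, Derivation.add_apply, smul_eq_mul, hs, hd]; ring
    have he : eulerD E = E * eulerD L := by
      simp only [eulerD, Derivation.smul_apply, Derivation.add_apply, smul_eq_mul, hs, hd]; ring
    rw [he, hL, ht, Derivation.leibniz, ht, ricc]
    simp only [smul_eq_mul, Algebra.smul_def]
    ring

end RandomXor

namespace RandomXor
open PowerSeries

/-- The array `e` of formal coefficients and its convolution square root `g`. -/
structure CoeffArrays (e g : ℕ → ℕ → ℝ) : Prop where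
  e_nonneg : ∀ r m, 0 ≤ e r m
  g_nonneg : ∀ r m, 0 ≤ g r m
  e_zero : ∀ m, e 0 m = if m = 0 then 1 else 0
  g_zero : ∀ m, g 0 m = if m = 0 then 1 else 0
  conv : ∀ r m, ∑ x ∈ Finset.HasAntidiagonal.antidiagonal r, ∑ y ∈ Finset.HasAntidiagonal.antidiagonal m,
    g x.1 y.1 * g x.2 y.2 = e r m
  e_rec_zero : ∀ r, e (r + 1) 0 = 0
  e_rec_one : ∀ r : ℕ, (r + 2 : ℝ) * e (r + 1) 1 = 1 / 2 * (e r 1 + (r + 1 / 2) * e r 0)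
  e_rec : ∀ r m : ℕ, (r + 1 + (m + 2) : ℝ) * e (r + 1) (m + 2) = 1 / 2 * ((m + 2) ^ 2 * e r (m + 2)
    + ((r + (m + 1)) * (2 * (m + 1) + 1) + 2 * (m + 1) + 1 / 2) * e r (m + 1)
    + ((r + m) * (r + m + 3) + 5 / 4) * e r m)

theorem exists_coeffArrays : ∃ e g, CoeffArrays e g := by
  obtain ⟨E, P, hE0, hP0, hE, hP, hPE, hrec⟩ := exists_two_var
  have key : ∀ r m : ℕ, (r + 1 + m : ℝ) * coeff m (coeff (r + 1) E) = 1 / 2 * coeff m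
      (coeff r (thetaD (thetaD E)
      + (2 : ℝ) • (zeta * thetaD E) + ((1 / 2 : ℝ) • zeta + (5 / 4 : ℝ) • (zeta * zeta)) * E)) := by
    intro r m
    have := congrArg (fun F => coeff m (coeff (r + 1) F)) hrec
    simp only [coeff_eulerD, coeff_smul, coeff_succ_X_mul] at this
    rw [← smul_eq_mul (1 / 2 : ℝ), ← this]
    push_cast; ring
  simp only [map_add, coeff_thetaD, add_mul, smul_mul_assoc, mul_assoc, coeff_smul,
    coeff_zeta_mul] at key
  refine ⟨fun r m => coeff m (coeff r E), fun r m => coeff m (coeff r P), hE, hP, ?_, ?_, ?_, ?_,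
    ?_, ?_⟩
  · intro m
    simp only [hE0, coeff_one]
  · intro m
    simp only [hP0, coeff_one]
  · intro r m
    simp only [← hPE, coeff_mul, map_sum]
  · intro r
    have := key r 0
    simp at this
    have hp : (r + 1 : ℝ) ≠ 0 := by positivity
    have h3 : (r + 1 : ℝ) * constantCoeff (coeff (r + 1) E) = 0 := by linear_combination this
    simpa [hp] using h3
  · intro r
    have := key r 1
    have z0 : ∀ F : PowerSeries ℝ, coeff 1 (X * F) = coeff 0 F := fun F => coeff_succ_X_mul 0 F
    have z1 : ∀ F : PowerSeries ℝ, coeff 0 (X * F) = 0 := fun F => coeff_zero_X_mul F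
    have dX : derivative ℝ (X : PowerSeries ℝ) = 1 := by simp
    have d1 : derivative ℝ (1 : PowerSeries ℝ) = 0 := by simp
    simp only [mul_add, one_mul, z0, z1, map_add, coeff_smul, coeff_derivative, dX,
      Derivation.leibniz, smul_eq_mul, Derivation.map_smul, mul_smul_comm, mul_one, mul_zero] at this
    push_cast at this
    linear_combination this
  · intro r m
    have := key r (m + 2)
    have z0 : ∀ (k : ℕ) (F : PowerSeries ℝ), coeff (k + 1) (X * F) = coeff k F :=
      fun k F => coeff_succ_X_mul k F
    have dX : derivative ℝ (X : PowerSeries ℝ) = 1 := by simp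
    have d1 : derivative ℝ (1 : PowerSeries ℝ) = 0 := by simp
    have z2 : ∀ (k : ℕ) (F : PowerSeries ℝ), coeff (k + 2) (X * F) = coeff (k + 1) F :=
      fun k F => coeff_succ_X_mul (k + 1) F
    have z3 : ∀ (F : PowerSeries ℝ), coeff (m) (X * derivative ℝ F) = m * coeff m F := by
      intro F
      cases m with
      | zero => simp
      | succ m => rw [coeff_succ_X_mul, coeff_derivative]; push_cast; ring
    have z4 : ∀ (F : PowerSeries ℝ), coeff (m) (X * (X * derivative ℝ (derivative ℝ F)))
        = m * (m - 1) * coeff m F := by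
      intro F
      rcases m with _ | _ | m
      · simp
      · rw [coeff_succ_X_mul]; simp
      · rw [coeff_succ_X_mul, coeff_succ_X_mul, coeff_derivative, coeff_derivative]; push_cast; ring
    simp only [mul_add, add_mul, one_mul, z0, map_add, coeff_smul, coeff_derivative, dX,
      Derivation.leibniz, smul_eq_mul, Derivation.map_smul, mul_smul_comm, mul_one] at this
    push_cast at this
    simp only [z4, z3, coeff_derivative] at this
    linear_combination this

variable {e g : ℕ → ℕ → ℝ}

theorem CoeffArrays.e_eq_zero (h : CoeffArrays e g) (r m : ℕ) (hm : 2 * r < m) : e r m = 0 := by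
  induction r generalizing m with
  | zero => rw [h.e_zero, if_neg (by omega)]
  | succ r ih =>
    obtain ⟨k, rfl⟩ : ∃ k, m = k + 2 := ⟨m - 2, by omega⟩
    have := h.e_rec r k
    rw [ih _ (by omega), ih _ (by omega), ih _ (by omega)] at this
    have hp : (0 : ℝ) < r + 1 + (k + 2) := by positivity
    simp at this
    rcases this with h | h
    · linarith
    · exact h

theorem CoeffArrays.g_le (h : CoeffArrays e g) (r m : ℕ) : g r m ≤ e r m := by
  rw [← h.conv r m]
  have nn : ∀ x ∈ Finset.HasAntidiagonal.antidiagonal r, 0 ≤ ∑ y ∈ Finset.HasAntidiagonal.antidiagonal m,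
    g x.1 y.1 * g x.2 y.2 := fun x _ => Finset.sum_nonneg fun y _ =>
      mul_nonneg (h.g_nonneg _ _) (h.g_nonneg _ _)
  refine le_trans ?_ (Finset.single_le_sum nn (show (r, 0) ∈ Finset.HasAntidiagonal.antidiagonal r by simp))
  refine le_trans ?_ (Finset.single_le_sum (fun y _ => mul_nonneg (h.g_nonneg _ _)
    (h.g_nonneg _ _)) (show (m, 0) ∈ Finset.HasAntidiagonal.antidiagonal m by simp))
  simp [h.g_zero]

theorem CoeffArrays.g_eq_zero (h : CoeffArrays e g) (r m : ℕ) (hm : 2 * r < m) : g r m = 0 :=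
  le_antisymm ((h.g_le r m).trans_eq (h.e_eq_zero r m hm)) (h.g_nonneg r m)

theorem epsr_zero : epsr 0 = 1 := by simp [epsr]

theorem epsr_succ (r : ℕ) : epsr (r + 1) * (24 * (r + 1)) = (6 * r + 1) * (6 * r + 5) * epsr r := by
  unfold epsr
  rw [show 6 * (r + 1) = 6 * r + 1 + 1 + 1 + 1 + 1 + 1 by ring,
    show 3 * (r + 1) = 3 * r + 1 + 1 + 1 by ring, show 2 * (r + 1) = 2 * r + 1 + 1 by ring]
  simp only [Nat.factorial_succ]
  have h1 := Nat.factorial_ne_zero (3 * r)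
  have h2 := Nat.factorial_ne_zero (2 * r)
  push_cast
  field_simp
  ring

theorem CoeffArrays.e_diag (h : CoeffArrays e g) (r : ℕ) : e r (2 * r) = epsr r := by
  induction r with
  | zero => simp [h.e_zero, epsr_zero]
  | succ r ih =>
    have := h.e_rec r (2 * r)
    rw [h.e_eq_zero r _ (by omega), h.e_eq_zero r (2 * r + 1) (by omega), ih] at this
    have h2 := epsr_succ r
    have hp : (r + 1 + (2 * r + 2) : ℝ) ≠ 0 := by positivity
    push_cast at this
    rw [show 2 * (r + 1) = 2 * r + 2 by ring]
    apply mul_left_cancel₀ hp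
    linear_combination this - h2 / 8

theorem CoeffArrays.g_diag_conv (h : CoeffArrays e g) (r : ℕ) :
    ∑ x ∈ Finset.HasAntidiagonal.antidiagonal r, g x.1 (2 * x.1) * g x.2 (2 * x.2) = epsr r := by
  rw [← h.e_diag, ← h.conv]
  refine Finset.sum_congr rfl fun x hx => ?_
  have hx := Finset.HasAntidiagonal.mem_antidiagonal.1 hx
  rw [Finset.sum_eq_single (2 * x.1, 2 * x.2)]
  · rintro ⟨a, b⟩ hab hne
    have hab := Finset.HasAntidiagonal.mem_antidiagonal.1 hab
    simp only at hab ⊢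
    rcases Nat.lt_or_ge (2 * x.1) a with h1 | h1
    · rw [h.g_eq_zero _ _ h1, zero_mul]
    · rw [h.g_eq_zero x.2 b, mul_zero]
      rcases h1.lt_or_eq with h2 | h2
      · omega
      · exact absurd (Prod.ext h2 (show b = 2 * x.2 by omega)) hne
  · intro h1
    exact absurd (Finset.HasAntidiagonal.mem_antidiagonal.2 (by simp only; omega)) h1

theorem CoeffArrays.g_diag (h : CoeffArrays e g) {f : ℕ → ℝ} (hf0 : f 0 = 1)
    (hrec : ∀ r : ℕ, 1 ≤ r → ∑ k ∈ Finset.range (r + 1), f k * f (r - k) = epsr r) (r : ℕ) :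
    g r (2 * r) = f r := by
  induction r using Nat.strong_induction_on with
  | _ r ih =>
    rcases Nat.eq_zero_or_pos r with rfl | hr
    · simp [h.g_zero, hf0]
    · have h1 := h.g_diag_conv r
      rw [Finset.Nat.sum_antidiagonal_eq_sum_range_succ (fun i j => g i (2 * i) * g j (2 * j)),
        ← hrec r hr] at h1
      obtain ⟨s, rfl⟩ : ∃ s, r = s + 1 := ⟨r - 1, by omega⟩
      rw [Finset.sum_range_succ, Finset.sum_range_succ _ (s + 1), Finset.sum_range_succ',
        Finset.sum_range_succ' _ s] at h1
      have h2 : ∀ k ∈ Finset.range s, g (k + 1) (2 * (k + 1)) * g (s + 1 - (k + 1)) (2 * (s + 1 - (k + 1)))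
          = f (k + 1) * f (s + 1 - (k + 1)) := by
        intro k hk
        rw [Finset.mem_range] at hk
        rw [ih _ (by omega), ih _ (by omega)]
      rw [Finset.sum_congr rfl h2] at h1
      simp [h.g_zero, hf0] at h1
      have e : g (s + 1) (2 * (s + 1)) + g (s + 1) (2 * (s + 1)) = f (s + 1) + f (s + 1) := by
        linarith
      linarith

/-- The recursion for `e`, tested against an arbitrary sequence. -/
theorem CoeffArrays.sum_rec (h : CoeffArrays e g) {M : Type*} [AddCommGroup M] [Module ℝ M]
    (v : ℕ → M) (r : ℕ) :
    ∑ m ∈ Finset.range (2 * r + 3), ((r + 1 + m : ℝ) * e (r + 1) m) • v m =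
    (1 / 2 : ℝ) • ∑ m ∈ Finset.range (2 * r + 1), e r m • ((m : ℝ) ^ 2 • v m
      + ((r + m : ℝ) * (2 * m + 1) + 2 * m + 1 / 2) • v (m + 1)
      + ((r + m : ℝ) * (r + m + 3) + 5 / 4) • v (m + 2)) := by
  have hv : ∀ m : ℕ, e r m • ((m : ℝ) ^ 2 • v m
      + ((r + m : ℝ) * (2 * m + 1) + 2 * m + 1 / 2) • v (m + 1)
      + ((r + m : ℝ) * (r + m + 3) + 5 / 4) • v (m + 2)) =
      ((m : ℝ) ^ 2 * e r m) • v m +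
      (((r + m : ℝ) * (2 * m + 1) + 2 * m + 1 / 2) * e r m) • v (m + 1)
      + (((r + m : ℝ) * (r + m + 3) + 5 / 4) * e r m) • v (m + 2) := by
    intro m; simp only [smul_add, smul_smul, mul_comm]
  rw [Finset.sum_congr rfl fun m _ => hv m, Finset.sum_add_distrib, Finset.sum_add_distrib]
  have z : ∀ k, 2 * r + 1 ≤ k → e r k = 0 := fun k hk => h.e_eq_zero r k (by omega)
  have e1 : ∑ m ∈ Finset.range (2 * r + 1), ((m : ℝ) ^ 2 * e r m) • v m =
      ∑ m ∈ Finset.range (2 * r + 1 ), (((m + 2 : ℕ) : ℝ) ^ 2 * e r (m + 2)) • v (m + 2) +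
        e r 1 • v 1 := by
    have : ∑ m ∈ Finset.range (2 * r + 1), ((m : ℝ) ^ 2 * e r m) • v m =
      ∑ m ∈ Finset.range (2 * r + 1 + 2), ((m : ℝ) ^ 2 * e r m) • v m := by
      rw [Finset.sum_range_succ _ (2 * r + 1 + 1), Finset.sum_range_succ _ (2 * r + 1),
        z _ le_rfl, z (2 * r + 1 + 1) (by omega)]
      simp
    rw [this, Finset.sum_range_succ', Finset.sum_range_succ']
    simp [add_assoc]
  have e2 : ∑ m ∈ Finset.range (2 * r + 1), (((r + m : ℝ) * (2 * m + 1) + 2 * m + 1 / 2) * e r m) • v (m + 1)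
      = ∑ m ∈ Finset.range (2 * r + 1), (((r + (m + 1 : ℕ) : ℝ) * (2 * (m + 1 : ℕ) + 1) + 2 * (m + 1 : ℕ) + 1 / 2) * e r (m + 1)) • v (m + 2)
       + ((r + 1 / 2 : ℝ) * e r 0) • v 1 := by
    have : ∑ m ∈ Finset.range (2 * r + 1), (((r + m : ℝ) * (2 * m + 1) + 2 * m + 1 / 2) * e r m) • v (m + 1) =
      ∑ m ∈ Finset.range (2 * r + 1 + 1), (((r + m : ℝ) * (2 * m + 1) + 2 * m + 1 / 2) * e r m) • v (m + 1) := by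
      rw [Finset.sum_range_succ _ (2 * r + 1), z _ le_rfl]
      simp
    rw [this, Finset.sum_range_succ']
    simp
  rw [e1, e2]
  rw [show 2 * r + 3 = 2 * r + 1 + 1 + 1 by ring, Finset.sum_range_succ', Finset.sum_range_succ']
  have h1 := h.e_rec_one r
  have e3 : ∀ m ∈ Finset.range (2 * r + 1), ((r + 1 + (m + 1 + 1 : ℕ) : ℝ) * e (r + 1) (m + 1 + 1)) • v (m + 1 + 1)
    = (1 / 2 : ℝ) • ((((m + 2 : ℕ) : ℝ) ^ 2 * e r (m + 2)) • v (m + 2) + (((r + (m + 1 : ℕ) : ℝ) * (2 * (m + 1 : ℕ) + 1) + 2 * (m + 1 : ℕ) + 1 / 2) * e r (m + 1)) • v (m + 2) + (((r + m : ℝ) * (r + m + 3) + 5 / 4) * e r m) • v (m + 2)) := by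
    intro m _
    have := h.e_rec r m
    rw [← add_smul, ← add_smul, smul_smul]
    congr 1
    push_cast
    rw [show m + 1 + 1 = m + 2 from rfl]
    linear_combination this
  rw [Finset.sum_congr rfl e3, ← Finset.smul_sum, Finset.sum_add_distrib, Finset.sum_add_distrib]
  have h0 := h.e_rec_zero r
  simp only [h0, zero_add, mul_zero, zero_smul, add_zero, smul_add]
  have h1' : ((r + 1 + (1 : ℕ) : ℝ) * e (r + 1) 1) • v 1 = (1 / 2 : ℝ) • e r 1 • v 1 + (1 / 2 : ℝ) • ((r + 1 / 2 : ℝ) * e r 0) • v 1 := by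
    rw [smul_smul, smul_smul, ← add_smul]
    congr 1
    push_cast
    linear_combination h1
  rw [h1']
  abel

end RandomXor

namespace RandomXor
open PowerSeries

/-- The binomial series `(1 - X) ^ b`. -/
noncomputable def opow (b : ℝ) : PowerSeries ℝ :=
  PowerSeries.mk fun j => ∏ i ∈ Finset.range j, ((i - b) / (i + 1))

theorem coeff_opow_zero (b : ℝ) : coeff 0 (opow b) = 1 := by rw [opow, coeff_mk]; simp

theorem coeff_opow_succ (b : ℝ) (j : ℕ) :
    coeff (j + 1) (opow b) * (j + 1) = (j - b) * coeff j (opow b) := by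
  rw [opow, coeff_mk, coeff_mk, Finset.prod_range_succ]
  have : (j + 1 : ℝ) ≠ 0 := by positivity
  field_simp

theorem one_sub_X_mul_deriv_opow (b : ℝ) :
    (1 - X) * derivative ℝ (opow b) = (-b) • opow b := by
  ext j
  rw [sub_mul, one_mul, map_sub, coeff_smul, coeff_derivative, coeff_opow_succ]
  cases j with
  | zero => simp
  | succ j =>
    rw [coeff_succ_X_mul, coeff_derivative, smul_eq_mul]; push_cast; ring

theorem coeff_opow_nonneg {b : ℝ} (hb : b ≤ 0) : NN1 (opow b) := fun j => by
  rw [opow, coeff_mk]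
  exact Finset.prod_nonneg fun i _ => div_nonneg (by have : (0:ℝ) ≤ i := i.cast_nonneg; linarith) (by positivity)

theorem mk_one_mul : (PowerSeries.mk 1 : PowerSeries ℝ) * (1 - X) = 1 :=
  mk_one_mul_one_sub_eq_one ℝ

theorem opow_unique {b : ℝ} {F : PowerSeries ℝ} (h0 : coeff 0 F = 1)
    (h : (1 - X) * derivative ℝ F = (-b) • F) : F = opow b := by
  have aux : ∀ H : PowerSeries ℝ, (1 - X) * derivative ℝ H = (-b) • H →
      derivative ℝ H = H * ((-b) • PowerSeries.mk 1) := by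
    intro H hH
    calc derivative ℝ H = (PowerSeries.mk 1 * (1 - X)) * derivative ℝ H := by rw [mk_one_mul, one_mul]
      _ = PowerSeries.mk 1 * ((-b) • H) := by rw [mul_assoc, hH]
      _ = _ := by rw [mul_smul_comm, mul_smul_comm, mul_comm]
  exact ode_unique' _ _ _ (by rw [h0, coeff_opow_zero]) (aux _ h)
    (aux _ (one_sub_X_mul_deriv_opow b))

theorem opow_zero : opow 0 = 1 := (opow_unique (by simp) (by simp)).symm

theorem opow_one : opow 1 = 1 - X := by
  refine (opow_unique (by simp) ?_).symm
  simp

theorem opow_add (a b : ℝ) : opow (a + b) = opow a * opow b := by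
  refine (opow_unique ?_ ?_).symm
  · rw [coeff_mul]; simp
    have h1 := coeff_opow_zero a
    have h2 := coeff_opow_zero b
    simp at h1 h2
    rw [h1, h2, one_mul]
  · have h1 := one_sub_X_mul_deriv_opow a
    have h2 := one_sub_X_mul_deriv_opow b
    rw [derivative_mul', smul_eq_mul, smul_eq_mul, mul_add, mul_left_comm, h2, mul_left_comm, h1]
    simp only [smul_eq_C_mul, map_add, map_neg]
    ring

theorem one_sub_mul_opow (b : ℝ) : (1 - X) * opow b = opow (1 + b) := by
  rw [opow_add, opow_one]

theorem deriv_opow (b : ℝ) : derivative ℝ (opow b) = (-b) • opow (b - 1) := by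
  have h := one_sub_X_mul_deriv_opow b
  have h2 := one_sub_mul_opow (b - 1)
  rw [add_sub_cancel] at h2
  rw [show (-b) • opow b = (-b) • ((1 - X) * opow (b - 1)) by rw [h2], ← mul_smul_comm] at h
  have : (1 - X : PowerSeries ℝ) ≠ 0 := by
    intro h; have := congrArg (coeff 0) h; simp at this
  exact mul_left_cancel₀ this h

/-- The exponential of a series (with zero constant coefficient). -/
noncomputable def expS (L : PowerSeries ℝ) : PowerSeries ℝ :=
  open Classical in if h : coeff 0 L = 0 then (exists_exp L h).choose else 0

theorem coeff_zero_expS {L : PowerSeries ℝ} (h : coeff 0 L = 0) : coeff 0 (expS L) = 1 := by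
  rw [expS, dif_pos h]; exact (exists_exp L h).choose_spec.1

theorem deriv_expS {L : PowerSeries ℝ} (h : coeff 0 L = 0) :
    derivative ℝ (expS L) = expS L * derivative ℝ L := by
  rw [expS, dif_pos h]; exact (exists_exp L h).choose_spec.2

theorem expS_unique {L E : PowerSeries ℝ} (h : coeff 0 L = 0) (h0 : coeff 0 E = 1)
    (hE : derivative ℝ E = E * derivative ℝ L) : E = expS L :=
  ode_unique' _ _ _ (by rw [h0, coeff_zero_expS h]) hE (deriv_expS h)

theorem coeff_zero_mul' (A B : PowerSeries ℝ) : coeff 0 (A * B) = coeff 0 A * coeff 0 B := by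
  rw [coeff_mul]; simp

theorem expS_add {L M : PowerSeries ℝ} (hL : coeff 0 L = 0) (hM : coeff 0 M = 0) :
    expS (L + M) = expS L * expS M := by
  refine (expS_unique (by rw [map_add, hL, hM, add_zero]) ?_ ?_).symm
  · rw [coeff_zero_mul', coeff_zero_expS hL, coeff_zero_expS hM, one_mul]
  · rw [derivative_mul', deriv_expS hL, deriv_expS hM, map_add]
    simp only [smul_eq_mul]; ring

theorem expS_zero : expS 0 = 1 := (expS_unique (by simp) (by simp) (by simp)).symm

/-- `X - X ^ 2 / 2`. -/
noncomputable def UU : PowerSeries ℝ := X - (1 / 2 : ℝ) • X ^ 2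

theorem deriv_UU : derivative ℝ UU = 1 - X := by
  rw [UU, map_sub, Derivation.map_smul, Derivation.leibniz_pow]
  simp
  rw [show (2 : PowerSeries ℝ) * X = (2 : ℝ) • X by rw [smul_eq_C_mul, map_ofNat], smul_smul]
  norm_num

theorem coeff_zero_UU : coeff 0 UU = 0 := by simp [UU]

/-- `U ^ k / k!`. -/
noncomputable def uu (k : ℕ) : PowerSeries ℝ := (k.factorial : ℝ)⁻¹ • UU ^ k

theorem uu_zero : uu 0 = 1 := by simp [uu]

theorem deriv_uu_zero : derivative ℝ (uu 0) = 0 := by simp [uu_zero]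

theorem deriv_uu_succ (k : ℕ) : derivative ℝ (uu (k + 1)) = (1 - X) * uu k := by
  rw [uu, Derivation.map_smul, Derivation.leibniz_pow, deriv_UU, uu, ← Nat.cast_smul_eq_nsmul ℝ,
    smul_smul, smul_eq_mul, Nat.factorial_succ, mul_smul_comm, mul_comm (1 - X : PowerSeries ℝ)]
  have h := Nat.factorial_ne_zero k
  congr 1
  push_cast
  field_simp

theorem UU_mul_uu (k : ℕ) : UU * uu k = (k + 1 : ℝ) • uu (k + 1) := by
  rw [uu, uu, Nat.factorial_succ, smul_smul, mul_smul_comm, ← pow_succ']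
  have h := Nat.factorial_ne_zero k
  congr 1
  push_cast
  field_simp

theorem X_pow_dvd_uu (k : ℕ) : X ^ k ∣ uu k := by
  rw [uu, smul_eq_C_mul]
  apply Dvd.dvd.mul_left
  apply pow_dvd_pow_of_dvd
  exact ⟨1 - (1 / 2 : ℝ) • X, by rw [UU]; simp only [smul_eq_C_mul]; ring⟩

theorem coeff_mul_eq_zero_of_dvd {n k : ℕ} (hk : n < k) {A : PowerSeries ℝ} (h : X ^ k ∣ A) :
    coeff n A = 0 := X_pow_dvd_iff.1 h n hk

theorem coeff_mul_congr {n : ℕ} {A B : PowerSeries ℝ} (C : PowerSeries ℝ)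
    (h : ∀ i ≤ n, coeff i A = coeff i B) : coeff n (A * C) = coeff n (B * C) := by
  rw [coeff_mul, coeff_mul]
  refine Finset.sum_congr rfl fun x hx => ?_
  have := Finset.HasAntidiagonal.mem_antidiagonal.1 hx
  rw [h _ (by omega)]

theorem coeff_expS_smul_UU (s : ℝ) {i K : ℕ} (hK : i < K) :
    coeff i (expS (s • UU)) = coeff i (∑ k ∈ Finset.range K, s ^ k • uu k) := by
  have stab : ∀ i K, i < K → coeff i (∑ k ∈ Finset.range K, s ^ k • uu k) =
      coeff i (∑ k ∈ Finset.range (i + 1), s ^ k • uu k) := by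
    intro i K hK
    induction K, hK using Nat.le_induction with
    | base => rfl
    | succ K hK ih =>
      rw [Finset.sum_range_succ, map_add, ih, coeff_smul,
        coeff_mul_eq_zero_of_dvd hK (X_pow_dvd_uu K)]
      simp
  have hz : coeff 0 (s • UU) = 0 := by rw [coeff_smul, coeff_zero_UU, smul_zero]
  rw [stab i K hK, ← expS_unique (E := PowerSeries.mk fun i =>
    coeff i (∑ k ∈ Finset.range (i + 1), s ^ k • uu k)) hz]
  · rw [coeff_mk]
  · rw [coeff_mk]; simp [uu_zero]
  · ext j
    have hd : derivative ℝ (∑ k ∈ Finset.range (j + 2), s ^ k • uu k) =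
        (∑ k ∈ Finset.range (j + 1), s ^ k • uu k) * derivative ℝ (s • UU) := by
      rw [Finset.sum_range_succ', map_add, map_sum, Finset.sum_mul]
      simp only [Derivation.map_smul, deriv_uu_zero, deriv_uu_succ, deriv_UU, smul_zero, add_zero]
      refine Finset.sum_congr rfl fun k _ => ?_
      simp only [smul_mul_assoc, mul_smul_comm, smul_smul, pow_succ]
      rw [mul_comm (uu k), mul_comm s]
    rw [coeff_derivative, coeff_mk, ← coeff_derivative, hd]
    refine coeff_mul_congr _ fun i hi => ?_
    rw [coeff_mk, stab i _ (by omega)]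

/-- Lagrange-type coefficient functional. -/
noncomputable def lamF (n : ℕ) : PowerSeries ℝ →ₗ[ℝ] ℝ :=
  (coeff n : PowerSeries ℝ →ₗ[ℝ] ℝ) ∘ₗ LinearMap.mulLeft ℝ ((1 - X) * expS ((n : ℝ) • X))

theorem lamF_apply (n : ℕ) (H : PowerSeries ℝ) :
    lamF n H = coeff n ((1 - X) * expS ((n : ℝ) • X) * H) := rfl

/-- `X (1 - X)⁻¹ d/dX`. -/
noncomputable def thetaT : Derivation ℝ (PowerSeries ℝ) (PowerSeries ℝ) :=
  (X * opow (-1)) • derivative ℝ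

theorem thetaT_apply (H : PowerSeries ℝ) : thetaT H = X * opow (-1) * derivative ℝ H := rfl

theorem one_sub_mul_opow_neg_one : (1 - X) * opow (-1) = 1 := by
  rw [one_sub_mul_opow]; norm_num [opow_zero]

theorem coeff_X_mul_deriv (n : ℕ) (F : PowerSeries ℝ) :
    coeff n (X * derivative ℝ F) = n * coeff n F := by
  cases n with
  | zero => simp
  | succ n => rw [coeff_succ_X_mul, coeff_derivative]; push_cast; ring

theorem coeff_zero_smul_X (c : ℝ) : coeff 0 (c • (X : PowerSeries ℝ)) = 0 := by simp

theorem lamF_thetaT (n : ℕ) (H : PowerSeries ℝ) : lamF n (thetaT H) = n * lamF n H := by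
  rw [lamF_apply, lamF_apply, thetaT_apply]
  set E := expS ((n : ℝ) • X)
  have hE : derivative ℝ E = (n : ℝ) • E := by
    rw [deriv_expS (coeff_zero_smul_X _), Derivation.map_smul]; simp [E]
  have h1 : (1 - X) * E * (X * opow (-1) * derivative ℝ H) = X * derivative ℝ (E * H) -
      (n : ℝ) • (X * (E * H)) := by
    rw [derivative_mul', hE]
    simp only [smul_eq_mul]
    have := one_sub_mul_opow_neg_one
    simp only [smul_eq_C_mul]
    linear_combination (E * X * derivative ℝ H) * this
  have h2 : (1 - X) * E * H = E * H - X * (E * H) := by ring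
  rw [h1, h2, map_sub, map_sub, coeff_smul, coeff_X_mul_deriv, smul_eq_mul]; ring

theorem lamF_uu_mul {n k : ℕ} (h : n < k) (H : PowerSeries ℝ) : lamF n (uu k * H) = 0 := by
  rw [lamF_apply]
  exact coeff_mul_eq_zero_of_dvd h (((X_pow_dvd_uu k).mul_right H).mul_left _)

theorem lamF_expS_mul (n : ℕ) (s : ℝ) (H : PowerSeries ℝ) :
    lamF n (expS (s • UU) * H) = ∑ k ∈ Finset.range (n + 1), s ^ k * lamF n (uu k * H) := by
  have : ∀ k, s ^ k * lamF n (uu k * H) = lamF n (s ^ k • uu k * H) := fun k => by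
    rw [smul_mul_assoc, map_smul, smul_eq_mul]
  simp only [this]
  rw [← map_sum, ← Finset.sum_mul, lamF_apply, lamF_apply, mul_left_comm, mul_left_comm _ (Finset.sum _ _)]
  exact coeff_mul_congr _ fun i hi => coeff_expS_smul_UU s (by omega)

theorem coeff_lam_nonneg (n k j : ℕ) (hj : j ≤ n) :
    0 ≤ coeff j (expS ((n : ℝ) • X) * uu k) ∧
    0 ≤ coeff j ((1 - X) * (expS ((n : ℝ) • X) * uu k)) := by
  have hd : ∀ (F : PowerSeries ℝ) j, coeff (j + 1) ((1 - X) * F) = coeff (j + 1) F - coeff j F := by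
    intro F j; rw [sub_mul, one_mul, map_sub, coeff_succ_X_mul]
  set E := expS ((n : ℝ) • X) with hEd
  have hE : derivative ℝ E = (n : ℝ) • E := by
    rw [deriv_expS (coeff_zero_smul_X _), Derivation.map_smul]; simp [E]
  have h0 : ∀ k, 0 ≤ coeff 0 (E * uu k) := by
    intro k
    rw [coeff_zero_mul', hEd, coeff_zero_expS (coeff_zero_smul_X _), one_mul]
    cases k with
    | zero => simp [uu_zero]
    | succ k => rw [coeff_mul_eq_zero_of_dvd (Nat.succ_pos k) (X_pow_dvd_uu _)]
  induction j generalizing k with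
  | zero =>
    refine ⟨h0 k, ?_⟩
    rw [coeff_zero_mul']; simpa using h0 k
  | succ j ih =>
    have hH := (ih k (by omega)).1
    have key : 0 ≤ coeff (j + 1) ((1 - X) * (E * uu k)) := by
      rw [hd]
      have h1 : coeff (j + 1) (E * uu k) * (j + 1) = coeff j (derivative ℝ (E * uu k)) := by
        rw [coeff_derivative]
      have hjn : (j + 1 : ℝ) ≤ n := by exact_mod_cast hj
      have hj0 : (0 : ℝ) < j + 1 := by positivity
      cases k with
      | zero =>
        rw [derivative_mul', deriv_uu_zero, hE, smul_zero, zero_add, smul_eq_mul, mul_smul_comm,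
          coeff_smul, mul_comm (uu 0) E, smul_eq_mul] at h1
        have : coeff (j + 1) (E * uu 0) * (j + 1) ≥ coeff j (E * uu 0) * (j + 1) := by
          rw [h1, mul_comm]; gcongr
        nlinarith
      | succ k =>
        rw [derivative_mul', deriv_uu_succ, hE, smul_eq_mul, smul_eq_mul, mul_smul_comm, map_add,
          coeff_smul, mul_comm (uu _) E, smul_eq_mul, mul_left_comm] at h1
        have hD := (ih k (by omega)).2
        have : coeff (j + 1) (E * uu (k + 1)) * (j + 1) ≥ coeff j (E * uu (k + 1)) * (j + 1) := by
          rw [h1, mul_comm (coeff j (E * uu (k + 1)))]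
          have : (j + 1 : ℝ) * coeff j (E * uu (k + 1)) ≤ n * coeff j (E * uu (k + 1)) := by gcongr
          linarith
        nlinarith
    refine ⟨?_, key⟩
    rw [hd] at key
    linarith

theorem lamF_uu_nonneg (n k : ℕ) {H : PowerSeries ℝ} (hH : NN1 H) : 0 ≤ lamF n (uu k * H) := by
  rw [lamF_apply, ← mul_assoc, mul_assoc (1 - X : PowerSeries ℝ), coeff_mul]
  refine Finset.sum_nonneg fun x hx => mul_nonneg ?_ (hH _)
  have := Finset.HasAntidiagonal.mem_antidiagonal.1 hx
  exact (coeff_lam_nonneg n k _ (by omega)).2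

theorem lamF_expS_nonneg (n : ℕ) {s : ℝ} (hs : 0 ≤ s) {H : PowerSeries ℝ} (hH : NN1 H) :
    0 ≤ lamF n (expS (s • UU) * H) := by
  rw [lamF_expS_mul]
  exact Finset.sum_nonneg fun k _ => mul_nonneg (by positivity) (lamF_uu_nonneg n k hH)

theorem lamF_of_low {n : ℕ} {H : PowerSeries ℝ} (h : ∀ i < n, coeff i H = 0) :
    lamF n H = coeff n H := by
  rw [lamF_apply, coeff_mul, Finset.sum_eq_single (0, n)]
  · rw [coeff_zero_mul', coeff_zero_expS (coeff_zero_smul_X _)]; simp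
  · intro x hx hne
    have := Finset.HasAntidiagonal.mem_antidiagonal.1 hx
    rw [h, mul_zero]
    rcases Nat.lt_or_ge x.2 n with h | h
    · exact h
    · exact absurd (Prod.ext (by simp; omega) (by simp; omega)) hne
  · intro h; simp at h

end RandomXor

namespace RandomXor
open PowerSeries
variable {e g : ℕ → ℕ → ℝ}

/-- `Σ_m e r m X^m (1 - X)^{-(r + m + y)}`. -/
noncomputable def phiS (e : ℕ → ℕ → ℝ) (y : ℝ) (r : ℕ) : PowerSeries ℝ :=
  ∑ m ∈ Finset.range (2 * r + 1), e r m • (X ^ m * opow (-(r + m + y)))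

theorem deriv_X_pow (m : ℕ) : X * derivative ℝ (X ^ m : PowerSeries ℝ) = (m : ℝ) • X ^ m := by
  ext n
  rw [coeff_X_mul_deriv, coeff_smul, coeff_X_pow]
  split_ifs with h
  · rw [h, smul_eq_mul]
  · simp

theorem X_mul_deriv_pow_opow (m : ℕ) (a : ℝ) : X * derivative ℝ (X ^ m * opow a) =
    (m : ℝ) • (X ^ m * opow a) + (-a) • (X ^ (m + 1) * opow (a - 1)) := by
  rw [derivative_mul', deriv_opow, smul_eq_mul, smul_eq_mul, mul_add, mul_left_comm X (opow a),
    deriv_X_pow]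
  simp only [smul_eq_C_mul]; ring

theorem opow_neg_one_mul (a : ℝ) : opow (-1) * opow a = opow (a - 1) := by
  rw [← opow_add]; congr 1; ring

theorem thetaT_pow_opow (m : ℕ) (a : ℝ) : thetaT (X ^ m * opow a) =
    (m : ℝ) • (X ^ m * opow (a - 1)) + (-a) • (X ^ (m + 1) * opow (a - 2)) := by
  rw [thetaT_apply, mul_comm X, mul_assoc, X_mul_deriv_pow_opow, mul_add, mul_smul_comm,
    mul_smul_comm, mul_left_comm, mul_left_comm (opow (-1)), opow_neg_one_mul, opow_neg_one_mul]
  rw [show a - 1 - 1 = a - 2 by ring]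

theorem thetaT_thetaT_pow_opow (m : ℕ) (a : ℝ) : thetaT (thetaT (X ^ m * opow a)) =
    ((m : ℝ) ^ 2) • (X ^ m * opow (a - 2)) +
    (m * (1 - a) - a * (m + 1)) • (X ^ (m + 1) * opow (a - 3)) +
    (-a * (2 - a)) • (X ^ (m + 2) * opow (a - 4)) := by
  rw [thetaT_pow_opow, map_add, Derivation.map_smul, Derivation.map_smul, thetaT_pow_opow,
    thetaT_pow_opow, sub_sub, sub_sub, sub_sub, sub_sub]
  norm_num only [smul_add, smul_smul]
  simp only [smul_eq_C_mul, map_add, map_sub, map_mul, map_neg, map_pow, Nat.cast_add, Nat.cast_one]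
  ring

theorem phiS_rec (h : CoeffArrays e g) (r : ℕ) :
    ((r + 1 : ℕ) : ℝ) • phiS e (1 / 2) (r + 1) + X * derivative ℝ (phiS e (1 / 2) (r + 1)) -
      (1 / 2 : ℝ) • (X * opow (-1) * phiS e (1 / 2) (r + 1)) =
    (1 / 2 : ℝ) • thetaT (thetaT (phiS e (1 / 2) r)) := by
  have h1 := h.sum_rec (fun m => X ^ m * opow (-(r + m + 5 / 2))) r
  have e1 : (1 / 2 : ℝ) • thetaT (thetaT (phiS e (1 / 2) r)) = (1 / 2 : ℝ) •
      ∑ m ∈ Finset.range (2 * r + 1), e r m • ((m : ℝ) ^ 2 • (X ^ m * opow (-(r + m + 5 / 2)))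
      + ((r + m : ℝ) * (2 * m + 1) + 2 * m + 1 / 2) • (X ^ (m + 1) * opow (-(r + (m + 1 : ℕ) + 5 / 2)))
      + ((r + m : ℝ) * (r + m + 3) + 5 / 4) • (X ^ (m + 2) * opow (-(r + (m + 2 : ℕ) + 5 / 2)))) := by
    rw [phiS, map_sum, map_sum]
    congr 1
    refine Finset.sum_congr rfl fun m _ => ?_
    rw [Derivation.map_smul, Derivation.map_smul, thetaT_thetaT_pow_opow]
    push_cast
    congr 1
    congr 1
    · congr 1
      · congr 3; ring
      · congr 1
        · ring
        · congr 2; ring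
    · congr 1
      · ring
      · congr 2; ring
  rw [e1, ← h1, phiS, show 2 * (r + 1) + 1 = 2 * r + 3 by ring, map_sum, Finset.smul_sum,
    Finset.mul_sum, Finset.mul_sum, Finset.smul_sum, ← Finset.sum_add_distrib,
    ← Finset.sum_sub_distrib]
  refine Finset.sum_congr rfl fun m _ => ?_
  have q1 : opow (-((r + 1 : ℕ) + m + 1 / 2)) = (1 - X) * opow (-(r + m + 5 / 2)) := by
    rw [one_sub_mul_opow]; congr 1; push_cast; ring
  have q2 : opow (-((r + 1 : ℕ) + m + 1 / 2) - 1) = opow (-(r + m + 5 / 2)) := by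
    congr 1; push_cast; ring
  have q3 : X * opow (-1) * (e (r + 1) m • (X ^ m * opow (-((r + 1 : ℕ) + m + 1 / 2)))) =
      e (r + 1) m • (X ^ (m + 1) * opow (-(r + m + 5 / 2))) := by
    rw [mul_smul_comm, mul_assoc, mul_left_comm (opow (-1)), opow_neg_one_mul, q2]
    simp only [smul_eq_C_mul]; ring
  rw [q3, Derivation.map_smul, mul_smul_comm, X_mul_deriv_pow_opow, q2, q1]
  have hC : (C (1 / 2 : ℝ) : PowerSeries ℝ) * 2 = 1 := by
    rw [show (2 : PowerSeries ℝ) = C (2 : ℝ) by rw [map_ofNat], ← map_mul]; norm_num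
  simp only [smul_eq_C_mul, map_add, map_mul, map_neg, Nat.cast_add, Nat.cast_one,
    map_one]
  ring

theorem phiS_zero (h : CoeffArrays e g) (y : ℝ) : phiS e y 0 = opow (-y) := by
  simp [phiS, h.e_zero]

theorem phiS_rec_zero (h : CoeffArrays e g) : X * derivative ℝ (phiS e (1 / 2) 0) -
      (1 / 2 : ℝ) • (X * opow (-1) * phiS e (1 / 2) 0) = 0 := by
  rw [phiS_zero h, deriv_opow, mul_assoc, opow_neg_one_mul]
  simp

theorem phiS_nonneg (he : ∀ r m, 0 ≤ e r m) {y : ℝ} (hy : 0 ≤ y) (r : ℕ) : NN1 (phiS e y r) := by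
  rw [phiS]
  refine Finset.sum_induction _ NN1 (fun _ _ => NN1.add) NN1.zero fun m _ => ?_
  refine NN1.smul (he r m) (NN1.mul ?_ (coeff_opow_nonneg ?_))
  · intro j; rw [coeff_X_pow]; split <;> norm_num
  · have : (0 : ℝ) ≤ r + m + y := by positivity
    linarith

/-- `phiS e (1/2)` extended by zero to negative indices. -/
noncomputable def phiZ (e : ℕ → ℕ → ℝ) (r : ℤ) : PowerSeries ℝ :=
  if 0 ≤ r then phiS e (1 / 2) r.toNat else 0

theorem phiZ_rec (h : CoeffArrays e g) (r : ℤ) :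
    ((r + 1 : ℤ) : ℝ) • phiZ e (r + 1) + X * derivative ℝ (phiZ e (r + 1)) -
      (1 / 2 : ℝ) • (X * opow (-1) * phiZ e (r + 1)) =
    (1 / 2 : ℝ) • thetaT (thetaT (phiZ e r)) := by
  rcases lt_trichotomy r (-1) with hr | rfl | hr
  · simp only [phiZ, if_neg (show ¬ 0 ≤ r + 1 by omega), if_neg (show ¬ 0 ≤ r by omega)]
    simp
  · simp only [phiZ]
    norm_num
    simpa using phiS_rec_zero h
  · lift r to ℕ using (by omega)
    have := phiS_rec h r
    simp only [phiZ, if_pos (show (0 : ℤ) ≤ r + 1 by omega), if_pos (show (0 : ℤ) ≤ r by omega),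
      show ((r : ℤ) + 1).toNat = r + 1 by omega, Int.toNat_natCast]
    exact_mod_cast this

/-- `u_{k-1}`. -/
noncomputable def uu1 : ℕ → PowerSeries ℝ
  | 0 => 0
  | k + 1 => uu k

/-- `u_{k-2}`. -/
noncomputable def uu2 : ℕ → PowerSeries ℝ
  | 0 => 0
  | k + 1 => uu1 k

theorem thetaT_uu (k : ℕ) : thetaT (uu k) = X * uu1 k := by
  cases k with
  | zero => rw [thetaT_apply, deriv_uu_zero]; simp [uu1]
  | succ k =>
    rw [thetaT_apply, deriv_uu_succ, uu1]
    linear_combination (X * uu k) * one_sub_mul_opow_neg_one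

theorem thetaT_uu1 (k : ℕ) : thetaT (uu1 k) = X * uu2 k := by
  cases k with
  | zero => simp [uu1, uu2]
  | succ k => exact thetaT_uu k

theorem thetaT_X : thetaT X = X * opow (-1) := by
  rw [thetaT_apply]; simp

theorem thetaT_thetaT_uu_mul (k : ℕ) (F : PowerSeries ℝ) : thetaT (thetaT (uu k * F)) =
    uu1 k * (X * opow (-1) * F + (2 : ℝ) • (X * thetaT F)) + uu2 k * (X ^ 2 * F)
      + uu k * thetaT (thetaT F) := by
  rw [Derivation.leibniz, thetaT_uu]
  simp only [smul_eq_mul, map_add, Derivation.leibniz, thetaT_uu, thetaT_uu1, thetaT_X]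
  rw [smul_eq_C_mul, map_ofNat]
  ring

/-- Diagonal sums. -/
noncomputable def diagY (e : ℕ → ℕ → ℝ) (n : ℕ) (j : ℤ) (K : ℕ) : ℝ :=
  lamF n (∑ k ∈ Finset.range K, uu k * phiZ e (j + k))

theorem lamF_sum_uu {n K : ℕ} (hK : n < K) (a : ℕ → PowerSeries ℝ) :
    lamF n (∑ k ∈ Finset.range K, uu k * a k) =
      lamF n (∑ k ∈ Finset.range (n + 1), uu k * a k) := by
  induction K, hK using Nat.le_induction with
  | base => rfl
  | succ K hK ih => rw [Finset.sum_range_succ, map_add, ih, lamF_uu_mul hK, add_zero]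

theorem diagY_stab {n K : ℕ} (hK : n < K) (j : ℤ) : diagY e n j K = diagY e n j (n + 1) :=
  lamF_sum_uu hK _

theorem sum_uu1 (K : ℕ) (a : ℕ → PowerSeries ℝ) :
    ∑ k ∈ Finset.range (K + 1), uu1 k * a k = ∑ k ∈ Finset.range K, uu k * a (k + 1) := by
  rw [Finset.sum_range_succ']; simp [uu1]

theorem sum_uu2 (K : ℕ) (a : ℕ → PowerSeries ℝ) :
    ∑ k ∈ Finset.range (K + 1), uu2 k * a k = ∑ k ∈ Finset.range K, uu1 k * a (k + 1) := by
  rw [Finset.sum_range_succ']; simp [uu2]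

theorem uu1_mul_UU (k : ℕ) : uu1 k * (X - (1 / 2 : ℝ) • X ^ 2) = (k : ℝ) • uu k := by
  cases k with
  | zero => simp [uu1]
  | succ k => rw [uu1, mul_comm]; have := UU_mul_uu k; rw [UU] at this; rw [this]; push_cast; rfl

theorem diagY_rec (h : CoeffArrays e g) (n : ℕ) (j : ℤ) :
    (j + n + 1 : ℝ) * diagY e n (j + 1) (n + 1) = (n : ℝ) ^ 2 / 2 * diagY e n j (n + 1) := by
  have st : ∀ K, ∀ a : ℕ → PowerSeries ℝ, n < K → lamF n (∑ k ∈ Finset.range K, uu k * a k) =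
      lamF n (∑ k ∈ Finset.range (n + 1), uu k * a k) := fun K a hK => lamF_sum_uu hK a
  have h1 : (n : ℝ) ^ 2 * diagY e n j (n + 1) =
      lamF n (∑ k ∈ Finset.range (n + 3), thetaT (thetaT (uu k * phiZ e (j + k)))) := by
    rw [← diagY_stab (show n < n + 3 by omega), diagY, ← map_sum, ← map_sum, lamF_thetaT,
      lamF_thetaT]
    ring
  simp only [thetaT_thetaT_uu_mul, Finset.sum_add_distrib, map_add] at h1
  rw [sum_uu1, sum_uu2, sum_uu1, st _ _ (show n < n + 2 by omega), st _ _ (show n < n + 1 by omega),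
    st _ _ (show n < n + 3 by omega), ← st (n + 2) _ (show n < n + 2 by omega),
    ← st (n + 2) (fun k => thetaT (thetaT (phiZ e (j + k)))) (show n < n + 2 by omega)] at h1
  rw [← sum_uu1 (n + 1) (fun k => X ^ 2 * phiZ e (j + (k + 1 : ℕ)))] at h1
  rw [← map_add, ← map_add, ← Finset.sum_add_distrib, ← Finset.sum_add_distrib] at h1
  have h2 : (n : ℝ) * diagY e n (j + 1) (n + 1) =
      lamF n (∑ k ∈ Finset.range (n + 2), thetaT (uu k * phiZ e (j + 1 + k))) := by
    rw [← diagY_stab (show n < n + 2 by omega), diagY, ← map_sum, lamF_thetaT]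
  have h3 : (n : ℝ) ^ 2 * diagY e n j (n + 1) = 2 * ((n : ℝ) * diagY e n (j + 1) (n + 1)) +
      2 * (j + 1) * diagY e n (j + 1) (n + 1) := by
    rw [h1, h2, ← diagY_stab (show n < n + 2 by omega), diagY, ← smul_eq_mul (2 : ℝ), ← map_smul,
      ← smul_eq_mul (2 * ((j : ℝ) + 1)), ← map_smul, ← map_add, Finset.smul_sum, Finset.smul_sum,
      ← Finset.sum_add_distrib]
    congr 1
    refine Finset.sum_congr rfl fun k _ => ?_
    have r1 := phiZ_rec h (j + k)
    rw [show j + (k : ℤ) + 1 = j + 1 + k by ring] at r1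
    rw [show j + ((k + 1 : ℕ) : ℤ) = j + 1 + k by push_cast; ring]
    set F := phiZ e (j + 1 + k)
    have r2 : thetaT (thetaT (phiZ e (j + k))) = (2 : ℝ) • (((j + k + 1 : ℤ) : ℝ) • F + X * derivative ℝ F -
      (1 / 2 : ℝ) • (X * opow (-1) * F)) := by
      rw [show j + (k : ℤ) + 1 = j + 1 + k by ring] 
      rw [r1, smul_smul]; norm_num
    rw [r2, Derivation.leibniz, thetaT_uu, thetaT_apply F]
    have q := uu1_mul_UU k
    have hC : (C (1 / 2 : ℝ) : PowerSeries ℝ) * 2 = 1 := by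
      rw [show (2 : PowerSeries ℝ) = C (2 : ℝ) by rw [map_ofNat], ← map_mul]; norm_num
    have o := one_sub_mul_opow_neg_one
    simp only [smul_eq_C_mul, smul_eq_mul, map_add, map_mul,
      map_one, Int.cast_add, Int.cast_one, Int.cast_natCast, map_ofNat] at q ⊢
    linear_combination (-(F * 2)) * q - (uu1 k * X ^ 2 * F + uu k * X * opow (-1) * F) * hC
      - 2 * uu k * X * derivative ℝ F * o
  linear_combination -h3 / 2

theorem lamF_uu_self (n : ℕ) {H : PowerSeries ℝ} (hH : coeff 0 H = 1) :
    lamF n (uu n * H) = (n.factorial : ℝ)⁻¹ := by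
  rw [lamF_of_low (fun i hi => coeff_mul_eq_zero_of_dvd hi ((X_pow_dvd_uu n).mul_right H))]
  have : uu n * H = X ^ n * ((n.factorial : ℝ)⁻¹ • ((1 - (1 / 2 : ℝ) • X) ^ n * H)) := by
    rw [uu, UU, show X - (1 / 2 : ℝ) • X ^ 2 = X * (1 - (1 / 2 : ℝ) • (X : PowerSeries ℝ)) by
      simp only [smul_eq_C_mul]; ring, mul_pow]
    simp only [smul_eq_C_mul]; ring
  have h0 := coeff_X_pow_mul ((n.factorial : ℝ)⁻¹ • ((1 - (1 / 2 : ℝ) • X) ^ n * H)) n 0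
  rw [zero_add] at h0
  rw [this, h0, coeff_smul, coeff_zero_mul', hH]
  simp

theorem diagY_eq (h : CoeffArrays e g) (n i : ℕ) : diagY e n (i - n) (n + 1) =
    ((n : ℝ) ^ 2 / 2) ^ i / (i.factorial * n.factorial) := by
  induction i with
  | zero =>
    rw [diagY, Finset.sum_range_succ, Finset.sum_eq_zero]
    · have : phiZ e ((0 : ℕ) - n + n) = opow (-(1 / 2)) := by
        simp [phiZ, phiS_zero h]
      rw [this, zero_add, lamF_uu_self _ (coeff_opow_zero _)]; simp
    · intro k hk
      rw [Finset.mem_range] at hk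
      rw [phiZ, if_neg (by push_cast; omega), mul_zero]
  | succ i ih =>
    have := diagY_rec h n (i - n)
    rw [ih, show ((i : ℤ) - n + 1) = ((i + 1 : ℕ) : ℤ) - n by push_cast; ring] at this
    have hp : (i + 1 : ℝ) ≠ 0 := by positivity
    apply mul_left_cancel₀ hp
    rw [show (((i : ℤ) - n : ℤ) + n + 1 : ℝ) = i + 1 by push_cast; ring] at this
    rw [this, Nat.factorial_succ, pow_succ _ i]
    have h1 := Nat.factorial_ne_zero i
    have h2 := Nat.factorial_ne_zero n
    push_cast
    rw [div_eq_mul_inv, div_eq_mul_inv, div_eq_mul_inv]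
    field_simp

end RandomXor

namespace RandomXor
open PowerSeries
variable {e g : ℕ → ℕ → ℝ}

theorem hasSum_e_half (h : CoeffArrays e g) {σ : ℝ} (hσ : 0 < σ) (n : ℕ) :
    HasSum (fun r : ℕ => σ ^ r * lamF n (expS (σ⁻¹ • UU) * phiS e (1 / 2) r))
      (Real.exp (σ * n ^ 2 / 2) * (σ ^ n)⁻¹ / n.factorial) := by
  let T : ℕ → ℕ → ℝ := fun k i => (σ ^ n)⁻¹ * σ ^ i * lamF n (uu k * phiZ e ((i : ℤ) - n + k))
  have hZ : ∀ r : ℤ, NN1 (phiZ e r) := by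
    intro r; rw [phiZ]; split
    · exact phiS_nonneg h.e_nonneg (by norm_num) _
    · exact NN1.zero
  have hT0 : ∀ k i, 0 ≤ T k i := fun k i => mul_nonneg (by positivity) (lamF_uu_nonneg n k (hZ _))
  have hTs : ∀ i, ∑ k ∈ Finset.range (n + 1), T k i =
      (σ ^ n)⁻¹ / n.factorial * ((σ * n ^ 2 / 2) ^ i / i.factorial) := by
    intro i
    simp only [T]
    rw [← Finset.mul_sum, ← map_sum]
    have := diagY_eq h n i
    rw [diagY] at this
    rw [this]
    have h1 : (σ * (n : ℝ) ^ 2 / 2) ^ i = σ ^ i * ((n : ℝ) ^ 2 / 2) ^ i := by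
      rw [← mul_pow]; congr 1; ring
    rw [h1]
    field_simp
  have hsum : HasSum (fun i => ∑ k ∈ Finset.range (n + 1), T k i)
      (Real.exp (σ * n ^ 2 / 2) * (σ ^ n)⁻¹ / n.factorial) := by
    simp only [hTs]
    have h1 : HasSum (fun i : ℕ => (σ * (n : ℝ) ^ 2 / 2) ^ i / i.factorial)
        (Real.exp (σ * n ^ 2 / 2)) := by
      rw [Real.exp_eq_exp_ℝ]; exact NormedSpace.expSeries_div_hasSum_exp _
    have h2 := h1.mul_left ((σ ^ n)⁻¹ / n.factorial)
    rwa [show (σ ^ n)⁻¹ / n.factorial * Real.exp (σ * n ^ 2 / 2) =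
      Real.exp (σ * n ^ 2 / 2) * (σ ^ n)⁻¹ / n.factorial by ring] at h2
  have hk : ∀ k ∈ Finset.range (n + 1), Summable (T k) := fun k hk =>
    Summable.of_nonneg_of_le (hT0 k)
      (fun i => Finset.single_le_sum (f := fun k => T k i) (fun k _ => hT0 k i) hk) hsum.summable
  have h2 : HasSum (fun i => ∑ k ∈ Finset.range (n + 1), T k i)
      (∑ k ∈ Finset.range (n + 1), ∑' i, T k i) := hasSum_sum fun k hk' => (hk k hk').hasSum
  have h3 : ∀ k ∈ Finset.range (n + 1), HasSum (fun r : ℕ => σ ^ r * ((σ⁻¹) ^ k *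
      lamF n (uu k * phiS e (1 / 2) r))) (∑' i, T k i) := by
    intro k hk'
    have hkn : k ≤ n := by simpa [Nat.lt_succ_iff] using hk'
    have inj : Function.Injective (fun r : ℕ => r + (n - k)) := fun a b hab => by simpa using hab
    have := (inj.hasSum_iff (f := T k) (a := ∑' i, T k i) ?_).2 (hk k hk').hasSum
    · convert this using 2 with r
      simp only [T, Function.comp]
      have e1 : ((r + (n - k) : ℕ) : ℤ) - n + k = r := by omega
      rw [e1, phiZ, if_pos (by omega), Int.toNat_natCast, pow_add, pow_sub₀ _ hσ.ne' hkn, inv_pow]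
      field_simp
    · intro i hi
      have hik : i < n - k := by
        by_contra hc
        exact hi ⟨i - (n - k), by simp only; omega⟩
      simp only [T]
      rw [phiZ, if_neg (by omega)]
      simp
  have h4 := hasSum_sum h3
  rw [hsum.unique h2]
  convert h4 using 2 with r
  rw [lamF_expS_mul, Finset.mul_sum]

/-- The contour coefficients `[τ^n] e^{N U + n τ} τ^m (1 - τ)^{1 - y}`. -/
noncomputable def BB (n : ℕ) (N : ℝ) (m : ℕ) (y : ℝ) : ℝ :=
  lamF n (expS (N • UU) * (X ^ m * opow (-y)))

theorem NN1.X_pow (m : ℕ) : NN1 (PowerSeries.X ^ m) := fun j => by rw [coeff_X_pow]; split <;> norm_num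

theorem BB_nonneg (n : ℕ) {N : ℝ} (hN : 0 ≤ N) (m : ℕ) {y : ℝ} (hy : 0 ≤ y) : 0 ≤ BB n N m y :=
  lamF_expS_nonneg n hN ((NN1.X_pow m).mul (coeff_opow_nonneg (by linarith)))

theorem lamF_phiS (n : ℕ) (N : ℝ) (c : ℕ → ℕ → ℝ) (y : ℝ) (r : ℕ) :
    lamF n (expS (N • UU) * phiS c y r) =
      ∑ m ∈ Finset.range (2 * r + 1), c r m * BB n N m (r + m + y) := by
  rw [phiS, Finset.mul_sum, map_sum]
  refine Finset.sum_congr rfl fun m _ => ?_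
  rw [mul_smul_comm, map_smul, smul_eq_mul, BB]

theorem phiS_mul_opow (c : ℕ → ℕ → ℝ) (y z : ℝ) (r : ℕ) :
    opow (-z) * phiS c y r = phiS c (y + z) r := by
  rw [phiS, phiS, Finset.mul_sum]
  refine Finset.sum_congr rfl fun m _ => ?_
  rw [mul_smul_comm, mul_left_comm, ← opow_add]
  congr 3; ring

theorem phiS_conv (h : CoeffArrays e g) (r : ℕ) :
    ∑ x ∈ Finset.HasAntidiagonal.antidiagonal r, phiS g 0 x.1 * phiS g 0 x.2 = phiS e 0 r := by
  have inner : ∀ x ∈ Finset.HasAntidiagonal.antidiagonal r, phiS g 0 x.1 * phiS g 0 x.2 =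
      ∑ m ∈ Finset.range (2 * r + 1), (∑ y ∈ Finset.HasAntidiagonal.antidiagonal m,
        g x.1 y.1 * g x.2 y.2) • (X ^ m * opow (-(r + m + 0))) := by
    intro x hx
    have hx := Finset.HasAntidiagonal.mem_antidiagonal.1 hx
    rw [phiS, phiS, Finset.sum_mul_sum, ← Finset.sum_product']
    simp only [Finset.sum_smul]
    have hterm : ∀ a b : ℕ, (g x.1 a • (X ^ a * opow (-(x.1 + a + 0)))) *
        (g x.2 b • (X ^ b * opow (-(x.2 + b + 0)))) =
        (g x.1 a * g x.2 b) • (X ^ (a + b) * opow (-(r + (a + b : ℕ) + 0))) := by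
      intro a b
      have : opow (-(r + (a + b : ℕ) + 0)) = opow (-(x.1 + a + 0)) * opow (-(x.2 + b + 0)) := by
        rw [← opow_add, ← hx]; congr 1; push_cast; ring
      rw [this]
      simp only [smul_eq_C_mul, map_mul]; ring
    simp only [hterm]
    rw [← Finset.sum_fiberwise_of_maps_to (g := fun y : ℕ × ℕ => y.1 + y.2)
      (t := Finset.range (2 * r + 1))]
    · refine Finset.sum_congr rfl fun m _ => ?_
      trans ∑ y ∈ Finset.HasAntidiagonal.antidiagonal m, (g x.1 y.1 * g x.2 y.2) •
        (X ^ (y.1 + y.2) * opow (-(r + (y.1 + y.2 : ℕ) + 0)))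
      · apply Finset.sum_subset
        · intro y hy
          rw [Finset.mem_filter] at hy
          exact Finset.HasAntidiagonal.mem_antidiagonal.2 hy.2
        · intro y hy hy'
          have hy := Finset.HasAntidiagonal.mem_antidiagonal.1 hy
          simp only [Finset.mem_filter, Finset.mem_product, Finset.mem_range, hy, and_true] at hy'
          rcases Nat.lt_or_ge (2 * x.1) y.1 with h1 | h1
          · rw [h.g_eq_zero _ _ h1, zero_mul, zero_smul]
          · rw [h.g_eq_zero x.2 y.2 (by omega), mul_zero, zero_smul]
      · refine Finset.sum_congr rfl fun y hy => ?_
        rw [Finset.HasAntidiagonal.mem_antidiagonal.1 hy]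
    · intro y hy
      simp only [Finset.mem_product, Finset.mem_range] at hy ⊢
      omega
  rw [Finset.sum_congr rfl inner, Finset.sum_comm, phiS]
  refine Finset.sum_congr rfl fun m _ => ?_
  rw [← Finset.sum_smul, h.conv]

end RandomXor

namespace RandomXor
open PowerSeries
variable {e g : ℕ → ℕ → ℝ}

/-- `X * exp (-X)`, the compositional inverse of the tree function. -/
noncomputable def treeZ : PowerSeries ℝ := X * expS ((-1 : ℝ) • X)

theorem lamF_one (n : ℕ) : lamF n 1 = if n = 0 then 1 else 0 := by
  rw [lamF_apply, mul_one]
  have hE : X * derivative ℝ (expS ((n : ℝ) • X)) = (n : ℝ) • (X * expS ((n : ℝ) • X)) := by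
    rw [deriv_expS (coeff_zero_smul_X _), Derivation.map_smul]
    simp
  cases n with
  | zero => simp [expS_zero]
  | succ n =>
    have h := congrArg (coeff (n + 1)) hE
    rw [coeff_X_mul_deriv, coeff_smul, coeff_succ_X_mul, smul_eq_mul] at h
    have h0 : ((n + 1 : ℕ) : ℝ) ≠ 0 := by positivity
    have h := mul_left_cancel₀ h0 h
    rw [sub_mul, one_mul, map_sub, coeff_succ_X_mul, h]
    simp

theorem lamF_zero (A : PowerSeries ℝ) : lamF 0 A = coeff 0 A :=
  lamF_of_low fun i hi => absurd hi (by omega)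

theorem lamF_succ_treeZ_mul (n : ℕ) (A : PowerSeries ℝ) :
    lamF (n + 1) (treeZ * A) = lamF n A := by
  rw [lamF_apply, lamF_apply, treeZ]
  have h : expS (((n + 1 : ℕ) : ℝ) • X) * expS ((-1 : ℝ) • X) = expS ((n : ℝ) • X) := by
    rw [← expS_add (coeff_zero_smul_X _) (coeff_zero_smul_X _), ← add_smul]
    congr 2; push_cast; ring
  rw [← h, ← coeff_succ_X_mul n ((1 - X) * _ * A)]
  congr 1; ring

theorem exists_eq_add_treeZ_mul (A : PowerSeries ℝ) :
    ∃ A', A = C (coeff 0 A) + treeZ * A' := by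
  obtain ⟨B, hB⟩ : ∃ B, A = X * B + C (constantCoeff A) := ⟨_, eq_X_mul_shift_add_const A⟩
  refine ⟨expS ((1 : ℝ) • X) * B, ?_⟩
  have h : expS ((-1 : ℝ) • X) * expS ((1 : ℝ) • X) = 1 := by
    rw [← expS_add (coeff_zero_smul_X _) (coeff_zero_smul_X _), ← add_smul]
    simp [expS_zero]
  rw [coeff_zero_eq_constantCoeff_apply, treeZ, mul_assoc, ← mul_assoc _ _ B, h, one_mul, add_comm, ← hB]

/-- The coefficients with respect to the powers of `X * exp (-X)` multiply like coefficients. -/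
theorem lamF_mul (n : ℕ) (A B : PowerSeries ℝ) : lamF n (A * B) =
    ∑ x ∈ Finset.HasAntidiagonal.antidiagonal n, lamF x.1 A * lamF x.2 B := by
  induction n generalizing A with
  | zero => simp [lamF_zero, coeff_zero_mul']
  | succ n ih =>
    obtain ⟨A', hA⟩ := exists_eq_add_treeZ_mul A
    have h1 : ∀ i, lamF (i + 1) A = lamF i A' := by
      intro i
      rw [hA, map_add, lamF_succ_treeZ_mul, ← mul_one (C _), ← smul_eq_C_mul, map_smul, lamF_one]
      simp
    rw [Finset.Nat.sum_antidiagonal_succ]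
    simp only [h1]
    rw [← ih, lamF_zero]
    conv_lhs => rw [hA, add_mul, map_add, mul_assoc, lamF_succ_treeZ_mul, ← smul_eq_C_mul, map_smul,
      smul_eq_mul]

theorem coeff_le_lamF_expS (n : ℕ) {s : ℝ} (hs : 0 ≤ s) {H : PowerSeries ℝ} (hH : NN1 H) :
    coeff n H ≤ lamF n (expS (s • UU) * H) := by
  rw [lamF_expS_mul]
  refine le_trans ?_ (Finset.single_le_sum (f := fun k => s ^ k * lamF n (uu k * H))
    (fun k _ => mul_nonneg (by positivity) (lamF_uu_nonneg n k hH)) (Finset.mem_range.2 n.succ_pos))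
  simp only [pow_zero, one_mul]
  rw [lamF_apply, ← mul_assoc, mul_assoc (1 - X : PowerSeries ℝ), coeff_mul]
  refine le_trans ?_ (Finset.single_le_sum
    (f := fun x : ℕ × ℕ => coeff x.1 ((1 - X) * (expS ((n : ℝ) • X) * uu 0)) * coeff x.2 H)
    (fun x hx => mul_nonneg ?_ (hH _)) (a := (0, n)) (by simp))
  · simp only [coeff_zero_mul', coeff_zero_expS (coeff_zero_smul_X _), uu_zero]; simp
  · have := Finset.HasAntidiagonal.mem_antidiagonal.1 hx
    exact (coeff_lam_nonneg n 0 _ (by omega)).2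

theorem coeff_le_coeff_opow_mul (n : ℕ) {b : ℝ} (hb : b ≤ 0) {H : PowerSeries ℝ} (hH : NN1 H) :
    coeff n H ≤ coeff n (opow b * H) := by
  rw [coeff_mul]
  refine le_trans ?_ (Finset.single_le_sum
    (f := fun x : ℕ × ℕ => coeff x.1 (opow b) * coeff x.2 H)
    (fun x _ => mul_nonneg (coeff_opow_nonneg hb _) (hH _)) (a := (0, n)) (by simp))
  simp only [coeff_opow_zero, one_mul, le_refl]

theorem hasSum_coeff_mul {c : ℕ → PowerSeries ℝ} {P : PowerSeries ℝ}
    (h : ∀ i, HasSum (fun r => coeff i (c r)) (coeff i P)) (A : PowerSeries ℝ) (n : ℕ) :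
    HasSum (fun r => coeff n (A * c r)) (coeff n (A * P)) := by
  simp only [coeff_mul]
  exact hasSum_sum fun x _ => (h _).mul_left _

theorem hasSum_lamF_mul {c : ℕ → PowerSeries ℝ} {P : PowerSeries ℝ}
    (h : ∀ i, HasSum (fun r => coeff i (c r)) (coeff i P)) (A : PowerSeries ℝ) (n : ℕ) :
    HasSum (fun r => lamF n (A * c r)) (lamF n (A * P)) := by
  simp only [lamF_apply, ← mul_assoc]
  exact hasSum_coeff_mul h _ n

theorem summable_coeff_phiS (h : CoeffArrays e g) {σ : ℝ} (hσ : 0 < σ) (i : ℕ) :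
    Summable (fun r : ℕ => coeff i (σ ^ r • phiS e 0 r)) := by
  refine Summable.of_nonneg_of_le (fun r => ?_) (fun r => ?_) (hasSum_e_half h hσ i).summable
  · rw [coeff_smul]
    exact smul_nonneg (by positivity) (phiS_nonneg h.e_nonneg le_rfl r i)
  · rw [coeff_smul, smul_eq_mul]
    refine mul_le_mul_of_nonneg_left ?_ (by positivity)
    have h1 := phiS_nonneg h.e_nonneg le_rfl r
    refine (coeff_le_coeff_opow_mul i (b := -(1 / 2)) (by norm_num) h1).trans ?_
    rw [phiS_mul_opow, zero_add]
    exact coeff_le_lamF_expS i (by positivity) (phiS_nonneg h.e_nonneg (by norm_num) r)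

theorem coeff_phiS_mono {c d : ℕ → ℕ → ℝ} (hcd : ∀ r m, c r m ≤ d r m) {y : ℝ} (hy : 0 ≤ y)
    (r i : ℕ) : coeff i (phiS c y r) ≤ coeff i (phiS d y r) := by
  rw [phiS, phiS, map_sum, map_sum]
  refine Finset.sum_le_sum fun m _ => ?_
  rw [coeff_smul, coeff_smul, smul_eq_mul, smul_eq_mul]
  refine mul_le_mul_of_nonneg_right (hcd r m) (NN1.mul (NN1.X_pow m) (coeff_opow_nonneg ?_) i)
  have : (0 : ℝ) ≤ r := r.cast_nonneg
  have : (0 : ℝ) ≤ m := m.cast_nonneg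
  linarith

theorem summable_coeff_phiS_g (h : CoeffArrays e g) {σ : ℝ} (hσ : 0 < σ) (i : ℕ) :
    Summable (fun r : ℕ => coeff i (σ ^ r • phiS g 0 r)) := by
  refine Summable.of_nonneg_of_le (fun r => ?_) (fun r => ?_) (summable_coeff_phiS h hσ i)
  · rw [coeff_smul]
    exact smul_nonneg (by positivity) (phiS_nonneg h.g_nonneg le_rfl r i)
  · rw [coeff_smul, coeff_smul, smul_eq_mul, smul_eq_mul]
    exact mul_le_mul_of_nonneg_left (coeff_phiS_mono h.g_le le_rfl r i) (by positivity)

/-- The limit of a coefficientwise convergent series of power series. -/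
noncomputable def sumS (c : ℕ → PowerSeries ℝ) : PowerSeries ℝ :=
  PowerSeries.mk fun i => ∑' r, coeff i (c r)

theorem hasSum_sumS {c : ℕ → PowerSeries ℝ} (hc : ∀ i, Summable fun r => coeff i (c r)) (i : ℕ) :
    HasSum (fun r => coeff i (c r)) (coeff i (sumS c)) := by
  rw [sumS, coeff_mk]; exact (hc i).hasSum

theorem sumS_mul_self (h : CoeffArrays e g) {σ : ℝ} (hσ : 0 < σ) :
    sumS (fun r => σ ^ r • phiS g 0 r) * sumS (fun r => σ ^ r • phiS g 0 r) =
      sumS (fun r => σ ^ r • phiS e 0 r) := by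
  ext n
  have hs := summable_coeff_phiS_g h hσ
  have hn : ∀ i, Summable (fun r : ℕ => ‖coeff i (σ ^ r • phiS g 0 r)‖) := fun i => (hs i).norm
  rw [coeff_mul, sumS, sumS]
  simp only [coeff_mk]
  simp only [tsum_mul_tsum_eq_tsum_sum_antidiagonal_of_summable_norm (hn _) (hn _)]
  rw [← Summable.tsum_finsetSum]
  · congr 1
    ext r
    rw [Finset.sum_comm, ← phiS_conv h r, coeff_smul, map_sum, Finset.smul_sum]
    refine Finset.sum_congr rfl fun x hx => ?_
    have := Finset.HasAntidiagonal.mem_antidiagonal.1 hx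
    rw [← coeff_mul, smul_mul_smul_comm, ← pow_add, this, coeff_smul]
  · intro x _
    exact (summable_norm_sum_mul_antidiagonal_of_summable_norm (hn _) (hn _)).of_norm

theorem eq_of_mul_self_eq {A B : PowerSeries ℝ} (h : A * A = B * B) (hA : 0 < coeff 0 A)
    (hB : 0 < coeff 0 B) : A = B := by
  rcases mul_self_eq_mul_self_iff.1 h with h | h
  · exact h
  · have := congrArg (coeff 0) h
    rw [map_neg] at this
    linarith

theorem coeff_zero_sumS_phiS (h : CoeffArrays e g) (σ : ℝ) :
    coeff 0 (sumS fun r => σ ^ r • phiS g 0 r) = 1 := by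
  have hg : ∀ r, coeff 0 (phiS g 0 r) = g r 0 := by
    intro r
    rw [phiS, map_sum, Finset.sum_range_succ', Finset.sum_eq_zero]
    · simp [coeff_opow_zero, -coeff_zero_eq_constantCoeff]
    · intro m _
      rw [coeff_smul, coeff_zero_mul']; simp
  rw [sumS, coeff_mk]
  simp only [coeff_smul, hg]
  rw [tsum_eq_single 0]
  · simp [h.g_zero]
  · intro r hr
    have he : e r 0 = 0 := by
      obtain ⟨r, rfl⟩ := Nat.exists_eq_succ_of_ne_zero hr
      have := h.e_rec_zero r
      simpa using this
    have := h.g_le r 0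
    have h2 := h.g_nonneg r 0
    rw [show g r 0 = 0 by linarith, smul_zero]

/-- A sequence whose self-convolution is `exp (σ n² / 2) / (σ ^ n n!)` is an explicit series. -/
theorem hasSum_sqrt (h : CoeffArrays e g) {σ : ℝ} (hσ : 0 < σ) {a : ℕ → ℝ} (ha0 : 0 < a 0)
    (ha : ∀ n, ∑ x ∈ Finset.HasAntidiagonal.antidiagonal n, a x.1 * a x.2 =
      Real.exp (σ * n ^ 2 / 2) * (σ ^ n)⁻¹ / n.factorial) (n : ℕ) :
    HasSum (fun r : ℕ => σ ^ r * ∑ m ∈ Finset.range (2 * r + 1),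
      g r m * BB n (2 * σ)⁻¹ m (r + m + 1 / 4)) (a n) := by
  set Ψ := sumS (fun r => σ ^ r • phiS g 0 r) with hΨ
  set Â := expS ((2 * σ)⁻¹ • UU) * opow (-(1 / 4)) * Ψ with hÂ
  have hU : ∀ s : ℝ, coeff 0 (s • UU) = 0 := fun s => by rw [coeff_smul, coeff_zero_UU, smul_zero]
  have hE : expS ((2 * σ)⁻¹ • UU) * expS ((2 * σ)⁻¹ • UU) = expS (σ⁻¹ • UU) := by
    rw [← expS_add (hU _) (hU _), ← add_smul]
    congr 2; field_simp; norm_num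
  have hO : opow (-(1 / 4)) * opow (-(1 / 4)) = opow (-(1 / 2)) := by
    rw [← opow_add]; congr 1; norm_num
  have hAA : Â * Â = expS (σ⁻¹ • UU) * opow (-(1 / 2)) * sumS (fun r => σ ^ r • phiS e 0 r) := by
    rw [← hE, ← hO, ← sumS_mul_self h hσ]; ring
  have hy : ∀ n, lamF n (Â * Â) = Real.exp (σ * n ^ 2 / 2) * (σ ^ n)⁻¹ / n.factorial := by
    intro n
    rw [hAA]
    refine HasSum.unique (hasSum_lamF_mul (hasSum_sumS (summable_coeff_phiS h hσ)) _ n) ?_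
    convert hasSum_e_half h hσ n using 2 with r
    rw [mul_assoc, mul_smul_comm, phiS_mul_opow, zero_add, mul_smul_comm, map_smul, smul_eq_mul]
  have key : PowerSeries.mk (fun n => lamF n Â) = PowerSeries.mk a := by
    refine eq_of_mul_self_eq ?_ ?_ ?_
    · ext n
      rw [coeff_mul, coeff_mul]
      simp only [coeff_mk]
      rw [← lamF_mul, hy, ha]
    · rw [coeff_mk, lamF_zero, hÂ, coeff_zero_mul', coeff_zero_mul', coeff_zero_expS (hU _),
        coeff_opow_zero, hΨ, coeff_zero_sumS_phiS h]
      norm_num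
    · rw [coeff_mk]; exact ha0
  have hn := congrArg (coeff n) key
  rw [coeff_mk, coeff_mk] at hn
  rw [← hn]
  convert hasSum_lamF_mul (hasSum_sumS (summable_coeff_phiS_g h hσ))
    (expS ((2 * σ)⁻¹ • UU) * opow (-(1 / 4))) n using 2 with r
  rw [mul_assoc, mul_smul_comm, phiS_mul_opow, zero_add, mul_smul_comm, map_smul, smul_eq_mul,
    lamF_phiS]

theorem hasSum_e_half' (h : CoeffArrays e g) {σ : ℝ} (hσ : 0 < σ) (n : ℕ) :
    HasSum (fun r : ℕ => (2 * σ) ^ r * ∑ m ∈ Finset.range (2 * r + 1),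
      e r m * BB n (2 * σ)⁻¹ m (r + m + 1 / 2))
      (Real.exp (σ * n ^ 2) * ((2 * σ) ^ n)⁻¹ / n.factorial) := by
  have := hasSum_e_half h (σ := 2 * σ) (by positivity) n
  simp only [lamF_phiS] at this
  convert this using 4
  ring

end RandomXor

namespace RandomXor

/-- Two-colourings constant along edges. -/
abbrev Colouring {V : Type*} (G : SimpleGraph V) : Type _ :=
  {χ : V → Bool // ∀ u v, G.Adj u v → χ u = χ v}

theorem card_colouring {V : Type*} [Finite V] (G : SimpleGraph V) :
    Nat.card (Colouring G) = 2 ^ numComponents G := by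
  have hE : Colouring G ≃ (G.ConnectedComponent → Bool) :=
    { toFun := fun χ c => c.lift χ.1 (by
        intro u v p _
        induction p with
        | nil => rfl
        | cons h p ih => exact (χ.2 _ _ h).trans (ih (by simp_all)))
      invFun := fun f => ⟨fun v => f (G.connectedComponentMk v), fun u v h => by
        exact congrArg f (SimpleGraph.ConnectedComponent.sound h.reachable)⟩
      left_inv := fun χ => by ext v; rfl
      right_inv := fun f => by
        ext c
        induction c using SimpleGraph.ConnectedComponent.ind with
        | h v => rfl }
  rw [Nat.card_congr hE, Nat.card_fun]
  simp [numComponents]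

theorem edgeCount_le {n : ℕ} (G : SimpleGraph (Fin n)) : edgeCount G ≤ n * (n - 1) / 2 := by
  classical
  rw [edgeCount, ← SimpleGraph.coe_edgeFinset, Set.ncard_coe_finset]
  have := G.card_edgeFinset_le_card_choose_two
  rwa [Fintype.card_fin, Nat.choose_two_right] at this

/-- The weighted count of graphs with weight `w` per edge and `1 / 2` per component. -/
noncomputable def graphZ (V : Type*) (w : ℝ) : ℝ :=
  ∑ᶠ G : SimpleGraph V, w ^ edgeCount G * (1 / 2 : ℝ) ^ numComponents G

theorem numComponents_iso {V W : Type*} {G : SimpleGraph V} {H : SimpleGraph W} (f : G ≃g H) :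
    numComponents G = numComponents H := Nat.card_congr f.connectedComponentEquiv

theorem edgeCount_iso {V W : Type*} {G : SimpleGraph V} {H : SimpleGraph W} (f : G ≃g H) :
    edgeCount G = edgeCount H := by
  rw [edgeCount, edgeCount, ← Nat.card_coe_set_eq, ← Nat.card_coe_set_eq]
  exact Nat.card_congr f.mapEdgeSet

theorem graphZ_eq_sum (V : Type*) [Fintype (SimpleGraph V)] (w : ℝ) :
    graphZ V w = ∑ G : SimpleGraph V, w ^ edgeCount G * (1 / 2 : ℝ) ^ numComponents G :=
  finsum_eq_sum_of_fintype _

theorem graphZ_congr {V W : Type*} (f : V ≃ W) (w : ℝ) : graphZ V w = graphZ W w := by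
  rw [graphZ, graphZ]
  refine finsum_eq_of_bijective f.simpleGraph f.simpleGraph.bijective fun G => ?_
  have : G ≃g f.simpleGraph G := SimpleGraph.Iso.comap f.symm G |>.symm
  rw [numComponents_iso this, edgeCount_iso this]

open Classical in
theorem sum_pow_edgeCount {V : Type*} [Fintype V] (w : ℝ) :
    ∑ G : SimpleGraph V, w ^ edgeCount G = (1 + w) ^ (Fintype.card V).choose 2 := by
  rw [← SimpleGraph.card_edgeFinset_top_eq_card_choose_two, add_comm, ← Finset.prod_const,
    Finset.prod_add_one]
  refine Finset.sum_bij (fun G _ => G.edgeFinset) ?_ ?_ ?_ ?_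
  · intro G _
    rw [Finset.mem_powerset]
    exact SimpleGraph.edgeFinset_mono le_top
  · intro G _ H _ h
    simpa using h
  · intro s hs
    rw [Finset.mem_powerset] at hs
    refine ⟨SimpleGraph.fromEdgeSet s, Finset.mem_univ _, ?_⟩
    ext x
    have := @hs x
    simp at this ⊢
    tauto
  · intro G _
    rw [Finset.prod_const, edgeCount, ← SimpleGraph.coe_edgeFinset, Set.ncard_coe_finset]

/-- Graphs without edges between `p` and its complement. -/
def splitEquiv {V : Type*} (p : V → Prop) :
    {G : SimpleGraph V // ∀ u v, G.Adj u v → (p u ↔ p v)} ≃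
      SimpleGraph {v // p v} × SimpleGraph {v // ¬ p v} where
  toFun G := (G.1.comap Subtype.val, G.1.comap Subtype.val)
  invFun H := ⟨
    { Adj := fun u v => (∃ hu hv, H.1.Adj ⟨u, hu⟩ ⟨v, hv⟩) ∨ (∃ hu hv, H.2.Adj ⟨u, hu⟩ ⟨v, hv⟩)
      symm := ⟨by
        rintro u v (⟨a, b, h⟩ | ⟨a, b, h⟩)
        · exact Or.inl ⟨b, a, h.symm⟩
        · exact Or.inr ⟨b, a, h.symm⟩⟩
      loopless := ⟨by
        rintro u (⟨a, b, h⟩ | ⟨a, b, h⟩)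
        · exact h.ne rfl
        · exact h.ne rfl⟩ }, by
    rintro u v (⟨a, b, h⟩ | ⟨a, b, h⟩)
    · exact iff_of_true a b
    · exact iff_of_false a b⟩
  left_inv G := by
    ext u v
    have h := G.2 u v
    by_cases hu : p u <;> by_cases hv : p v <;> simp_all
  right_inv H := by
    ext u v <;> have hu := u.2 <;> have hv := v.2 <;> simp_all

open Classical in
/-- A graph split by `p` is a disjoint sum. -/
noncomputable def splitIso {V : Type*} {p : V → Prop} {G : SimpleGraph V}
    (h : ∀ u v, G.Adj u v → (p u ↔ p v)) :
    ((G.comap (Subtype.val : {v // p v} → V)) ⊕g (G.comap (Subtype.val : {v // ¬ p v} → V))) ≃g G where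
  toEquiv := Equiv.sumCompl p
  map_rel_iff' := by
    rintro (u | u) (v | v)
    · simp
    · simp; intro huv; exact v.2 ((h _ _ huv).1 u.2)
    · simp; intro huv; exact u.2 ((h _ _ huv).2 v.2)
    · simp

theorem edgeCount_sum {V W : Type*} [Finite V] [Finite W] (G : SimpleGraph V) (H : SimpleGraph W) :
    edgeCount (G ⊕g H) = edgeCount G + edgeCount H := by
  rw [edgeCount, edgeCount, edgeCount, ← Nat.card_coe_set_eq, ← Nat.card_coe_set_eq,
    ← Nat.card_coe_set_eq, Nat.card_congr SimpleGraph.edgeSetSumEquiv, Nat.card_sum]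

theorem numComponents_sum {V W : Type*} [Finite V] [Finite W] (G : SimpleGraph V)
    (H : SimpleGraph W) : numComponents (G ⊕g H) = numComponents G + numComponents H := by
  apply Nat.pow_right_injective (le_refl 2)
  simp only
  rw [pow_add, ← card_colouring, ← card_colouring, ← card_colouring, ← Nat.card_prod]
  refine Nat.card_congr
    { toFun := fun χ => (⟨fun v => χ.1 (Sum.inl v), fun u v h => χ.2 _ _ (by simpa using h)⟩,
        ⟨fun v => χ.1 (Sum.inr v), fun u v h => χ.2 _ _ (by simpa using h)⟩)
      invFun := fun χ => ⟨Sum.elim χ.1.1 χ.2.1, by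
        rintro (u | u) (v | v) h
        · exact χ.1.2 u v (by simpa using h)
        · simp at h
        · simp at h
        · exact χ.2.2 u v (by simpa using h)⟩
      left_inv := fun χ => by ext (v | v) <;> rfl
      right_inv := fun χ => rfl }

open Classical in
theorem graphZ_mul_graphZ {V : Type*} [Fintype V] (p : V → Prop) (w : ℝ) :
    graphZ {v // p v} w * graphZ {v // ¬ p v} w =
      ∑ G : SimpleGraph V with ∀ u v, G.Adj u v → (p u ↔ p v),
        w ^ edgeCount G * (1 / 2 : ℝ) ^ numComponents G := by
  let i1 : Fintype (SimpleGraph {v // p v}) := Fintype.ofFinite _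
  let i2 : Fintype (SimpleGraph {v // ¬ p v}) := Fintype.ofFinite _
  rw [graphZ_eq_sum, graphZ_eq_sum, Finset.sum_mul_sum, ← Fintype.sum_prod_type']
  trans ∑ G : {G : SimpleGraph V // ∀ u v, G.Adj u v → (p u ↔ p v)},
    w ^ edgeCount G.1 * (1 / 2 : ℝ) ^ numComponents G.1
  · symm
    refine Fintype.sum_equiv (splitEquiv p) _ _ ?_
    rintro ⟨G, hG⟩
    have h1 := edgeCount_iso (splitIso (p := p) (G := G) hG)
    have h2 := numComponents_iso (splitIso (p := p) (G := G) hG)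
    rw [edgeCount_sum] at h1
    rw [numComponents_sum] at h2
    simp only [splitEquiv, Equiv.coe_fn_mk, ← h1, ← h2, pow_add]
    ring
  · symm
    exact Finset.sum_subtype _ (by simp) _

open Classical in
theorem sum_graphZ_mul {V : Type*} [Fintype V] (w : ℝ) :
    ∑ s : Finset V, graphZ {v // v ∈ s} w * graphZ {v // v ∉ s} w =
      (1 + w) ^ (Fintype.card V).choose 2 := by
  rw [Finset.sum_congr rfl fun s _ => graphZ_mul_graphZ (· ∈ s) w]
  simp only [Finset.sum_filter]
  rw [Finset.sum_comm, ← sum_pow_edgeCount]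
  refine Finset.sum_congr rfl fun G _ => ?_
  trans ∑ s : Finset V with ∀ u v, G.Adj u v → (u ∈ s ↔ v ∈ s),
    w ^ edgeCount G * (1 / 2 : ℝ) ^ numComponents G
  · rw [Finset.sum_filter]
    exact Finset.sum_congr rfl fun s _ => by congr
  rw [Finset.sum_const, nsmul_eq_mul]
  have : (Finset.univ.filter fun s : Finset V => ∀ u v, G.Adj u v → (u ∈ s ↔ v ∈ s)).card =
      2 ^ numComponents G := by
    rw [← card_colouring, ← Fintype.card_subtype, ← Nat.card_eq_fintype_card]
    refine Nat.card_congr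
      { toFun := fun s => ⟨fun v => decide (v ∈ s.1), fun u v h => by simpa using s.2 u v h⟩
        invFun := fun χ => ⟨Finset.univ.filter fun v => χ.1 v = true, fun u v h => by
          simp [χ.2 u v h]⟩
        left_inv := fun s => by ext; simp
        right_inv := fun χ => by ext; simp }
  rw [this]
  push_cast
  rw [mul_left_comm, ← mul_pow]
  norm_num

theorem graphZ_of_card {V : Type*} [Fintype V] {n : ℕ} (h : Fintype.card V = n) (w : ℝ) :
    graphZ V w = graphZ (Fin n) w := graphZ_congr (Fintype.equivFinOfCardEq h) w

theorem sum_choose_graphZ (n : ℕ) (w : ℝ) :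
    ∑ k ∈ Finset.range (n + 1), (n.choose k : ℝ) * (graphZ (Fin k) w * graphZ (Fin (n - k)) w) =
      (1 + w) ^ n.choose 2 := by
  classical
  have h := sum_graphZ_mul (V := Fin n) w
  rw [Fintype.card_fin] at h
  rw [← h]
  have := Finset.sum_powerset_apply_card (x := (Finset.univ : Finset (Fin n)))
    (fun k => graphZ (Fin k) w * graphZ (Fin (n - k)) w)
  simp only [Finset.powerset_univ, Finset.card_univ, Fintype.card_fin, nsmul_eq_mul] at this
  rw [← this]
  refine Finset.sum_congr rfl fun s _ => ?_
  rw [graphZ_of_card (V := {v // v ∈ s}) (n := s.card) (by simp),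
    ← graphZ_of_card (V := {v // v ∉ s}) (n := n - s.card) (by
      rw [Fintype.card_subtype_compl]; simp)]

theorem sum_weight_eq (n : ℕ) {p : ℝ} (hp : 1 - p ≠ 0) (inst : Fintype (SimpleGraph (Fin n))) :
    ∑ G : SimpleGraph (Fin n), p ^ edgeCount G * (1 - p) ^ (n * (n - 1) / 2 - edgeCount G) *
      (1 / 2 : ℝ) ^ XG G =
    2 ^ n * (1 - p) ^ (n * (n - 1) / 2) * graphZ (Fin n) (p / (2 * (1 - p))) := by
  rw [graphZ_eq_sum, Finset.mul_sum]
  refine Finset.sum_congr rfl fun G _ => ?_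
  rw [pow_sub₀ _ hp (edgeCount_le G), XG, zpow_add₀ (by norm_num), zpow_sub₀ (by norm_num),
    Fintype.card_fin, zpow_natCast, zpow_natCast, zpow_natCast, div_pow p, mul_pow]
  field_simp
  rw [mul_assoc, ← mul_pow, ← mul_pow]; norm_num
  rw [mul_assoc, ← mul_pow]; norm_num

theorem sum_antidiagonal_graphZ {σ : ℝ} (hσ : 0 < σ) (n : ℕ) :
    ∑ x ∈ Finset.HasAntidiagonal.antidiagonal n,
      (graphZ (Fin x.1) (Real.exp σ - 1) * Real.exp (σ * x.1 / 2) / (σ ^ x.1 * x.1.factorial)) *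
      (graphZ (Fin x.2) (Real.exp σ - 1) * Real.exp (σ * x.2 / 2) / (σ ^ x.2 * x.2.factorial)) =
      Real.exp (σ * n ^ 2 / 2) * (σ ^ n)⁻¹ / n.factorial := by
  have h := sum_choose_graphZ n (Real.exp σ - 1)
  rw [← Finset.Nat.sum_antidiagonal_eq_sum_range_succ (fun i j => (n.choose i : ℝ) *
    (graphZ (Fin i) (Real.exp σ - 1) * graphZ (Fin j) (Real.exp σ - 1))), add_sub_cancel,
    ← Real.exp_nat_mul] at h
  have h2 : Real.exp (σ * n ^ 2 / 2) = Real.exp (n.choose 2 * σ) * Real.exp (σ * n / 2) := by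
    rw [← Real.exp_add, Nat.cast_choose_two]; congr 1; ring
  rw [h2, ← h, Finset.sum_mul, Finset.sum_mul, Finset.sum_div]
  refine Finset.sum_congr rfl fun x hx => ?_
  have hx := Finset.HasAntidiagonal.mem_antidiagonal.1 hx
  have h3 : Real.exp (σ * n / 2) = Real.exp (σ * x.1 / 2) * Real.exp (σ * x.2 / 2) := by
    rw [← Real.exp_add, ← hx]; congr 1; push_cast; ring
  have h4 : (n.choose x.1 : ℝ) = n.factorial / (x.1.factorial * x.2.factorial) := by
    rw [← hx, Nat.cast_add_choose]
  have h5 : σ ^ n = σ ^ x.1 * σ ^ x.2 := by rw [← pow_add, hx]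
  have := Nat.factorial_ne_zero n
  rw [h3, h4, h5]
  field_simp

end RandomXor

namespace RandomXor
variable {e g : ℕ → ℕ → ℝ}

/-- The edge probability. -/
noncomputable def pN (lam : ℝ) (n : ℕ) : ℝ := (1 + lam * (n : ℝ) ^ (-(1 : ℝ) / 3)) / n

/-- The logarithmic edge weight. -/
noncomputable def sigP (p : ℝ) : ℝ := Real.log ((1 - p / 2) / (1 - p))

/-- The normalizing constant. -/
noncomputable def CC (p : ℝ) (n : ℕ) : ℝ :=
  n.factorial * (2 * sigP p) ^ n * (1 - p) ^ (n * (n - 1) / 2) * Real.exp (-(sigP p * n / 2))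

theorem exp_sigP {p : ℝ} (h1 : p < 1) :
    Real.exp (sigP p) = (1 - p / 2) / (1 - p) := by
  rw [sigP, Real.exp_log]
  apply div_pos <;> linarith

theorem sigP_pos {p : ℝ} (h0 : 0 < p) (h1 : p < 1) : 0 < sigP p := by
  apply Real.log_pos
  rw [lt_div_iff₀] <;> linarith

theorem hasSum_solvProb (h : CoeffArrays e g) {lam : ℝ} {n : ℕ} (h0 : 0 < pN lam n)
    (h1 : pN lam n < 1) :
    HasSum (fun r : ℕ => CC (pN lam n) n * (sigP (pN lam n) ^ r *
      ∑ m ∈ Finset.range (2 * r + 1), g r m * BB n (2 * sigP (pN lam n))⁻¹ m (r + m + 1 / 4)))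
      (solvProb lam n) := by
  set p := pN lam n with hp
  have hσ := sigP_pos h0 h1
  set σ := sigP p with hσd
  have hq : 1 - p ≠ 0 := by linarith
  have hw : p / (2 * (1 - p)) = Real.exp σ - 1 := by
    rw [exp_sigP h1]; field_simp; ring
  have key := hasSum_sqrt h hσ (a := fun k => graphZ (Fin k) (Real.exp σ - 1) *
    Real.exp (σ * k / 2) / (σ ^ k * k.factorial)) (by
      rw [graphZ_eq_sum]
      refine div_pos (mul_pos (Finset.sum_pos (fun G _ => ?_) Finset.univ_nonempty)
        (Real.exp_pos _)) (by positivity)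
      rw [edgeCount, Set.eq_empty_of_isEmpty G.edgeSet]
      simp) (sum_antidiagonal_graphZ hσ) n
  have := key.mul_left (CC p n)
  suffices hs : solvProb lam n = CC p n * (graphZ (Fin n) (Real.exp σ - 1) *
      Real.exp (σ * n / 2) / (σ ^ n * n.factorial)) by rw [hs]; exact this
  rw [solvProb]
  change ∑ G : SimpleGraph (Fin n), p ^ edgeCount G * (1 - p) ^ (n * (n - 1) / 2 - edgeCount G) *
    (1 / 2 : ℝ) ^ XG G = _
  rw [sum_weight_eq n hq, hw, CC, ← hσd, Real.exp_neg]
  have := Nat.factorial_ne_zero n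
  have h3 := Real.exp_ne_zero (σ * n / 2)
  field_simp
  rw [mul_pow]; ring

theorem hasSum_dominating (h : CoeffArrays e g) {p : ℝ} (h0 : 0 < p) (h1 : p < 1) (n : ℕ) :
    HasSum (fun r : ℕ => CC p n * ((2 * sigP p) ^ r * ∑ m ∈ Finset.range (2 * r + 1),
      e r m * BB n (2 * sigP p)⁻¹ m (r + m + 1 / 2)))
      ((1 - p) ^ (n * (n - 1) / 2) * Real.exp (sigP p * n ^ 2 - sigP p * n / 2)) := by
  have hσ := sigP_pos h0 h1
  have := (hasSum_e_half' h hσ n).mul_left (CC p n)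
  suffices hs : (1 - p) ^ (n * (n - 1) / 2) * Real.exp (sigP p * n ^ 2 - sigP p * n / 2) =
      CC p n * (Real.exp (sigP p * n ^ 2) * ((2 * sigP p) ^ n)⁻¹ / n.factorial) by
    rw [hs]; exact this
  rw [CC, sub_eq_add_neg (sigP p * _), Real.exp_add]
  have := Nat.factorial_ne_zero n
  field_simp

end RandomXor

namespace RandomXor
open PowerSeries

theorem lamF_mul_eq_sum (n : ℕ) (A H : PowerSeries ℝ) :
    lamF n (A * H) = ∑ k ∈ Finset.range (n + 1), coeff k H * lamF n (A * X ^ k) := by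
  rw [lamF_apply, ← mul_assoc, mul_comm _ H, coeff_mul,
    Finset.Nat.sum_antidiagonal_eq_sum_range_succ_mk]
  refine Finset.sum_congr rfl fun k hk => ?_
  rw [lamF_apply, ← mul_assoc, coeff_mul_X_pow', if_pos (by simpa [Nat.lt_succ_iff] using hk)]

theorem BB_eq_sum (n : ℕ) (N : ℝ) (m : ℕ) (y : ℝ) :
    BB n N m y = ∑ k ∈ Finset.range (n + 1), coeff k (opow (-y)) * BB n N (m + k) 0 := by
  rw [BB, ← mul_assoc, lamF_mul_eq_sum]
  refine Finset.sum_congr rfl fun k _ => ?_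
  rw [BB, neg_zero, opow_zero, mul_one, pow_add, mul_assoc]

theorem coeff_opow_neg_mono {y z : ℝ} (hy : 0 ≤ y) (hyz : y ≤ z) (k : ℕ) :
    coeff k (opow (-y)) ≤ coeff k (opow (-z)) := by
  rw [opow, opow, coeff_mk, coeff_mk]
  refine Finset.prod_le_prod (fun i _ => ?_) fun i _ => ?_
  · have : (0 : ℝ) ≤ i := i.cast_nonneg
    apply div_nonneg <;> linarith
  · gcongr

theorem BB_mono (n : ℕ) {N : ℝ} (hN : 0 ≤ N) (m : ℕ) {y z : ℝ} (hy : 0 ≤ y) (hyz : y ≤ z) :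
    BB n N m y ≤ BB n N m z := by
  rw [BB_eq_sum, BB_eq_sum n N m z]
  exact Finset.sum_le_sum fun k _ => mul_le_mul_of_nonneg_right (coeff_opow_neg_mono hy hyz k)
    (BB_nonneg n hN _ le_rfl)

theorem Gamma_mul_coeff_opow {y : ℝ} (hy : 0 < y) (k : ℕ) :
    Real.Gamma y * coeff k (opow (-y)) = Real.Gamma (y + k) / k.factorial := by
  induction k with
  | zero => rw [coeff_opow_zero]; simp
  | succ k ih =>
    have h := coeff_opow_succ (-y) k
    have hk : (k + 1 : ℝ) ≠ 0 := by positivity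
    have hyk : y + k ≠ 0 := by positivity
    rw [← mul_left_inj' hk, mul_assoc, h, mul_left_comm, ih, Nat.cast_succ, ← add_assoc,
      Real.Gamma_add_one hyk, Nat.factorial_succ]
    push_cast
    field_simp
    ring

theorem Gamma_mul_BB (n : ℕ) (N : ℝ) (m : ℕ) {y : ℝ} (hy : 0 < y) :
    Real.Gamma y * BB n N m y =
      ∑ k ∈ Finset.range (n + 1), BB n N (m + k) 0 / k.factorial * Real.Gamma (y + k) := by
  rw [BB_eq_sum, Finset.mul_sum]
  refine Finset.sum_congr rfl fun k _ => ?_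
  rw [← mul_assoc, Gamma_mul_coeff_opow hy]; ring

theorem Gamma_mul_BB_convex (n : ℕ) {N : ℝ} (hN : 0 ≤ N) (m : ℕ) {a b s t : ℝ} (ha : 0 < a)
    (hb : 0 < b) (hs : 0 < s) (ht : 0 < t) (hst : s + t = 1) :
    Real.Gamma (s * a + t * b) * BB n N m (s * a + t * b) ≤
      (Real.Gamma a * BB n N m a) ^ s * (Real.Gamma b * BB n N m b) ^ t := by
  rw [Gamma_mul_BB _ _ _ (by positivity), Gamma_mul_BB _ _ _ ha, Gamma_mul_BB _ _ _ hb]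
  have hc : ∀ k, 0 ≤ BB n N (m + k) 0 / k.factorial := fun k =>
    div_nonneg (BB_nonneg n hN _ le_rfl) (by positivity)
  have hG : ∀ {x : ℝ} (k : ℕ), 0 < x → 0 < Real.Gamma (x + k) := fun k hx =>
    Real.Gamma_pos_of_pos (by positivity)
  have hpq : (1 / s).HolderConjugate (1 / t) := by
    rw [Real.holderConjugate_iff]
    constructor
    · rw [lt_div_iff₀ hs]; linarith
    · simpa using hst
  have := Real.inner_le_Lp_mul_Lq_of_nonneg (Finset.range (n + 1)) hpq
    (f := fun k => (BB n N (m + k) 0 / k.factorial * Real.Gamma (a + k)) ^ s)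
    (g := fun k => (BB n N (m + k) 0 / k.factorial * Real.Gamma (b + k)) ^ t)
    (fun k _ => Real.rpow_nonneg (mul_nonneg (hc k) (hG k ha).le) _)
    (fun k _ => Real.rpow_nonneg (mul_nonneg (hc k) (hG k hb).le) _)
  simp only [one_div_one_div] at this
  have e1 : ∀ k : ℕ, ((BB n N (m + k) 0 / k.factorial * Real.Gamma (a + k)) ^ s) ^ (1 / s) =
      BB n N (m + k) 0 / k.factorial * Real.Gamma (a + k) := fun k => by
    rw [← Real.rpow_mul (mul_nonneg (hc k) (hG k ha).le), mul_one_div_cancel hs.ne', Real.rpow_one]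
  have e2 : ∀ k : ℕ, ((BB n N (m + k) 0 / k.factorial * Real.Gamma (b + k)) ^ t) ^ (1 / t) =
      BB n N (m + k) 0 / k.factorial * Real.Gamma (b + k) := fun k => by
    rw [← Real.rpow_mul (mul_nonneg (hc k) (hG k hb).le), mul_one_div_cancel ht.ne', Real.rpow_one]
  simp only [e1, e2] at this
  refine le_trans (Finset.sum_le_sum fun k _ => ?_) this
  rw [Real.mul_rpow (hc k) (hG k ha).le, Real.mul_rpow (hc k) (hG k hb).le, mul_mul_mul_comm,
    ← Real.rpow_add_of_nonneg (hc k) hs.le ht.le, hst, Real.rpow_one]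
  refine mul_le_mul_of_nonneg_left ?_ (hc k)
  have := Real.Gamma_mul_add_mul_le_rpow_Gamma_mul_rpow_Gamma (s := a + k) (t := b + k) (a := s)
    (b := t) (by positivity) (by positivity) hs ht hst
  refine le_of_eq_of_le ?_ this
  congr 1
  linear_combination (-(k : ℝ)) * hst

theorem Gamma_mul_BB_sq_le (n : ℕ) {N : ℝ} (hN : 0 ≤ N) (m : ℕ) {y : ℝ} (hy : 0 < y) :
    (Real.Gamma (y + 1) * BB n N m (y + 1)) ^ 2 ≤
      (Real.Gamma y * BB n N m y) * (Real.Gamma (y + 2) * BB n N m (y + 2)) := by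
  have h := Gamma_mul_BB_convex n hN m (a := y) (b := y + 2) (s := 1 / 2) (t := 1 / 2) hy
    (by positivity) (by norm_num) (by norm_num) (by norm_num)
  rw [show 1 / 2 * y + 1 / 2 * (y + 2) = y + 1 by ring] at h
  have nn : ∀ z, 0 < z → 0 ≤ Real.Gamma z * BB n N m z := fun z hz =>
    mul_nonneg (Real.Gamma_pos_of_pos hz).le (BB_nonneg n hN m hz.le)
  have h2 := pow_le_pow_left₀ (nn _ (by positivity)) h 2
  rwa [← Real.sqrt_eq_rpow, ← Real.sqrt_eq_rpow, mul_pow (√_), Real.sq_sqrt (nn _ hy),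
    Real.sq_sqrt (nn _ (by positivity))] at h2

theorem Gamma_mul_BB_exchange (n : ℕ) {N : ℝ} (hN : 0 ≤ N) (m : ℕ) {y : ℝ} (hy : 0 < y) :
    (Real.Gamma (y + 1 / 4) * BB n N m (y + 1 / 4)) * (Real.Gamma (1 / 2) * BB n N m (1 / 2)) ≤
      (Real.Gamma (y + 1 / 2) * BB n N m (y + 1 / 2)) * (Real.Gamma (1 / 4) * BB n N m (1 / 4)) := by
  have hd : 0 < y + 1 / 4 := by positivity
  have h1 := Gamma_mul_BB_convex n hN m (a := 1 / 4) (b := y + 1 / 2) (s := 1 / 4 / (y + 1 / 4))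
    (t := y / (y + 1 / 4)) (by norm_num) (by positivity) (by positivity) (by positivity)
    (by field_simp; ring_nf)
  have h2 := Gamma_mul_BB_convex n hN m (a := 1 / 4) (b := y + 1 / 2) (t := 1 / 4 / (y + 1 / 4))
    (s := y / (y + 1 / 4)) (by norm_num) (by positivity) (by positivity) (by positivity)
    (by field_simp)
  rw [show 1 / 4 / (y + 1 / 4) * (1 / 4) + y / (y + 1 / 4) * (y + 1 / 2) = y + 1 / 4 by
    field_simp; ring] at h1
  rw [show y / (y + 1 / 4) * (1 / 4) + 1 / 4 / (y + 1 / 4) * (y + 1 / 2) = 1 / 2 by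
    field_simp; ring] at h2
  have nn : ∀ z, 0 < z → 0 ≤ Real.Gamma z * BB n N m z := fun z hz =>
    mul_nonneg (Real.Gamma_pos_of_pos hz).le (BB_nonneg n hN m hz.le)
  refine (mul_le_mul h1 h2 (nn _ (by norm_num)) ?_).trans (le_of_eq ?_)
  · exact mul_nonneg (Real.rpow_nonneg (nn _ (by norm_num)) _)
      (Real.rpow_nonneg (nn _ (by positivity)) _)
  · rw [mul_mul_mul_comm, ← Real.rpow_add_of_nonneg (nn _ (by norm_num)) (by positivity)
      (by positivity), ← Real.rpow_add_of_nonneg (nn _ (by positivity)) (by positivity)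
      (by positivity), show 1 / 4 / (y + 1 / 4) + y / (y + 1 / 4) = 1 by field_simp; ring,
      show y / (y + 1 / 4) + 1 / 4 / (y + 1 / 4) = 1 by field_simp, Real.rpow_one,
      Real.rpow_one, mul_comm]

theorem Gamma_half_le {y : ℝ} (hy : 0 ≤ y) :
    Real.Gamma (y + 1 / 2) ≤ (1 + y) * Real.Gamma (y + 1 / 4) := by
  have h := Real.Gamma_mul_add_mul_le_rpow_Gamma_mul_rpow_Gamma (s := y + 1 / 4)
    (t := y + 1 / 4 + 1) (a := 3 / 4) (b := 1 / 4) (by positivity) (by positivity) (by norm_num)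
    (by norm_num) (by norm_num)
  rw [show 3 / 4 * (y + 1 / 4) + 1 / 4 * (y + 1 / 4 + 1) = y + 1 / 2 by ring,
    Real.Gamma_add_one (by positivity)] at h
  have hG : 0 < Real.Gamma (y + 1 / 4) := Real.Gamma_pos_of_pos (by positivity)
  rw [Real.mul_rpow (by positivity) hG.le, mul_left_comm, ← Real.rpow_add hG,
    show (3 : ℝ) / 4 + 1 / 4 = 1 by norm_num, Real.rpow_one] at h
  refine h.trans (mul_le_mul_of_nonneg_right ?_ hG.le)
  calc (y + 1 / 4) ^ ((1 : ℝ) / 4) ≤ (1 + y) ^ ((1 : ℝ) / 4) :=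
        Real.rpow_le_rpow (by positivity) (by linarith) (by norm_num)
    _ ≤ (1 + y) ^ (1 : ℝ) := Real.rpow_le_rpow_of_exponent_le (by linarith) (by norm_num)
    _ = 1 + y := Real.rpow_one _

theorem BB_quarter_mul_le (n : ℕ) {N : ℝ} (hN : 0 ≤ N) (m : ℕ) {y : ℝ} (hy : 0 ≤ y) :
    BB n N m (y + 1 / 4) * BB n N m (1 / 2) ≤
      Real.Gamma (1 / 4) / Real.Gamma (1 / 2) * (1 + y) *
        (BB n N m (y + 1 / 2) * BB n N m (1 / 4)) := by
  have h4 : 0 < Real.Gamma (1 / 4) := Real.Gamma_pos_of_pos (by norm_num)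
  have h2 : 0 < Real.Gamma (1 / 2) := Real.Gamma_pos_of_pos (by norm_num)
  have hG : 0 < Real.Gamma (y + 1 / 4) := Real.Gamma_pos_of_pos (by positivity)
  have key : (Real.Gamma (y + 1 / 4) * BB n N m (y + 1 / 4)) *
      (Real.Gamma (1 / 2) * BB n N m (1 / 2)) ≤
      (Real.Gamma (y + 1 / 2) * BB n N m (y + 1 / 2)) *
        (Real.Gamma (1 / 4) * BB n N m (1 / 4)) := by
    rcases hy.eq_or_lt with rfl | hy
    · rw [zero_add, zero_add, mul_comm]
    · exact Gamma_mul_BB_exchange n hN m hy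
  have hP : 0 ≤ BB n N m (y + 1 / 2) * BB n N m (1 / 4) :=
    mul_nonneg (BB_nonneg n hN m (by positivity)) (BB_nonneg n hN m (by norm_num))
  have h5 := mul_le_mul_of_nonneg_right (Gamma_half_le hy) (mul_nonneg h4.le hP)
  have h6 : Real.Gamma (y + 1 / 4) * (BB n N m (y + 1 / 4) * BB n N m (1 / 2) *
      Real.Gamma (1 / 2)) ≤ Real.Gamma (y + 1 / 4) * (Real.Gamma (1 / 4) * (1 + y) *
        (BB n N m (y + 1 / 2) * BB n N m (1 / 4))) := by nlinarith
  have h7 := le_of_mul_le_mul_left h6 hG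
  rw [← le_div_iff₀ h2] at h7
  refine h7.trans (le_of_eq ?_)
  ring

end RandomXor

namespace RandomXor
open PowerSeries

theorem _root_.HasSum.congr_fun' {f g : ℕ → ℂ} {a : ℂ} (h : HasSum f a) (hfg : ∀ k, g k = f k) :
    HasSum g a := by rwa [funext hfg]

/-- The power series `A` converges to `f` on the open unit disc. -/
def Rep (A : PowerSeries ℝ) (f : ℂ → ℂ) : Prop :=
  ∀ z : ℂ, ‖z‖ < 1 → HasSum (fun k : ℕ => ((coeff k A : ℝ) : ℂ) * z ^ k) (f z)

theorem Rep.mul {A B : PowerSeries ℝ} {f g : ℂ → ℂ} (hA : Rep A f) (hB : Rep B g) :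
    Rep (A * B) (fun z => f z * g z) := by
  intro z hz
  have h1 := (hA z hz)
  have h2 := (hB z hz)
  have s1 := h1.summable.norm
  have s2 := h2.summable.norm
  have h3 := tsum_mul_tsum_eq_tsum_sum_antidiagonal_of_summable_norm s1 s2
  have h4 := (summable_norm_sum_mul_antidiagonal_of_summable_norm s1 s2).of_norm
  rw [h1.tsum_eq, h2.tsum_eq] at h3
  simp only [h3]
  have : (fun k : ℕ => ((coeff k (A * B) : ℝ) : ℂ) * z ^ k) = fun n =>
      ∑ kl ∈ Finset.HasAntidiagonal.antidiagonal n, ((coeff kl.1 A : ℝ) : ℂ) * z ^ kl.1 *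
        (((coeff kl.2 B : ℝ) : ℂ) * z ^ kl.2) := by
    ext n
    rw [coeff_mul, Complex.ofReal_sum, Finset.sum_mul]
    refine Finset.sum_congr rfl fun kl hkl => ?_
    rw [← Finset.HasAntidiagonal.mem_antidiagonal.1 hkl, pow_add, Complex.ofReal_mul]; ring
  rw [this]
  exact h4.hasSum

theorem Rep.X_pow (m : ℕ) : Rep (X ^ m) (fun z => z ^ m) := by
  intro z _
  have := hasSum_ite_eq m (z ^ m)
  convert this using 2 with k
  rw [coeff_X_pow]
  split_ifs with h <;> simp [h]

theorem Rep.expS_smul_X (c : ℝ) : Rep (expS (c • X)) (fun z => Complex.exp (c * z)) := by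
  have hE : PowerSeries.mk (fun k => c ^ k / (k.factorial : ℝ)) = expS (c • X) := by
    refine expS_unique (by simp) (by simp) ?_
    ext k
    rw [coeff_derivative, coeff_mk, Derivation.map_smul, derivative_X, mul_smul_comm, mul_one,
      coeff_smul, coeff_mk, Nat.factorial_succ, smul_eq_mul]
    have : (k + 1 : ℝ) ≠ 0 := by positivity
    have := Nat.factorial_ne_zero k
    push_cast
    field_simp
    ring
  intro z _
  have h1 := NormedSpace.expSeries_div_hasSum_exp (c * z : ℂ)
  rw [← hE, Complex.exp_eq_exp_ℂ]
  refine h1.congr_fun' fun k => ?_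
  rw [coeff_mk, mul_pow]; push_cast; ring

theorem Rep.expS_smul_X_sq (c : ℝ) : Rep (expS (c • X ^ 2)) (fun z => Complex.exp (c * z ^ 2)) := by
  have hE : PowerSeries.mk (fun k => if Even k then c ^ (k / 2) / ((k / 2).factorial : ℝ) else 0) =
      expS (c • X ^ 2) := by
    refine expS_unique (by simp) (by simp) ?_
    ext k
    rw [coeff_derivative, coeff_mk, Derivation.map_smul, derivative_pow, derivative_X]
    rcases k with _ | k
    · simp
    · simp only [Nat.cast_ofNat, mul_one, mul_smul_comm, coeff_smul, smul_eq_mul,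
        show 2 - 1 = 1 by rfl, pow_one]
      rw [show (PowerSeries.mk (fun k => if Even k then c ^ (k / 2) / ((k / 2).factorial : ℝ) else 0)) *
        (2 * X) = (X * PowerSeries.mk (fun k => if Even k then c ^ (k / 2) / ((k / 2).factorial : ℝ) else 0)) * C (2 : ℝ) by
          rw [show (C (2:ℝ) : PowerSeries ℝ) = 2 from map_ofNat C 2]; ring, coeff_mul_C, coeff_succ_X_mul, coeff_mk]
      rcases Nat.even_or_odd k with h | h
      · obtain ⟨j, rfl⟩ := h
        have e1 : (j + j + 1 + 1) / 2 = j + 1 := by omega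
        have e2 : (j + j) / 2 = j := by omega
        rw [if_pos (by use j + 1; ring), if_pos (by use j), e1, e2, Nat.factorial_succ]
        have : (j + 1 : ℝ) ≠ 0 := by positivity
        have := Nat.factorial_ne_zero j
        push_cast
        field_simp
        ring
      · have h1 : ¬ Even k := Nat.not_even_iff_odd.2 h
        have h2 : ¬ Even (k + 1 + 1) := by
          rw [Nat.even_add_one, Nat.even_add_one]; simpa using h1
        rw [if_neg h1, if_neg h2]; simp
  intro z _
  have h1 := NormedSpace.expSeries_div_hasSum_exp (c * z ^ 2 : ℂ)
  rw [← hE, Complex.exp_eq_exp_ℂ]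
  have inj : Function.Injective (fun j : ℕ => 2 * j) := fun a b h => by simpa using h
  refine (inj.hasSum_iff ?_).1 ?_
  · intro k hk
    have : ¬ Even k := fun ⟨j, hj⟩ => hk ⟨j, by simp only; omega⟩
    rw [coeff_mk, if_neg this]; simp
  · refine h1.congr_fun' fun j => ?_
    simp only [Function.comp]
    rw [coeff_mk, if_pos (even_two_mul j), mul_pow, ← pow_mul, Nat.mul_div_cancel_left _ two_pos]
    push_cast; ring

theorem Rep.opow (b : ℝ) : Rep (opow b) (fun z => (1 - z) ^ (b : ℂ)) := by
  intro z hz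
  have h := (Complex.one_add_cpow_hasFPowerSeriesOnBall_zero (a := (b : ℂ)))
  have hz' : -z ∈ Metric.eball (0 : ℂ) 1 := by
    simpa [Metric.mem_eball, edist_zero_right, enorm_eq_nnnorm, ← NNReal.coe_lt_coe] using hz
  have h2 := h.hasSum hz'
  rw [zero_add, ← sub_eq_add_neg] at h2
  suffices hs : (fun k : ℕ => ((coeff k (RandomXor.opow b) : ℝ) : ℂ) * z ^ k) =
      fun n => (binomialSeries ℂ (b : ℂ) n) fun _ => -z by rw [hs]; exact h2
  ext k
  rw [binomialSeries_apply]
  have hc : ∀ k : ℕ, ((coeff k (RandomXor.opow b) : ℝ) : ℂ) = (-1) ^ k * Ring.choose (b : ℂ) k := by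
    intro k
    induction k with
    | zero => rw [coeff_opow_zero]; simp
    | succ k ih =>
      have h1 := coeff_opow_succ b k
      have h3 := Ring.choose_smul_choose (b : ℂ) (Nat.le_succ k)
      rw [Nat.succ_eq_add_one, Nat.choose_succ_self_right, Nat.add_sub_cancel_left,
        Ring.choose_one_right, nsmul_eq_mul] at h3
      have h4 : ((coeff (k + 1) (RandomXor.opow b) : ℝ) : ℂ) * (k + 1) =
          (k - b) * ((coeff k (RandomXor.opow b) : ℝ) : ℂ) := by exact_mod_cast h1
      have hk : (k + 1 : ℂ) ≠ 0 := by exact_mod_cast k.succ_ne_zero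
      apply mul_right_cancel₀ hk
      rw [h4, ih]
      push_cast at h3
      rw [pow_succ]
      linear_combination (-1) ^ k * h3
  rw [hc]
  simp [neg_pow z k]
  ring

end RandomXor

namespace RandomXor
open PowerSeries

theorem integral_exp_int_mul (j : ℤ) :
    ∫ θ in (-Real.pi)..Real.pi, Complex.exp (j * Complex.I * θ) =
      if j = 0 then ((2 * Real.pi : ℝ) : ℂ) else 0 := by
  split_ifs with h
  · subst h; simp [two_mul]
  · have hj : (j : ℂ) * Complex.I ≠ 0 := mul_ne_zero (by exact_mod_cast h) Complex.I_ne_zero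
    rw [integral_exp_mul_complex hj]
    have : Complex.exp (j * Complex.I * Real.pi) = Complex.exp (j * Complex.I * (-Real.pi : ℝ)) := by
      rw [Complex.exp_eq_exp_iff_exists_int]
      exact ⟨j, by push_cast; ring⟩
    rw [this, sub_self, zero_div]

theorem Rep.coeff_eq {A : PowerSeries ℝ} {f : ℂ → ℂ} (h : Rep A f) (n : ℕ) {ρ : ℝ} (h0 : 0 < ρ)
    (h1 : ρ < 1) : ((coeff n A : ℝ) : ℂ) = ((2 * Real.pi : ℝ) : ℂ)⁻¹ *
      ∫ θ in (-Real.pi)..Real.pi, f (ρ * Complex.exp (θ * Complex.I)) *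
        ((ρ * Complex.exp (θ * Complex.I)) ^ n)⁻¹ := by
  have hρ : (ρ : ℂ) ≠ 0 := by exact_mod_cast h0.ne'
  have hnorm : ∀ θ : ℝ, ‖(ρ : ℂ) * Complex.exp (θ * Complex.I)‖ = ρ := fun θ => by
    rw [norm_mul, Complex.norm_exp_ofReal_mul_I, mul_one, Complex.norm_real, Real.norm_of_nonneg h0.le]
  have hs : Summable fun k : ℕ => ‖((coeff k A : ℝ) : ℂ) * (ρ : ℂ) ^ k‖ :=
    (h ρ (by rw [Complex.norm_real, Real.norm_of_nonneg h0.le]; exact h1)).summable.norm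
  have key := intervalIntegral.hasSum_integral_of_dominated_convergence
    (μ := MeasureTheory.volume) (a := -Real.pi) (b := Real.pi)
    (F := fun (k : ℕ) (θ : ℝ) => ((coeff k A : ℝ) : ℂ) * (ρ * Complex.exp (θ * Complex.I)) ^ k *
      ((ρ * Complex.exp (θ * Complex.I)) ^ n)⁻¹)
    (f := fun θ : ℝ => f (ρ * Complex.exp (θ * Complex.I)) *
        ((ρ * Complex.exp (θ * Complex.I)) ^ n)⁻¹)
    (fun k _ => ‖((coeff k A : ℝ) : ℂ) * (ρ : ℂ) ^ k‖ * (ρ ^ n)⁻¹)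
    (fun k => Continuous.aestronglyMeasurable (by
      refine Continuous.mul (by fun_prop) (Continuous.inv₀ (by fun_prop) fun θ => ?_)
      exact pow_ne_zero _ (mul_ne_zero hρ (Complex.exp_ne_zero _))))
    (fun k => Filter.Eventually.of_forall fun θ _ => le_of_eq (by
      rw [norm_mul, norm_mul, norm_mul, norm_inv, norm_pow, norm_pow, norm_pow, hnorm,
        Complex.norm_real ρ, Real.norm_of_nonneg h0.le]))
    (Filter.Eventually.of_forall fun θ _ => hs.mul_right _)
    (by simp only [tsum_mul_right]; exact intervalIntegrable_const)
    (Filter.Eventually.of_forall fun θ _ => (h _ (by rw [hnorm]; exact h1)).mul_right _)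
  have hF : ∀ k : ℕ, ∫ θ in (-Real.pi)..Real.pi, ((coeff k A : ℝ) : ℂ) *
      (ρ * Complex.exp (θ * Complex.I)) ^ k * ((ρ * Complex.exp (θ * Complex.I)) ^ n)⁻¹ =
      if k = n then ((2 * Real.pi : ℝ) : ℂ) * ((coeff n A : ℝ) : ℂ) else 0 := by
    intro k
    have : ∀ θ : ℝ, ((coeff k A : ℝ) : ℂ) *
      (ρ * Complex.exp (θ * Complex.I)) ^ k * ((ρ * Complex.exp (θ * Complex.I)) ^ n)⁻¹ =
      ((coeff k A : ℝ) : ℂ) * (ρ : ℂ) ^ k * ((ρ : ℂ) ^ n)⁻¹ *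
        Complex.exp (((k - n : ℤ) : ℂ) * Complex.I * θ) := by
      intro θ
      rw [mul_pow, mul_pow, ← Complex.exp_nat_mul, ← Complex.exp_nat_mul, mul_inv, ← Complex.exp_neg,
        show ((k - n : ℤ) : ℂ) * Complex.I * θ = k * (θ * Complex.I) + -(n * (θ * Complex.I)) by
          push_cast; ring, Complex.exp_add]
      ring
    simp only [this]
    rw [intervalIntegral.integral_const_mul, integral_exp_int_mul]
    by_cases hk : k = n
    · subst hk
      have := pow_ne_zero k hρ
      simp only [sub_self, if_true]
      field_simp
    · rw [if_neg hk, if_neg (by omega), mul_zero]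
  simp only [hF] at key
  rw [key.unique (hasSum_ite_eq n _), ← mul_assoc, inv_mul_cancel₀, one_mul]
  exact_mod_cast ne_of_gt Real.two_pi_pos

/-- The generating function of `n ↦ BB n N m y`, up to the factor `exp (n z)`. -/
noncomputable def genFun (n : ℕ) (N : ℝ) (m : ℕ) (y : ℝ) (z : ℂ) : ℂ :=
  Complex.exp (n * z + N * (z - z ^ 2 / 2)) * (z ^ m * (1 - z) ^ ((1 - y : ℝ) : ℂ))

theorem rep_BB (n : ℕ) (N : ℝ) (m : ℕ) (y : ℝ) :
    Rep ((1 - X) * expS ((n : ℝ) • X) * (expS (N • UU) * (X ^ m * opow (-y)))) (genFun n N m y) := by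
  have hU : N • UU = N • X + (-(N / 2)) • X ^ 2 := by
    rw [UU, smul_sub, smul_smul, sub_eq_add_neg, neg_smul]; congr 3; ring
  have e1 : (1 - X) * expS ((n : ℝ) • X) * (expS (N • UU) * (X ^ m * opow (-y))) =
      expS ((n : ℝ) • X) * (expS (N • X) * expS ((-(N / 2)) • X ^ 2)) * (X ^ m * opow (1 - y)) := by
    rw [hU, expS_add (by simp) (by simp), sub_eq_add_neg 1 y, ← one_sub_mul_opow]
    ring
  rw [e1]
  have := ((Rep.expS_smul_X n).mul ((Rep.expS_smul_X N).mul (Rep.expS_smul_X_sq (-(N / 2))))).mul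
    ((Rep.X_pow m).mul (Rep.opow (1 - y)))
  convert this using 1
  ext z
  simp only [genFun]
  rw [← Complex.exp_add, ← Complex.exp_add]
  congr 2
  push_cast; ring

theorem BB_eq_integral (n : ℕ) (N : ℝ) (m : ℕ) (y : ℝ) {ρ : ℝ} (h0 : 0 < ρ) (h1 : ρ < 1) :
    ((BB n N m y : ℝ) : ℂ) = ((2 * Real.pi : ℝ) : ℂ)⁻¹ *
      ∫ θ in (-Real.pi)..Real.pi, genFun n N m y (ρ * Complex.exp (θ * Complex.I)) *
        ((ρ * Complex.exp (θ * Complex.I)) ^ n)⁻¹ :=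
  (rep_BB n N m y).coeff_eq n h0 h1

end RandomXor

namespace RandomXor

theorem rpow_le_exp_of_mem {κ s t : ℝ} (hκ : 0 < κ) (h1 : κ ≤ s) (h2 : s ≤ κ + |t|) (b : ℝ) :
    s ^ b ≤ Real.exp (|b| * (|Real.log κ| + κ + |t|)) := by
  have hs : 0 < s := hκ.trans_le h1
  rw [Real.rpow_def_of_pos hs, Real.exp_le_exp, mul_comm]
  have hlog : |Real.log s| ≤ |Real.log κ| + κ + |t| := by
    rw [abs_le]
    have a1 := Real.log_le_log hκ h1
    have a2 := neg_abs_le (Real.log κ)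
    have a3 := Real.log_le_self hs.le
    have a4 := abs_nonneg (Real.log κ)
    have a5 := abs_nonneg t
    constructor <;> linarith
  calc b * Real.log s ≤ |b * Real.log s| := le_abs_self _
    _ = |b| * |Real.log s| := abs_mul _ _
    _ ≤ _ := by gcongr

theorem exp_abs_mul_le (c b t : ℝ) (hc : 0 < c) :
    |b| * |t| - 2 * c * t ^ 2 ≤ b ^ 2 / (4 * c) - c * t ^ 2 := by
  have : |b| * |t| ≤ b ^ 2 / (4 * c) + c * t ^ 2 := by
    rw [← sq_abs b, ← sq_abs t]
    have h := sq_nonneg (|b| - 2 * c * |t|)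
    rw [div_add' _ _ _ (by positivity), le_div_iff₀ (by positivity)]
    nlinarith
  linarith

/-- The point `(1 - κ δ) exp (i δ t)` on the integration circle. -/
noncomputable def circPt (κ δ t : ℝ) : ℂ :=
  ((1 - κ * δ : ℝ) : ℂ) * Complex.exp (((δ * t : ℝ) : ℂ) * Complex.I)

/-- The rescaled integrand in the contour integral for `BB`. -/
noncomputable def scaledInt (κ δ : ℝ) (n : ℕ) (N : ℝ) (m : ℕ) (y t : ℝ) : ℂ :=
  ((Real.exp (-n - N / 2) : ℝ) : ℂ) * (genFun n N m y (circPt κ δ t) * (circPt κ δ t ^ n)⁻¹) *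
    ((δ ^ (-(1 - y)) : ℝ) : ℂ)

theorem norm_circPt {κ δ : ℝ} (h : 0 ≤ 1 - κ * δ) (t : ℝ) : ‖circPt κ δ t‖ = 1 - κ * δ := by
  rw [circPt, norm_mul, Complex.norm_exp_ofReal_mul_I, mul_one, Complex.norm_real,
    Real.norm_of_nonneg h]

theorem circPt_re (κ δ t : ℝ) : (circPt κ δ t).re = (1 - κ * δ) * Real.cos (δ * t) := by
  rw [circPt, Complex.re_ofReal_mul, Complex.exp_ofReal_mul_I_re]

theorem circPt_im (κ δ t : ℝ) : (circPt κ δ t).im = (1 - κ * δ) * Real.sin (δ * t) := by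
  rw [circPt, Complex.im_ofReal_mul, Complex.exp_ofReal_mul_I_im]

theorem norm_one_sub_circPt_sq (κ δ t : ℝ) : ‖1 - circPt κ δ t‖ ^ 2 =
    (κ * δ) ^ 2 + 2 * (1 - κ * δ) * (1 - Real.cos (δ * t)) := by
  rw [← Complex.normSq_eq_norm_sq, Complex.normSq_apply]
  simp only [Complex.sub_re, Complex.sub_im, Complex.one_re, Complex.one_im, circPt_re, circPt_im]
  have := Real.sin_sq_add_cos_sq (δ * t)
  linear_combination (1 - κ * δ) ^ 2 * this

theorem norm_one_sub_circPt_div_mem {κ δ : ℝ} (hκ : 0 < κ) (hδ : 0 < δ) (h : κ * δ ≤ 1 / 2) (t : ℝ) :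
    κ ≤ ‖1 - circPt κ δ t‖ / δ ∧ ‖1 - circPt κ δ t‖ / δ ≤ κ + |t| := by
  have h1 := norm_one_sub_circPt_sq κ δ t
  have h2 := Real.cos_le_one (δ * t)
  have h3 := Real.one_sub_sq_div_two_le_cos (x := δ * t)
  have hk : 0 < κ * δ := by positivity
  rw [le_div_iff₀ hδ, div_le_iff₀ hδ]
  constructor
  · apply le_of_sq_le_sq _ (norm_nonneg _)
    rw [h1]
    nlinarith
  · apply le_of_sq_le_sq _ (by positivity)
    rw [h1, show ((κ + |t|) * δ) ^ 2 = κ ^ 2 * δ ^ 2 + 2 * κ * |t| * δ ^ 2 + |t| ^ 2 * δ ^ 2 by ring,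
      sq_abs]
    have h4 : 2 * (1 - κ * δ) * (1 - Real.cos (δ * t)) ≤ (δ * t) ^ 2 := by nlinarith
    have h5 : 0 ≤ 2 * κ * |t| * δ ^ 2 := by positivity
    nlinarith

theorem exponent_re (n : ℕ) (N κ δ t : ℝ) :
    -n - N / 2 + ((n : ℂ) * circPt κ δ t + N * (circPt κ δ t - circPt κ δ t ^ 2 / 2)).re =
      -n * κ * δ - n * (1 - κ * δ) * (1 - Real.cos (δ * t)) - N / 2 * ((κ * δ) ^ 2 +
        2 * (1 - κ * δ) * (1 - Real.cos (δ * t)) * (1 - 2 * (1 - κ * δ)) +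
        2 * (1 - κ * δ) ^ 2 * (1 - Real.cos (δ * t)) ^ 2) := by
  have e1 : ((n : ℂ) * circPt κ δ t + N * (circPt κ δ t - circPt κ δ t ^ 2 / 2)).re =
      n * (circPt κ δ t).re + N * ((circPt κ δ t).re -
        ((circPt κ δ t).re ^ 2 - (circPt κ δ t).im ^ 2) / 2) := by
    have h2 : circPt κ δ t ^ 2 / 2 = circPt κ δ t ^ 2 / ((2 : ℝ) : ℂ) := by simp
    rw [Complex.add_re, ← Complex.ofReal_natCast, Complex.re_ofReal_mul, Complex.re_ofReal_mul,
      Complex.sub_re, h2, Complex.div_ofReal_re, sq (circPt κ δ t), Complex.mul_re]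
    ring
  rw [e1, circPt_re, circPt_im]
  have := Real.sin_sq_add_cos_sq (δ * t)
  linear_combination N / 2 * (1 - κ * δ) ^ 2 * this

theorem exponent_le {n δ κ L x : ℝ} (hδ : 0 < δ) (hκ : 0 < κ) (hn : n * δ ^ 3 = 1)
    (h : κ * δ ≤ 1 / 2) (hL : |L| ≤ κ) (hL1 : L * δ ≤ 1) (hx : 0 ≤ x) :
    -n * κ * δ - n * (1 - κ * δ) * x - (n - n * L * δ) / 2 * ((κ * δ) ^ 2 +
        2 * (1 - κ * δ) * x * (1 - 2 * (1 - κ * δ)) + 2 * (1 - κ * δ) ^ 2 * x ^ 2) -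
      n * Real.log (1 - κ * δ) ≤ 3 * κ ^ 3 - n * δ * κ * x / 2 := by
  have hn0 : 0 < n := by
    by_contra hc
    have : n * δ ^ 3 ≤ 0 := mul_nonpos_of_nonpos_of_nonneg (not_lt.1 hc) (by positivity)
    linarith
  have hu : 0 < κ * δ := by positivity
  have hlog : -n * Real.log (1 - κ * δ) - n * κ * δ - n * (κ * δ) ^ 2 / 2 ≤ 2 * κ ^ 3 := by
    have h1 := Real.abs_log_sub_add_sum_range_le (x := κ * δ) (by rw [abs_of_pos hu]; linarith) 2
    rw [Finset.sum_range_succ, Finset.sum_range_one, abs_of_pos hu] at h1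
    have h2 : (κ * δ) ^ (2 + 1) / (1 - κ * δ) ≤ 2 * (κ * δ) ^ 3 := by
      rw [div_le_iff₀ (by linarith)]
      have : 0 < (κ * δ) ^ 3 := by positivity
      norm_num
      nlinarith [mul_nonneg this.le (sub_nonneg.2 h)]
    have h3 := (abs_le.1 (h1.trans h2)).1
    have h4 : n * (2 * (κ * δ) ^ 3) = 2 * κ ^ 3 := by linear_combination 2 * κ ^ 3 * hn
    norm_num at h3
    nlinarith [mul_le_mul_of_nonneg_left h3 hn0.le]
  obtain ⟨hL2, hL3⟩ := abs_le.1 hL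
  set u := κ * δ with hud
  set r := 1 - u with hr
  have hr1 : 1 / 2 ≤ r := by linarith
  have hr2 : r < 1 := by linarith
  have hA : n * L * δ / 2 * u ^ 2 ≤ κ ^ 3 / 2 := by
    have : n * L * δ / 2 * u ^ 2 = L * κ ^ 2 / 2 := by
      rw [hud]; linear_combination L * κ ^ 2 / 2 * hn
    rw [this]
    nlinarith [sq_nonneg κ]
  have hB : n * L * δ * (r * x * (1 - 2 * r)) ≤ n * δ * κ * (r * x) := by
    have h1 : L * (1 - 2 * r) ≤ κ := by
      nlinarith [abs_le.1 hL]
    have : 0 ≤ n * δ * (r * x) := by positivity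
    nlinarith
  have hC : n * L * δ * (r ^ 2 * x ^ 2) ≤ n * (r ^ 2 * x ^ 2) := by
    have : 0 ≤ n * (r ^ 2 * x ^ 2) := by positivity
    nlinarith
  have hD : n * δ * κ * x / 2 ≤ n * δ * κ * (r * x) := by
    have : 0 ≤ n * δ * κ * x := by positivity
    nlinarith
  have hE : n * r * x * (2 * u) = 2 * (n * δ * κ * (r * x)) := by rw [hud]; ring
  have hid : -n * κ * δ - n * r * x - (n - n * L * δ) / 2 * (u ^ 2 +
        2 * r * x * (1 - 2 * r) + 2 * r ^ 2 * x ^ 2) - n * Real.log r =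
      (-n * Real.log r - n * κ * δ - n * u ^ 2 / 2) - n * r * x * (2 * u) - n * (r ^ 2 * x ^ 2) +
      n * L * δ / 2 * u ^ 2 + n * L * δ * (r * x * (1 - 2 * r)) + n * L * δ * (r ^ 2 * x ^ 2) := by
    rw [hr]; ring
  rw [hid]
  have : 0 < κ ^ 3 := by positivity
  linarith

theorem norm_scaledInt_le {κ δ L t y : ℝ} {n m : ℕ} {N : ℝ} (hδ : 0 < δ) (hκ : 0 < κ)
    (hn : n * δ ^ 3 = 1) (h : κ * δ ≤ 1 / 2) (hL : |L| ≤ κ) (hL1 : L * δ ≤ 1)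
    (hN : N = n - n * L * δ) (ht : |δ * t| ≤ Real.pi) :
    ‖scaledInt κ δ n N m y t‖ ≤ Real.exp (3 * κ ^ 3 + |1 - y| * (|Real.log κ| + κ) +
      (1 - y) ^ 2 / (4 * (κ / (2 * Real.pi ^ 2)))) * Real.exp (-(κ / (2 * Real.pi ^ 2)) * t ^ 2) := by
  have hr : 0 < 1 - κ * δ := by linarith
  have hnorm := norm_circPt hr.le t
  obtain ⟨hs1, hs2⟩ := norm_one_sub_circPt_div_mem hκ hδ h t
  rw [scaledInt, genFun, norm_mul, norm_mul, norm_mul, norm_mul, norm_mul, norm_inv, norm_pow, norm_pow,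
    hnorm, Complex.norm_real, Complex.norm_real, Complex.norm_cpow_real, Complex.norm_exp,
    Real.norm_of_nonneg (Real.exp_pos _).le, Real.norm_of_nonneg (by positivity)]
  have e1 : ‖1 - circPt κ δ t‖ ^ (1 - y) * δ ^ (-(1 - y)) = (‖1 - circPt κ δ t‖ / δ) ^ (1 - y) := by
    rw [Real.div_rpow (norm_nonneg _) hδ.le, Real.rpow_neg hδ.le, div_eq_mul_inv]
  have e2 : ((1 - κ * δ) ^ n)⁻¹ = Real.exp (-(n * Real.log (1 - κ * δ))) := by
    rw [Real.exp_neg, Real.exp_nat_mul, Real.exp_log hr]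
  calc _ = Real.exp (-n - N / 2 + ((n : ℂ) * circPt κ δ t +
        N * (circPt κ δ t - circPt κ δ t ^ 2 / 2)).re + -(n * Real.log (1 - κ * δ))) *
        (1 - κ * δ) ^ m * (‖1 - circPt κ δ t‖ ^ (1 - y) * δ ^ (-(1 - y))) := by
        rw [Real.exp_add, Real.exp_add, e2]; ring
    _ ≤ Real.exp (3 * κ ^ 3 - n * δ * κ * (1 - Real.cos (δ * t)) / 2) * 1 *
        Real.exp (|1 - y| * (|Real.log κ| + κ + |t|)) := by
        rw [e1]
        have hx : 0 ≤ 1 - Real.cos (δ * t) := by linarith [Real.cos_le_one (δ * t)]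
        gcongr
        · rw [exponent_re, hN]
          have := exponent_le hδ hκ hn h hL hL1 hx
          linarith
        · exact pow_le_one₀ hr.le (by nlinarith)
        · exact rpow_le_exp_of_mem hκ hs1 hs2 _
    _ ≤ _ := by
        rw [mul_one, ← Real.exp_add, ← Real.exp_add, Real.exp_le_exp]
        have hc := Real.cos_le_one_sub_mul_cos_sq ht
        have hp := Real.pi_pos
        have h1 : κ / Real.pi ^ 2 * t ^ 2 ≤ n * δ * κ * (1 - Real.cos (δ * t)) / 2 := by
          have h2 : 0 ≤ n * δ * κ := by positivity
          have h3 : 2 / Real.pi ^ 2 * (δ * t) ^ 2 ≤ 1 - Real.cos (δ * t) := by linarith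
          have h4 := mul_le_mul_of_nonneg_left h3 h2
          have h5 : n * δ * κ * (2 / Real.pi ^ 2 * (δ * t) ^ 2) = 2 * (κ / Real.pi ^ 2 * t ^ 2) := by
            linear_combination 2 * κ / Real.pi ^ 2 * t ^ 2 * hn
          linarith
        have h6 := exp_abs_mul_le (κ / (2 * Real.pi ^ 2)) (1 - y) t (by positivity)
        have h7 : 2 * (κ / (2 * Real.pi ^ 2)) = κ / Real.pi ^ 2 := by field_simp
        rw [h7] at h6
        linarith

end RandomXor

namespace RandomXor
open MeasureTheory Filter

/-- `n ^ (-1/3)`. -/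
noncomputable def dl (n : ℕ) : ℝ := (n : ℝ) ^ (-(1 : ℝ) / 3)

theorem dl_pos {n : ℕ} (hn : 0 < n) : 0 < dl n := Real.rpow_pos_of_pos (by exact_mod_cast hn) _

theorem mul_dl_pow {n : ℕ} (hn : 0 < n) : (n : ℝ) * dl n ^ 3 = 1 := by
  have h : (0 : ℝ) < n := by exact_mod_cast hn
  rw [dl, ← Real.rpow_natCast, ← Real.rpow_mul h.le, show -(1 : ℝ) / 3 * (3 : ℕ) = -1 by norm_num,
    Real.rpow_neg_one, mul_inv_cancel₀ h.ne']

theorem tendsto_dl : Tendsto dl atTop (nhds 0) := by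
  have := (tendsto_rpow_neg_atTop (y := 1 / 3) (by norm_num)).comp tendsto_natCast_atTop_atTop
  refine this.congr fun n => ?_
  simp only [Function.comp, dl]; congr 1; ring

/-- The limiting integrand on the vertical line of abscissa `κ`. -/
noncomputable def limInt (κ lam b t : ℝ) : ℂ :=
  Complex.exp (lam * (κ - t * Complex.I) ^ 2 / 2 + (κ - t * Complex.I) ^ 3 / 3) *
    (κ - t * Complex.I) ^ (b : ℂ)

/-- The limiting contour integral. -/
noncomputable def contourK (κ lam b : ℝ) : ℂ :=
  ((2 * Real.pi : ℝ) : ℂ)⁻¹ * ∫ t : ℝ, limInt κ lam b t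

theorem ofReal_mul_cpow {r : ℝ} (hr : 0 < r) {z : ℂ} (hz : z ≠ 0) (b : ℝ) :
    ((r : ℂ) * z) ^ (b : ℂ) = ((r ^ b : ℝ) : ℂ) * z ^ (b : ℂ) := by
  have hr' : (r : ℂ) ≠ 0 := by exact_mod_cast hr.ne'
  rw [Complex.cpow_def_of_ne_zero (mul_ne_zero hr' hz), Complex.log_ofReal_mul hr hz, add_mul,
    Complex.exp_add, Complex.cpow_def_of_ne_zero hz, Complex.ofReal_cpow hr.le,
    Complex.cpow_def_of_ne_zero hr', Complex.ofReal_log hr.le]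

theorem tendsto_one_sub_circPt_div (κ t : ℝ) :
    Tendsto (fun n => (1 - circPt κ (dl n) t) / dl n) atTop (nhds (κ - t * Complex.I)) := by
  have hd : HasDerivAt (fun δ : ℝ => 1 - circPt κ δ t) (κ - t * Complex.I) 0 := by
    have h1 : HasDerivAt (fun δ : ℝ => ((1 - κ * δ : ℝ) : ℂ)) ((-κ : ℝ) : ℂ) 0 := by
      have := ((hasDerivAt_id (0 : ℝ)).const_mul κ).const_sub 1
      simpa using this.ofReal_comp
    have h2 : HasDerivAt (fun δ : ℝ => (((δ * t : ℝ) : ℂ) * Complex.I)) (t * Complex.I) 0 := by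
      have := ((hasDerivAt_id (0 : ℝ)).mul_const t).ofReal_comp.mul_const Complex.I
      simpa using this
    have h3 := (h1.mul h2.cexp).const_sub 1
    have h4 : (κ - t * Complex.I : ℂ) = -(((-κ : ℝ) : ℂ) * Complex.exp (((0 * t : ℝ) : ℂ) * Complex.I) +
        ((1 - κ * 0 : ℝ) : ℂ) * (Complex.exp (((0 * t : ℝ) : ℂ) * Complex.I) * (t * Complex.I))) := by
      simp; ring
    rw [h4]
    exact h3
  have h0 : 1 - circPt κ 0 t = 0 := by simp [circPt]
  have h1 := hd.tendsto_slope_zero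
  simp only [zero_add, h0, sub_zero] at h1
  have h2 : Tendsto dl atTop (nhdsWithin 0 {0}ᶜ) := tendsto_nhdsWithin_iff.2 ⟨tendsto_dl,
    (eventually_gt_atTop 0).mono fun n hn => (dl_pos hn).ne'⟩
  refine (h1.comp h2).congr fun n => ?_
  simp only [Function.comp, Complex.real_smul, Complex.ofReal_inv]
  rw [div_eq_inv_mul]

theorem scaledInt_eq {κ δ t y L : ℝ} {n m : ℕ} {N : ℝ} (hδ : 0 < δ) (hn : n * δ ^ 3 = 1)
    (hN : N = n - n * L * δ) {s : ℂ} (hs : s = (1 - circPt κ δ t) / δ) (hs0 : s ≠ 0)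
    (hc : circPt κ δ t ≠ 0) :
    scaledInt κ δ n N m y t = Complex.exp (L * s ^ 2 / 2 + s ^ 3 / 3 -
      n * (Complex.log (1 + -(δ * s)) - Complex.logTaylor 4 (-(δ * s))) +
      m * Complex.log (1 + -(δ * s))) * s ^ ((1 - y : ℝ) : ℂ) := by
  have hδ' : (δ : ℂ) ≠ 0 := by exact_mod_cast hδ.ne'
  have hw : 1 - circPt κ δ t = δ * s := by rw [hs]; field_simp
  have hτ : circPt κ δ t = 1 + -(δ * s) := by rw [← hw]; ring
  have hpow : ∀ k : ℕ, circPt κ δ t ^ k = Complex.exp (k * Complex.log (1 + -(δ * s))) := fun k => by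
    rw [Complex.exp_nat_mul, ← hτ, Complex.exp_log hc]
  have hT : Complex.logTaylor 4 (-(δ * s)) = -(δ * s) - (δ * s) ^ 2 / 2 - (δ * s) ^ 3 / 3 := by
    simp [Complex.logTaylor, Finset.sum_range_succ]
    ring
  rw [scaledInt, genFun, hw, ofReal_mul_cpow hδ hs0, hpow m, hpow n, ← Complex.exp_neg, hT,
    Complex.ofReal_exp]
  have e3 : ((δ ^ (-(1 - y)) : ℝ) : ℂ) * ((δ ^ (1 - y) : ℝ) : ℂ) = 1 := by
    rw [← Complex.ofReal_mul, ← Real.rpow_add hδ]; simp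
  have hnC : (n : ℂ) * δ ^ 3 = 1 := by exact_mod_cast hn
  calc _ = (Complex.exp ((-n - N / 2 : ℝ) : ℂ) *
        Complex.exp (n * circPt κ δ t + N * (circPt κ δ t - circPt κ δ t ^ 2 / 2)) *
        Complex.exp (m * Complex.log (1 + -(δ * s))) *
        Complex.exp (-(n * Complex.log (1 + -(δ * s))))) * s ^ ((1 - y : ℝ) : ℂ) *
        (((δ ^ (-(1 - y)) : ℝ) : ℂ) * ((δ ^ (1 - y) : ℝ) : ℂ)) := by ring
    _ = _ := by
      rw [e3, mul_one, ← Complex.exp_add, ← Complex.exp_add, ← Complex.exp_add]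
      congr 2
      rw [hτ, hN]
      push_cast
      linear_combination (L * s ^ 2 / 2 + s ^ 3 / 3) * hnC

theorem tendsto_scaledInt {lam κ y t : ℝ} (hκ : 0 < κ) {L : ℕ → ℝ} {N : ℕ → ℝ} {m : ℕ → ℕ}
    (hL : Tendsto L atTop (nhds lam)) (hN : ∀ n, N n = n - n * L n * dl n)
    (hm : Tendsto (fun n => m n * dl n) atTop (nhds 0)) :
    Tendsto (fun n => scaledInt κ (dl n) n (N n) (m n) y t) atTop (nhds (limInt κ lam (1 - y) t)) := by
  set w₀ : ℂ := κ - t * Complex.I with hw₀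
  have hre : w₀.re = κ := by simp [hw₀]
  have hw₀0 : w₀ ≠ 0 := fun h => by rw [h] at hre; simp at hre; linarith
  let s : ℕ → ℂ := fun n => (1 - circPt κ (dl n) t) / dl n
  have hs : Tendsto s atTop (nhds w₀) := tendsto_one_sub_circPt_div κ t
  have hd : Tendsto (fun n => (dl n : ℂ)) atTop (nhds 0) := by
    exact (Complex.continuous_ofReal.tendsto 0).comp tendsto_dl
  have hds : Tendsto (fun n => -((dl n : ℂ) * s n)) atTop (nhds 0) := by
    have := (hd.mul hs).neg; simpa using this
  have hsmall : ∀ᶠ n in atTop, ‖-((dl n : ℂ) * s n)‖ ≤ 1 / 2 := by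
    have := hds.norm
    rw [norm_zero] at this
    exact (this.eventually (gt_mem_nhds (by norm_num : (0 : ℝ) < 1 / 2))).mono fun _ h => h.le
  have hpos : ∀ᶠ n : ℕ in atTop, 0 < n := eventually_gt_atTop 0
  have hR : Tendsto (fun n : ℕ => (n : ℂ) * (Complex.log (1 + -(dl n * s n)) -
      Complex.logTaylor 4 (-(dl n * s n)))) atTop (nhds 0) := by
    have hb : Tendsto (fun n => dl n * ‖s n‖ ^ 4) atTop (nhds 0) := by
      have := tendsto_dl.mul (hs.norm.pow 4); simpa using this
    refine squeeze_zero_norm' ?_ hb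
    filter_upwards [hsmall, hpos] with n h1 h2
    have h3 := Complex.norm_log_sub_logTaylor_le 3 (z := -((dl n : ℂ) * s n)) (by linarith)
    have hdl := dl_pos h2
    have hw : ‖-((dl n : ℂ) * s n)‖ = dl n * ‖s n‖ := by
      rw [norm_neg, norm_mul, Complex.norm_real, Real.norm_of_nonneg hdl.le]
    rw [norm_mul, Complex.norm_natCast]
    have h4 : (1 - ‖-((dl n : ℂ) * s n)‖)⁻¹ ≤ 2 := by
      rw [inv_le_comm₀ (by linarith) (by norm_num)]; linarith
    calc _ ≤ (n : ℝ) * (‖-((dl n : ℂ) * s n)‖ ^ 4 * 2 / 2) := by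
          refine mul_le_mul_of_nonneg_left (h3.trans ?_) n.cast_nonneg
          have : 0 ≤ ‖-((dl n : ℂ) * s n)‖ ^ 4 := by positivity
          norm_num at this ⊢
          norm_num at h4
          nlinarith
      _ = (n * dl n ^ 3) * (dl n * ‖s n‖ ^ 4) := by rw [hw]; ring
      _ = _ := by rw [mul_dl_pow h2, one_mul]
  have hM : Tendsto (fun n : ℕ => (m n : ℂ) * Complex.log (1 + -(dl n * s n))) atTop (nhds 0) := by
    have hb : Tendsto (fun n => 3 / 2 * (m n * dl n) * ‖s n‖) atTop (nhds 0) := by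
      have := (hm.const_mul (3 / 2)).mul hs.norm; simpa using this
    refine squeeze_zero_norm' ?_ hb
    filter_upwards [hsmall, hpos] with n h1 h2
    have h3 := Complex.norm_log_one_add_half_le_self h1
    have hdl := dl_pos h2
    have hw : ‖-((dl n : ℂ) * s n)‖ = dl n * ‖s n‖ := by
      rw [norm_neg, norm_mul, Complex.norm_real, Real.norm_of_nonneg hdl.le]
    rw [norm_mul, Complex.norm_natCast]
    rw [hw] at h3
    nlinarith [mul_le_mul_of_nonneg_left h3 (m n).cast_nonneg]
  have hLc : Tendsto (fun n => (L n : ℂ)) atTop (nhds lam) :=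
    (Complex.continuous_ofReal.tendsto lam).comp hL
  have hE := ((((hLc.mul (hs.pow 2)).div_const 2).add ((hs.pow 3).div_const 3)).sub hR).add hM
  have hcp : Tendsto (fun n => s n ^ ((1 - y : ℝ) : ℂ)) atTop (nhds (w₀ ^ ((1 - y : ℝ) : ℂ))) :=
    ((continuousAt_cpow_const (Or.inl (by rw [hre]; exact hκ))).tendsto).comp hs
  have hlim := (hE.cexp).mul hcp
  rw [sub_zero, add_zero] at hlim
  refine Tendsto.congr' ?_ hlim
  filter_upwards [hpos, hsmall, hs.eventually_ne hw₀0] with n h1 h2 h3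
  have h4 : (dl n : ℂ) ≠ 0 := by exact_mod_cast (dl_pos h1).ne'
  refine (scaledInt_eq (dl_pos h1) (mul_dl_pow h1) (hN n) rfl h3 fun hc => ?_).symm
  have : (dl n : ℂ) * s n = 1 := by simp only [s, hc]; field_simp; simp
  rw [this] at h2
  norm_num at h2

end RandomXor

namespace RandomXor
open MeasureTheory Filter

theorem measurable_circPt (κ δ : ℝ) : Measurable (circPt κ δ) := by
  unfold circPt; fun_prop

theorem measurable_scaledInt (κ δ : ℝ) (n : ℕ) (N : ℝ) (m : ℕ) (y : ℝ) :
    Measurable (scaledInt κ δ n N m y) := by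
  have h := measurable_circPt κ δ
  unfold scaledInt genFun
  refine ((measurable_const.mul (Measurable.mul ?_ ?_))).mul measurable_const
  · refine Measurable.mul (by fun_prop) (Measurable.mul (by fun_prop) ?_)
    exact (measurable_const.sub h).pow_const _
  · exact (h.pow_const n).inv

theorem scaled_BB_eq_integral {κ δ y : ℝ} {n m : ℕ} {N : ℝ} (hδ : 0 < δ) (hκ : 0 < κ)
    (h : κ * δ ≤ 1 / 2) :
    ((δ ^ (y - 2) * Real.exp (-n - N / 2) * BB n N m y : ℝ) : ℂ) = ((2 * Real.pi : ℝ) : ℂ)⁻¹ *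
      ∫ t : ℝ, (Set.Ioc (-Real.pi / δ) (Real.pi / δ)).indicator (scaledInt κ δ n N m y) t := by
  have h0 : 0 < 1 - κ * δ := by linarith
  have h1 : 1 - κ * δ < 1 := by have : 0 < κ * δ := by positivity
                                linarith
  have hle : -Real.pi / δ ≤ Real.pi / δ := by
    gcongr; linarith [Real.pi_pos]
  rw [integral_indicator measurableSet_Ioc, ← intervalIntegral.integral_of_le hle]
  simp only [scaledInt]
  rw [intervalIntegral.integral_mul_const, intervalIntegral.integral_const_mul]
  rw [Complex.ofReal_mul, Complex.ofReal_mul, BB_eq_integral n N m y h0 h1]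
  have hsub := intervalIntegral.integral_comp_mul_left (a := -Real.pi / δ) (b := Real.pi / δ)
    (fun θ : ℝ => genFun n N m y (((1 - κ * δ : ℝ) : ℂ) * Complex.exp (θ * Complex.I)) *
        ((((1 - κ * δ : ℝ) : ℂ) * Complex.exp (θ * Complex.I)) ^ n)⁻¹) hδ.ne'
  rw [mul_div_cancel₀ _ hδ.ne', mul_div_cancel₀ _ hδ.ne'] at hsub
  simp only [circPt]
  rw [hsub, Complex.real_smul]
  have e : (δ ^ (-(1 - y)) : ℝ) * δ⁻¹ = δ ^ (y - 2) := by
    rw [← Real.rpow_neg_one, ← Real.rpow_add hδ]; congr 1; ring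
  rw [← e, Complex.ofReal_mul]
  ring

theorem rpow_eq_dl_rpow (n : ℕ) (c : ℝ) : (n : ℝ) ^ (-c / 3) = dl n ^ c := by
  rw [dl, ← Real.rpow_mul n.cast_nonneg]; congr 1; ring

theorem tendsto_BB {lam κ y : ℝ} (hκ : |lam| < κ) {L : ℕ → ℝ} {N : ℕ → ℝ} {m : ℕ → ℕ}
    (hL : Tendsto L atTop (nhds lam)) (hN : ∀ n, N n = n - n * L n * dl n)
    (hm : Tendsto (fun n => m n * dl n) atTop (nhds 0)) :
    Tendsto (fun n : ℕ => ((dl n ^ (y - 2) * Real.exp (-n - N n / 2) * BB n (N n) (m n) y : ℝ) : ℂ))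
      atTop (nhds (contourK κ lam (1 - y))) := by
  have hκ0 : 0 < κ := (abs_nonneg _).trans_lt hκ
  have E1 : ∀ᶠ n : ℕ in atTop, 0 < n := eventually_gt_atTop 0
  have E2 : ∀ᶠ n in atTop, κ * dl n ≤ 1 / 2 := by
    have := tendsto_dl.const_mul κ
    rw [mul_zero] at this
    exact (this.eventually (gt_mem_nhds (by norm_num : (0 : ℝ) < 1 / 2))).mono fun _ h => h.le
  have E3 : ∀ᶠ n in atTop, |L n| ≤ κ :=
    (hL.abs.eventually (gt_mem_nhds hκ)).mono fun _ h => h.le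
  have E4 : ∀ᶠ n in atTop, L n * dl n ≤ 1 := by
    have := hL.mul tendsto_dl
    rw [mul_zero] at this
    exact (this.eventually (gt_mem_nhds (by norm_num : (0 : ℝ) < 1))).mono fun _ h => h.le
  have key : Tendsto (fun n : ℕ => ∫ t : ℝ, (Set.Ioc (-Real.pi / dl n) (Real.pi / dl n)).indicator
      (scaledInt κ (dl n) n (N n) (m n) y) t) atTop (nhds (∫ t : ℝ, limInt κ lam (1 - y) t)) := by
    refine tendsto_integral_filter_of_dominated_convergence
      (fun t => Real.exp (3 * κ ^ 3 + |1 - y| * (|Real.log κ| + κ) +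
      (1 - y) ^ 2 / (4 * (κ / (2 * Real.pi ^ 2)))) * Real.exp (-(κ / (2 * Real.pi ^ 2)) * t ^ 2))
      ?_ ?_ ?_ ?_
    · exact .of_forall fun n =>
        ((measurable_scaledInt _ _ _ _ _ _).indicator measurableSet_Ioc).aestronglyMeasurable
    · filter_upwards [E1, E2, E3, E4] with n h1 h2 h3 h4
      refine .of_forall fun t => ?_
      by_cases ht : t ∈ Set.Ioc (-Real.pi / dl n) (Real.pi / dl n)
      · rw [Set.indicator_of_mem ht]
        have hd := dl_pos h1
        refine norm_scaledInt_le hd hκ0 (mul_dl_pow h1) h2 h3 h4 (hN n) ?_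
        obtain ⟨a, b⟩ := ht
        rw [div_lt_iff₀ hd] at a
        rw [le_div_iff₀ hd] at b
        rw [abs_le]; constructor <;> linarith
      · rw [Set.indicator_of_notMem ht, norm_zero]; positivity
    · exact (integrable_exp_neg_mul_sq (by positivity)).const_mul _
    · refine .of_forall fun t => ?_
      refine (tendsto_scaledInt hκ0 hL hN hm (y := y) (t := t)).congr' ?_
      have : Tendsto (fun n => |t| * dl n) atTop (nhds 0) := by
        have := tendsto_dl.const_mul |t|; rwa [mul_zero] at this
      filter_upwards [E1, this.eventually (gt_mem_nhds Real.pi_pos)] with n h1 h2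
      have hd := dl_pos h1
      rw [Set.indicator_of_mem]
      refine ⟨?_, ?_⟩
      · rw [div_lt_iff₀ hd]; nlinarith [neg_abs_le t]
      · rw [le_div_iff₀ hd]; nlinarith [le_abs_self t]
  refine (key.const_mul _).congr' ?_
  filter_upwards [E1, E2] with n h1 h2
  exact (scaled_BB_eq_integral (dl_pos h1) hκ0 h2).symm

end RandomXor

namespace RandomXor
open MeasureTheory Filter

theorem vline_ne_zero {κ : ℝ} (hκ : 0 < κ) (t : ℝ) : (κ - t * Complex.I : ℂ) ≠ 0 := fun h => by
  have := congrArg Complex.re h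
  simp at this; linarith

theorem vline_mem_slitPlane {κ : ℝ} (hκ : 0 < κ) (t : ℝ) :
    (κ - t * Complex.I : ℂ) ∈ Complex.slitPlane := Or.inl (by simpa using hκ)

theorem norm_vline_sq (κ t : ℝ) : ‖(κ - t * Complex.I : ℂ)‖ ^ 2 = κ ^ 2 + t ^ 2 := by
  rw [← Complex.normSq_eq_norm_sq, Complex.normSq_apply]; simp; ring

theorem norm_vline_mem {κ : ℝ} (hκ : 0 < κ) (t : ℝ) :
    κ ≤ ‖(κ - t * Complex.I : ℂ)‖ ∧ ‖(κ - t * Complex.I : ℂ)‖ ≤ κ + |t| := by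
  have h := norm_vline_sq κ t
  constructor
  · apply le_of_sq_le_sq _ (norm_nonneg _); rw [h]; nlinarith [sq_nonneg t]
  · apply le_of_sq_le_sq _ (by positivity); rw [h, add_sq, sq_abs]
    have : 0 ≤ κ * |t| := by positivity
    linarith

theorem limInt_exponent_re (κ lam t : ℝ) : (lam * (κ - t * Complex.I) ^ 2 / 2 +
    (κ - t * Complex.I) ^ 3 / 3 : ℂ).re = lam * (κ ^ 2 - t ^ 2) / 2 + (κ ^ 3 / 3 - κ * t ^ 2) := by
  have : (lam * (κ - t * Complex.I) ^ 2 / 2 + (κ - t * Complex.I) ^ 3 / 3 : ℂ) =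
      ((lam * (κ ^ 2 - t ^ 2) / 2 + (κ ^ 3 / 3 - κ * t ^ 2) : ℝ) : ℂ) +
      ((-lam * κ * t - κ ^ 2 * t + t ^ 3 / 3 : ℝ) : ℂ) * Complex.I := by
    have h2 := Complex.I_sq
    have h3 := Complex.I_pow_three
    push_cast
    linear_combination (lam * t ^ 2 / 2 + κ * t ^ 2) * h2 - t ^ 3 / 3 * h3
  rw [this, Complex.add_re, Complex.re_ofReal_mul, Complex.ofReal_re, Complex.I_re]; ring

theorem norm_limInt (κ lam b t : ℝ) : ‖limInt κ lam b t‖ =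
    Real.exp (lam * (κ ^ 2 - t ^ 2) / 2 + (κ ^ 3 / 3 - κ * t ^ 2)) *
      ‖(κ - t * Complex.I : ℂ)‖ ^ b := by
  rw [limInt, norm_mul, Complex.norm_exp, Complex.norm_cpow_real, limInt_exponent_re]

theorem norm_limInt_le {κ lam : ℝ} (hκ : |lam| < κ) (b t : ℝ) : ‖limInt κ lam b t‖ ≤
    Real.exp (|lam| * κ ^ 2 / 2 + κ ^ 3 / 3 + |b| * (|Real.log κ| + κ) + b ^ 2 / κ) *
      Real.exp (-(κ / 4) * t ^ 2) := by
  have hκ0 : 0 < κ := (abs_nonneg _).trans_lt hκ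
  obtain ⟨h1, h2⟩ := norm_vline_mem hκ0 t
  rw [norm_limInt]
  refine (mul_le_mul_of_nonneg_left (rpow_le_exp_of_mem hκ0 h1 h2 b) (Real.exp_pos _).le).trans ?_
  rw [← Real.exp_add, ← Real.exp_add, Real.exp_le_exp]
  have h3 := exp_abs_mul_le (κ / 4) b t (by positivity)
  have h4 : b ^ 2 / (4 * (κ / 4)) = b ^ 2 / κ := by congr 1; ring
  rw [h4] at h3
  obtain ⟨h5, h6⟩ := abs_le.1 hκ.le
  have h7 := mul_le_mul_of_nonneg_right (le_abs_self lam) (sq_nonneg κ)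
  have h8 : -lam * t ^ 2 ≤ κ * t ^ 2 := by nlinarith [sq_nonneg t]
  nlinarith

theorem continuous_limInt {κ : ℝ} (hκ : 0 < κ) (lam b : ℝ) : Continuous (limInt κ lam b) := by
  unfold limInt
  refine Continuous.mul (by fun_prop) ?_
  exact Continuous.cpow (by fun_prop) continuous_const fun t => vline_mem_slitPlane hκ t

theorem integrable_limInt {κ lam : ℝ} (hκ : |lam| < κ) (b : ℝ) : Integrable (limInt κ lam b) := by
  have hκ0 : 0 < κ := (abs_nonneg _).trans_lt hκ
  exact Integrable.mono' ((integrable_exp_neg_mul_sq (b := κ / 4) (by positivity)).const_mul _)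
    (continuous_limInt hκ0 lam b).aestronglyMeasurable (.of_forall (norm_limInt_le hκ b))

theorem limInt_zero_add_natCast {κ : ℝ} (hκ : 0 < κ) (lam b : ℝ) (j : ℕ) (t : ℝ) :
    limInt κ lam (b + j) t = (κ - t * Complex.I) ^ j * limInt κ lam b t := by
  rw [limInt, limInt, Complex.ofReal_add, Complex.cpow_add _ _ (vline_ne_zero hκ t),
    Complex.ofReal_natCast, Complex.cpow_natCast]; ring

theorem limInt_two_mul {κ : ℝ} (hκ : 0 < κ) (lam b : ℝ) (k : ℕ) (t : ℝ) :
    ((lam / 2) ^ k / k.factorial : ℂ) * limInt κ 0 (b + 2 * k) t =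
      limInt κ 0 b t * ((lam * (κ - t * Complex.I) ^ 2 / 2) ^ k / k.factorial) := by
  rw [show b + 2 * k = b + ((2 * k : ℕ) : ℝ) by push_cast; ring, limInt_zero_add_natCast hκ, pow_mul,
    mul_div_right_comm, mul_pow]
  ring

theorem norm_limInt_two_mul {κ : ℝ} (hκ : 0 < κ) (lam b : ℝ) (k : ℕ) (t : ℝ) :
    ‖((lam / 2) ^ k / k.factorial : ℂ) * limInt κ 0 (b + 2 * k) t‖ =
      ‖limInt κ 0 b t‖ * ((|lam| * (κ ^ 2 + t ^ 2) / 2) ^ k / k.factorial) := by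
  rw [limInt_two_mul hκ, norm_mul, norm_div, norm_pow, norm_div, norm_mul, norm_pow, norm_vline_sq]
  simp

theorem hasSum_limInt {κ : ℝ} (hκ : 0 < κ) (lam b t : ℝ) :
    HasSum (fun k : ℕ => ((lam / 2) ^ k / k.factorial : ℂ) * limInt κ 0 (b + 2 * k) t)
      (limInt κ lam b t) := by
  have h3 := (NormedSpace.expSeries_div_hasSum_exp
    (lam * (κ - t * Complex.I) ^ 2 / 2 : ℂ)).mul_left (limInt κ 0 b t)
  have h4 : limInt κ lam b t = limInt κ 0 b t * NormedSpace.exp (lam * (κ - t * Complex.I) ^ 2 / 2 : ℂ) := by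
    rw [← Complex.exp_eq_exp_ℂ, limInt, limInt, mul_right_comm, ← Complex.exp_add]
    congr 2; push_cast; ring
  rw [h4, funext fun k => limInt_two_mul hκ lam b k t]
  exact h3

theorem tsum_norm_limInt (κ lam b : ℝ) :
    (fun t => ∑' k : ℕ, ‖limInt κ 0 b t‖ * ((|lam| * (κ ^ 2 + t ^ 2) / 2) ^ k / k.factorial)) =
        fun t => ‖limInt κ (-|lam|) b t‖ * Real.exp (|lam| * κ ^ 2) := by
  ext t
  have h : (∑' k : ℕ, (|lam| * (κ ^ 2 + t ^ 2) / 2) ^ k / k.factorial) =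
      Real.exp (|lam| * (κ ^ 2 + t ^ 2) / 2) := by
    rw [Real.exp_eq_exp_ℝ]
    exact (NormedSpace.expSeries_div_hasSum_exp (|lam| * (κ ^ 2 + t ^ 2) / 2)).tsum_eq
  rw [tsum_mul_left, h, norm_limInt, norm_limInt, mul_right_comm, ← Real.exp_add, mul_right_comm, ← Real.exp_add]
  congr 2; ring

theorem hasSum_contourK {κ lam : ℝ} (hκ : |lam| < κ) (b : ℝ) :
    HasSum (fun k : ℕ => ((lam / 2) ^ k / k.factorial : ℂ) * contourK κ 0 (b + 2 * k))
      (contourK κ lam b) := by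
  have hκ0 : 0 < κ := (abs_nonneg _).trans_lt hκ
  have h := hasSum_integral_of_dominated_convergence (μ := volume)
    (F := fun (k : ℕ) (t : ℝ) => (((lam / 2) ^ k / k.factorial : ℂ)) * limInt κ 0 (b + 2 * k) t)
    (f := fun t => limInt κ lam b t)
    (fun k t => ‖limInt κ 0 b t‖ * ((|lam| * (κ ^ 2 + t ^ 2) / 2) ^ k / k.factorial))
    (fun k => (continuous_const.mul (continuous_limInt hκ0 0 _)).aestronglyMeasurable)
    (fun k => .of_forall fun t => (norm_limInt_two_mul hκ0 lam b k t).le)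
    (.of_forall fun t => (Real.summable_pow_div_factorial _).mul_left _)
    (by
      rw [tsum_norm_limInt]
      exact ((integrable_limInt (by rwa [abs_neg, abs_abs]) b).norm).mul_const _)
    (.of_forall fun t => hasSum_limInt hκ0 lam b t)
  have h2 := h.mul_left (((2 * Real.pi : ℝ) : ℂ)⁻¹)
  have h5 : ∀ k : ℕ, ((lam / 2) ^ k / k.factorial : ℂ) * contourK κ 0 (b + 2 * k) =
      ((2 * Real.pi : ℝ) : ℂ)⁻¹ * ∫ t : ℝ, ((lam / 2) ^ k / k.factorial : ℂ) *
        limInt κ 0 (b + 2 * k) t := fun k => by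
    rw [integral_const_mul, contourK]; ring
  rw [funext h5]
  exact h2

theorem contourK_recursion {κ : ℝ} (hκ : 0 < κ) (b : ℝ) :
    ((b + 1 : ℝ) : ℂ) * contourK κ 0 b + contourK κ 0 (b + 3) = 0 := by
  have hκ' : |(0 : ℝ)| < κ := by rwa [abs_zero]
  have hd : ∀ t : ℝ, HasDerivAt (limInt κ 0 (b + 1))
      (-Complex.I * (((b + 1 : ℝ) : ℂ) * limInt κ 0 b t + limInt κ 0 (b + 3) t)) t := by
    intro t
    have h1 : HasDerivAt (fun t : ℂ => (κ - t * Complex.I : ℂ)) (-Complex.I) t := by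
      have := ((hasDerivAt_id (t : ℂ)).mul_const Complex.I).const_sub (κ : ℂ)
      simpa using this
    have h2 := ((h1.pow 3).div_const 3).cexp
    have h3 := h1.cpow_const (c := ((b + 1 : ℝ) : ℂ)) (vline_mem_slitPlane hκ t)
    have h4 := (h2.mul h3).comp_ofReal
    have e1 : limInt κ 0 (b + 1) = (fun t : ℝ => Complex.exp ((κ - t * Complex.I) ^ 3 / 3) *
        (κ - t * Complex.I) ^ ((b + 1 : ℝ) : ℂ)) := by
      ext t; simp [limInt]
    rw [e1]
    refine h4.congr_deriv ?_
    have h5 := limInt_zero_add_natCast hκ 0 b 3 t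
    have h6 := limInt_zero_add_natCast hκ 0 b 1 t
    have e2 : limInt κ 0 b t = Complex.exp ((κ - t * Complex.I) ^ 3 / 3) *
        (κ - t * Complex.I) ^ (b : ℂ) := by simp [limInt]
    have e3 : (κ - t * Complex.I : ℂ) ^ ((b + 1 : ℝ) : ℂ) =
        (κ - t * Complex.I) ^ (b : ℂ) * (κ - t * Complex.I) := by
      rw [Complex.ofReal_add, Complex.cpow_add _ _ (vline_ne_zero hκ t)]; simp
    have e4 : (((b + 1 : ℝ) : ℂ) - 1) = (b : ℂ) := by push_cast; ring
    push_cast at h5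
    rw [h5, e2, e3, e4]
    simp only [Pi.pow_apply]
    push_cast
    ring
  have h := integral_eq_zero_of_hasDerivAt_of_integrable hd
    (((integrable_limInt hκ' b).const_mul _).add (integrable_limInt hκ' (b + 3)) |>.const_mul _)
    (integrable_limInt hκ' (b + 1))
  rw [integral_const_mul, integral_add ((integrable_limInt hκ' b).const_mul _)
    (integrable_limInt hκ' (b + 3)), integral_const_mul] at h
  have h2 := (mul_eq_zero.1 h).resolve_left (neg_ne_zero.2 Complex.I_ne_zero)
  rw [contourK, contourK]
  linear_combination ((2 * Real.pi : ℝ) : ℂ)⁻¹ * h2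

end RandomXor

namespace RandomXor
open MeasureTheory Filter

/-- The measure `t ^ (a - 1) dt` on the positive half-line. -/
noncomputable def powMeasure (a : ℝ) : Measure ℝ :=
  (volume.restrict (Set.Ioi 0)).withDensity fun t => ((t ^ (a - 1)).toNNReal : ENNReal)

theorem measurable_rpow_toNNReal (a : ℝ) : Measurable fun t : ℝ => (t ^ (a - 1)).toNNReal := by
  fun_prop

theorem complexMGF_powMeasure (a : ℝ) (z : ℂ) :
    ProbabilityTheory.complexMGF id (powMeasure a) z =
      ∫ t in Set.Ioi (0 : ℝ), (t : ℂ) ^ ((a : ℂ) - 1) * Complex.exp (z * t) := by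
  have h := integral_withDensity_eq_integral_smul (μ := volume.restrict (Set.Ioi (0 : ℝ)))
    (measurable_rpow_toNNReal a) (fun t : ℝ => Complex.exp (z * t))
  refine h.trans ?_
  refine setIntegral_congr_fun measurableSet_Ioi fun t (ht : 0 < t) => ?_
  simp only [NNReal.smul_def, Real.coe_toNNReal _ (Real.rpow_nonneg ht.le _)]
  rw [Complex.real_smul, Complex.ofReal_cpow ht.le]; push_cast; rfl

theorem Iio_subset_integrableExpSet {a : ℝ} (ha : 0 < a) :
    Set.Iio 0 ⊆ ProbabilityTheory.integrableExpSet id (powMeasure a) := by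
  intro x (hx : x < 0)
  refine (integrable_withDensity_iff_integrable_smul (measurable_rpow_toNNReal a)).2 ?_
  have := integrableOn_rpow_mul_exp_neg_mul_rpow (s := a - 1) (p := 1) (b := -x) (by linarith)
    one_pos (by linarith)
  refine (integrableOn_congr_fun (fun t (ht : 0 < t) => ?_) measurableSet_Ioi).1 this
  simp [NNReal.smul_def, Real.coe_toNNReal _ (Real.rpow_nonneg ht.le _)]

theorem integral_ofReal_cpow_mul_exp_neg_mul {a : ℝ} (ha : 0 < a) {r : ℂ} (hr : 0 < r.re) :
    ∫ t in Set.Ioi (0 : ℝ), (t : ℂ) ^ ((a : ℂ) - 1) * Complex.exp (-(r * t)) =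
      r ^ (-(a : ℂ)) * Complex.Gamma a := by
  have hmgf := complexMGF_powMeasure a
  have h_int : Set.Iio 0 ⊆ interior (ProbabilityTheory.integrableExpSet id (powMeasure a)) :=
    interior_maximal (Iio_subset_integrableExpSet ha) isOpen_Iio
  set U : Set ℂ := {z | z.re < 0} with hU
  have hUo : IsOpen U := isOpen_lt Complex.continuous_re continuous_const
  have hUc : IsPreconnected U := (convex_halfSpace_re_lt 0).isPreconnected
  have hf : AnalyticOnNhd ℂ (ProbabilityTheory.complexMGF id (powMeasure a)) U := fun z hz =>
    ProbabilityTheory.analyticAt_complexMGF (h_int hz)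
  have hg : AnalyticOnNhd ℂ (fun z : ℂ => (-z) ^ (-(a : ℂ)) * Complex.Gamma a) U := by
    refine DifferentiableOn.analyticOnNhd (fun z hz => ?_) hUo
    refine DifferentiableAt.differentiableWithinAt ?_
    refine DifferentiableAt.mul_const ?_ _
    refine DifferentiableAt.cpow (by fun_prop) (by fun_prop) (Or.inl ?_)
    have : z.re < 0 := hz
    simpa using this
  have hreal : ∀ x : ℝ, x < 0 → ProbabilityTheory.complexMGF id (powMeasure a) x =
      (-(x : ℂ)) ^ (-(a : ℂ)) * Complex.Gamma a := by
    intro x hx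
    have h1 := Complex.integral_cpow_mul_exp_neg_mul_Ioi (a := a) (r := -x) (by simpa) (by linarith)
    rw [hmgf]
    simp only [Complex.ofReal_neg, neg_mul, neg_neg] at h1
    rw [h1, one_div, Complex.inv_cpow, ← Complex.cpow_neg]
    rw [← Complex.ofReal_neg, Complex.arg_ofReal_of_nonneg (by linarith)]
    exact Real.pi_pos.ne
  have heq : Set.EqOn (ProbabilityTheory.complexMGF id (powMeasure a))
      (fun z : ℂ => (-z) ^ (-(a : ℂ)) * Complex.Gamma a) U := by
    refine hf.eqOn_of_preconnected_of_frequently_eq hg hUc (z₀ := ((-1 : ℝ) : ℂ)) (by simp [hU]) ?_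
    have ht : Tendsto (fun k : ℕ => ((-1 - 1 / ((k : ℝ) + 1) : ℝ) : ℂ)) atTop
        (nhdsWithin ((-1 : ℝ) : ℂ) {((-1 : ℝ) : ℂ)}ᶜ) := by
      refine tendsto_nhdsWithin_iff.2 ⟨?_, .of_forall fun k => ?_⟩
      · refine (Complex.continuous_ofReal.tendsto _).comp ?_
        simpa using tendsto_one_div_add_atTop_nhds_zero_nat.const_sub (-1 : ℝ)
      · simp only [Set.mem_compl_iff, Set.mem_singleton_iff, Complex.ofReal_inj]
        have : 0 < 1 / ((k : ℝ) + 1) := by positivity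
        linarith
    refine ht.frequently (Frequently.of_forall fun k => ?_)
    refine hreal _ ?_
    have : 0 < 1 / ((k : ℝ) + 1) := by positivity
    linarith
  have := heq (x := -r) (by simpa [hU] using hr)
  rw [hmgf] at this
  simpa [neg_mul] using this

theorem integral_ofReal_cpow_mul_exp_neg_mul_cube {b : ℝ} (hb : 0 < b) {r : ℂ} (hr : 0 < r.re) :
    ∫ t in Set.Ioi (0 : ℝ), (t : ℂ) ^ (b : ℂ) * Complex.exp (-(r * t ^ 3)) =
      r ^ (-(((b + 1) / 3 : ℝ) : ℂ)) * Complex.Gamma ((b + 1) / 3 : ℝ) / 3 := by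
  rw [← integral_ofReal_cpow_mul_exp_neg_mul (by positivity) hr,
    ← integral_comp_rpow_Ioi_of_pos (p := 3) (g := fun t : ℝ =>
      (t : ℂ) ^ ((((b + 1) / 3 : ℝ) : ℂ) - 1) * Complex.exp (-(r * t))) (by norm_num),
    ← integral_div]
  refine setIntegral_congr_fun measurableSet_Ioi fun t (ht : 0 < t) => ?_
  have h1 : ((t ^ (3 : ℝ) : ℝ) : ℂ) = (t : ℂ) ^ 3 := by
    rw [show (3 : ℝ) = (3 : ℕ) by norm_num, Real.rpow_natCast]; push_cast; rfl
  have h2 : ((t ^ (3 : ℝ) : ℝ) : ℂ) ^ ((((b + 1) / 3 : ℝ) : ℂ) - 1) = ((t ^ (b - 2) : ℝ) : ℂ) := by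
    rw [← Complex.ofReal_one, ← Complex.ofReal_sub, ← Complex.ofReal_cpow (by positivity),
      ← Real.rpow_mul ht.le]; congr 2; ring
  have h3 : (t : ℂ) ^ (b : ℂ) = ((t ^ (3 - 1 : ℝ) : ℝ) : ℂ) * ((t ^ (b - 2) : ℝ) : ℂ) := by
    rw [← Complex.ofReal_mul, ← Real.rpow_add ht, ← Complex.ofReal_cpow ht.le]; congr 2; ring
  simp only [h2, h3]
  rw [h1, Complex.real_smul]; push_cast; ring
end RandomXor

namespace RandomXor
open MeasureTheory Filter

/-- Regularised integrand `s ^ b * exp (s ^ 3 / 3)`; the parameter `ε` tilts the exponent so that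
the integral over the positive imaginary axis converges. -/
noncomputable def tiltInt (ε b : ℝ) (s : ℂ) : ℂ :=
  s ^ (b : ℂ) * Complex.exp ((1 / 3 - ε * Complex.I) * s ^ 3)

theorem norm_tiltInt (ε b x y : ℝ) : ‖tiltInt ε b (x + y * Complex.I)‖ =
    ‖(x + y * Complex.I : ℂ)‖ ^ b *
      Real.exp ((x ^ 3 - 3 * x * y ^ 2) / 3 + ε * (3 * x ^ 2 * y - y ^ 3)) := by
  rw [tiltInt, norm_mul, Complex.norm_exp, Complex.norm_cpow_real]
  have : (1 / 3 - ε * Complex.I) * (x + y * Complex.I : ℂ) ^ 3 =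
      (((x ^ 3 - 3 * x * y ^ 2) / 3 + ε * (3 * x ^ 2 * y - y ^ 3) : ℝ) : ℂ) +
      (((3 * x ^ 2 * y - y ^ 3) / 3 - ε * (x ^ 3 - 3 * x * y ^ 2) : ℝ) : ℂ) * Complex.I := by
    have h2 := Complex.I_sq
    have h3 := Complex.I_pow_three
    have h4 := Complex.I_pow_four
    push_cast
    linear_combination (x * y ^ 2 - 3 * ε * x ^ 2 * y) * h2 + (y ^ 3 / 3 - 3 * ε * x * y ^ 2) * h3
      - ε * y ^ 3 * h4
  rw [this, Complex.add_re, Complex.re_ofReal_mul, Complex.ofReal_re, Complex.I_re, mul_zero,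
    add_zero]

theorem tiltInt_zero (κ b y : ℝ) : tiltInt 0 b (κ + y * Complex.I) = limInt κ 0 b (-y) := by
  rw [tiltInt, limInt, mul_comm]; congr 1 <;> [congr 1; congr 1] <;> push_cast <;> ring

theorem norm_tiltInt_le {κ ε y : ℝ} (hκ : 0 < κ) (hε : 0 ≤ ε) (h1 : ε ≤ 1) (hy : 0 ≤ y) (b : ℝ) :
    ‖tiltInt ε b (κ + y * Complex.I)‖ ≤ Real.exp (2 * κ ^ 3) * ‖limInt κ 0 b (-y)‖ := by
  rw [← tiltInt_zero, norm_tiltInt, norm_tiltInt, mul_left_comm, ← Real.exp_add]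
  gcongr ?_ * ?_
  rw [Real.exp_le_exp]
  have : 3 * κ ^ 2 * y - y ^ 3 ≤ 2 * κ ^ 3 := by
    nlinarith [mul_nonneg (add_nonneg hy (by positivity : 0 ≤ 2 * κ)) (sq_nonneg (y - κ))]
  have h2 : ε * (3 * κ ^ 2 * y - y ^ 3) ≤ 1 * (2 * κ ^ 3) := by
    rcases le_total 0 (3 * κ ^ 2 * y - y ^ 3) with h | h
    · exact mul_le_mul h1 this h zero_le_one
    · exact (mul_nonpos_of_nonneg_of_nonpos hε h).trans (by positivity)
  linarith

theorem continuousAt_tiltInt (ε : ℝ) {b : ℝ} (hb : 0 < b) {s : ℂ} (hs : 0 ≤ s.re) :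
    ContinuousAt (tiltInt ε b) s := by
  unfold tiltInt
  refine ContinuousAt.mul ?_ (by fun_prop)
  exact Complex.continuousAt_cpow_const_of_re_pos (Or.inl hs) (by simpa using hb)

theorem integrableOn_tiltInt {κ ε : ℝ} (hκ : 0 < κ) (hε : 0 ≤ ε) (h1 : ε ≤ 1) {b : ℝ}
    (hb : 0 < b) :
    IntegrableOn (fun y : ℝ => tiltInt ε b (κ + y * Complex.I)) (Set.Ioi 0) := by
  have hi := ((integrable_limInt (κ := κ) (lam := 0) (by simpa) b).comp_neg.norm.const_mul
    (Real.exp (2 * κ ^ 3))).integrableOn (s := Set.Ioi 0)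
  refine Integrable.mono' hi ?_ ?_
  · refine Continuous.aestronglyMeasurable (continuous_iff_continuousAt.2 fun y => ?_)
    exact ContinuousAt.comp (f := fun y : ℝ => (κ + y * Complex.I : ℂ))
      (continuousAt_tiltInt ε hb (by simpa using hκ.le)) (by fun_prop)
  · filter_upwards [ae_restrict_mem measurableSet_Ioi] with y (hy : 0 < y)
    exact norm_tiltInt_le hκ hε h1 hy.le b

theorem tiltInt_mul_I {y : ℝ} (hy : 0 < y) (ε b : ℝ) : tiltInt ε b (y * Complex.I) =
    Complex.I ^ (b : ℂ) * ((y : ℂ) ^ (b : ℂ) * Complex.exp (-((ε + Complex.I / 3) * y ^ 3))) := by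
  rw [tiltInt, ofReal_mul_cpow hy Complex.I_ne_zero, Complex.ofReal_cpow hy.le, mul_comm ((y : ℂ) ^ _),
    mul_assoc]
  congr 3
  have h3 := Complex.I_pow_three
  have h4 := Complex.I_pow_four
  linear_combination y ^ 3 / 3 * h3 - ε * y ^ 3 * h4

theorem integral_tiltInt_mul_I {ε b : ℝ} (hε : 0 < ε) (hb : 0 < b) :
    ∫ y in Set.Ioi (0 : ℝ), tiltInt ε b (y * Complex.I) =
      Complex.I ^ (b : ℂ) * ((ε + Complex.I / 3) ^ (-(((b + 1) / 3 : ℝ) : ℂ)) *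
        Complex.Gamma ((b + 1) / 3 : ℝ) / 3) := by
  rw [← integral_ofReal_cpow_mul_exp_neg_mul_cube hb (r := ε + Complex.I / 3)
    (by simpa using hε), ← integral_const_mul]
  exact setIntegral_congr_fun measurableSet_Ioi fun y hy => tiltInt_mul_I hy ε b

theorem integrableOn_tiltInt_mul_I {ε b : ℝ} (hε : 0 < ε) (hb : 0 < b) :
    IntegrableOn (fun y : ℝ => tiltInt ε b (y * Complex.I)) (Set.Ioi 0) := by
  have hi := integrableOn_rpow_mul_exp_neg_mul_rpow (s := b) (p := (3 : ℕ)) (b := ε) (by linarith)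
    (by norm_num) hε
  refine Integrable.mono' hi ?_ ?_
  · refine ContinuousOn.aestronglyMeasurable (fun y hy => ?_) measurableSet_Ioi
    refine ContinuousAt.continuousWithinAt ?_
    exact ContinuousAt.comp (f := fun y : ℝ => (y * Complex.I : ℂ))
      (continuousAt_tiltInt ε hb (by simp)) (by fun_prop)
  · filter_upwards [ae_restrict_mem measurableSet_Ioi] with y (hy : 0 < y)
    have := norm_tiltInt ε b 0 y
    simp only [Complex.ofReal_zero, zero_add] at this
    rw [this, norm_mul, Complex.norm_I, mul_one, Complex.norm_real, Real.norm_of_nonneg hy.le]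
    apply le_of_eq
    rw [Real.rpow_natCast]; congr 2; ring

theorem rect_tiltInt (ε : ℝ) {b κ R : ℝ} (hb : 0 < b) (hκ : 0 < κ) :
    (∫ x in (0 : ℝ)..κ, tiltInt ε b x) - (∫ x in (0 : ℝ)..κ, tiltInt ε b (x + R * Complex.I)) +
      Complex.I * (∫ y in (0 : ℝ)..R, tiltInt ε b (κ + y * Complex.I)) -
      Complex.I * (∫ y in (0 : ℝ)..R, tiltInt ε b (y * Complex.I)) = 0 := by
  have h := Complex.integral_boundary_rect_eq_zero_of_continuousOn_of_differentiableOn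
    (tiltInt ε b) 0 (κ + R * Complex.I) (fun s hs => ?_) (fun s hs => ?_)
  · simpa using h
  · rw [Complex.mem_reProdIm] at hs
    refine (continuousAt_tiltInt ε hb ?_).continuousWithinAt
    have := hs.1
    simp [Set.uIcc_of_le hκ.le] at this
    exact this.1
  · rw [Complex.mem_reProdIm] at hs
    have := hs.1
    simp [hκ.le] at this
    refine DifferentiableAt.differentiableWithinAt ?_
    unfold tiltInt
    refine DifferentiableAt.mul ?_ (by fun_prop)
    exact DifferentiableAt.cpow (by fun_prop) (by fun_prop) (Or.inl this.1)

theorem tendsto_top_tiltInt {ε b κ : ℝ} (hε : 0 < ε) (hb : 0 < b) (hκ : 0 < κ) :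
    Tendsto (fun R : ℝ => ∫ x in (0 : ℝ)..κ, tiltInt ε b (x + R * Complex.I)) atTop (nhds 0) := by
  have hlim : Tendsto (fun R : ℝ => Real.exp (b * κ + κ ^ 3 / 3 - R) * |κ - 0|) atTop (nhds 0) := by
    have : Tendsto (fun R : ℝ => b * κ + κ ^ 3 / 3 - R) atTop atBot :=
      tendsto_atBot_add_const_left _ _ tendsto_neg_atTop_atBot
    simpa using (Real.tendsto_exp_atBot.comp this).mul_const |κ - 0|
  refine squeeze_zero_norm' ?_ hlim
  have h2 : Tendsto (fun R : ℝ => ε * R ^ 2) atTop atTop :=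
    (tendsto_pow_atTop two_ne_zero).const_mul_atTop hε
  filter_upwards [h2.eventually_ge_atTop (b + 3 * ε * κ ^ 2 + 1), eventually_gt_atTop 0] with R hR hR0
  refine intervalIntegral.norm_integral_le_of_norm_le_const fun x hx => ?_
  rw [Set.uIoc_of_le hκ.le] at hx
  obtain ⟨hx0, hxκ⟩ := hx
  rw [norm_tiltInt]
  have hn : ‖(x + R * Complex.I : ℂ)‖ ≤ Real.exp (κ + R) := by
    refine (norm_add_le _ _).trans ?_
    rw [norm_mul, Complex.norm_I, mul_one, Complex.norm_real, Complex.norm_real,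
      Real.norm_of_nonneg hx0.le, Real.norm_of_nonneg hR0.le]
    linarith [Real.add_one_le_exp (κ + R)]
  have h3 := Real.rpow_le_rpow (norm_nonneg _) hn hb.le
  rw [← Real.exp_mul] at h3
  refine (mul_le_mul_of_nonneg_right h3 (Real.exp_pos _).le).trans ?_
  rw [← Real.exp_add, Real.exp_le_exp]
  have h4 : x ^ 3 ≤ κ ^ 3 := by gcongr
  have h5 : x ^ 2 ≤ κ ^ 2 := by gcongr
  have h6 : ε * R * x ^ 2 ≤ ε * R * κ ^ 2 := by gcongr
  have h7 : 0 ≤ x * R ^ 2 := by positivity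
  have h8 := mul_le_mul_of_nonneg_right hR hR0.le
  nlinarith

theorem tiltInt_contour {ε b κ : ℝ} (hε : 0 < ε) (h1 : ε ≤ 1) (hb : 0 < b) (hκ : 0 < κ) :
    (∫ x in (0 : ℝ)..κ, tiltInt ε b x) +
      Complex.I * (∫ y in Set.Ioi (0 : ℝ), tiltInt ε b (κ + y * Complex.I)) =
      Complex.I * (∫ y in Set.Ioi (0 : ℝ), tiltInt ε b (y * Complex.I)) := by
  have t1 := intervalIntegral_tendsto_integral_Ioi 0 (integrableOn_tiltInt hκ hε.le h1 hb) tendsto_id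
  have t2 := intervalIntegral_tendsto_integral_Ioi 0 (integrableOn_tiltInt_mul_I hε hb) tendsto_id
  have t := ((tendsto_const_nhds (x := ∫ x in (0 : ℝ)..κ, tiltInt ε b x)).sub
    (tendsto_top_tiltInt hε hb hκ)).add (t1.const_mul Complex.I) |>.sub (t2.const_mul Complex.I)
  have h0 := tendsto_nhds_unique (t.congr' ?_) tendsto_const_nhds (b := (0 : ℂ))
  · rw [sub_zero] at h0; exact sub_eq_zero.1 h0
  · exact .of_forall fun R => rect_tiltInt ε hb hκ

theorem tendsto_integral_tiltInt_vline {b κ : ℝ} (hb : 0 < b) (hκ : 0 < κ) :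
    Tendsto (fun ε : ℝ => ∫ y in Set.Ioi (0 : ℝ), tiltInt ε b (κ + y * Complex.I))
      (nhdsWithin 0 (Set.Ioi 0)) (nhds (∫ y in Set.Ioi (0 : ℝ), tiltInt 0 b (κ + y * Complex.I))) := by
  have hev : ∀ᶠ ε : ℝ in nhdsWithin 0 (Set.Ioi 0), 0 < ε ∧ ε ≤ 1 := by
    filter_upwards [Ioo_mem_nhdsGT (zero_lt_one (α := ℝ))] with ε h using ⟨h.1, h.2.le⟩
  refine tendsto_integral_filter_of_dominated_convergence
    (fun y => Real.exp (2 * κ ^ 3) * ‖limInt κ 0 b (-y)‖) ?_ ?_ ?_ ?_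
  · filter_upwards [hev] with ε h using (integrableOn_tiltInt hκ h.1.le h.2 hb).1
  · filter_upwards [hev] with ε h
    filter_upwards [ae_restrict_mem measurableSet_Ioi] with y (hy : 0 < y)
    exact norm_tiltInt_le hκ h.1.le h.2 hy.le b
  · exact ((integrable_limInt (κ := κ) (lam := 0) (by simpa) b).comp_neg.norm.const_mul
      (Real.exp (2 * κ ^ 3))).integrableOn (s := Set.Ioi 0)
  · refine .of_forall fun y => tendsto_nhdsWithin_of_tendsto_nhds ?_
    have : Continuous fun ε : ℝ => tiltInt ε b (κ + y * Complex.I) := by unfold tiltInt; fun_prop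
    exact this.tendsto 0

theorem tendsto_integral_tiltInt_real {b κ : ℝ} (hb : 0 < b) (hκ : 0 < κ) :
    Tendsto (fun ε : ℝ => ∫ x in (0 : ℝ)..κ, tiltInt ε b x)
      (nhdsWithin 0 (Set.Ioi 0)) (nhds (∫ x in (0 : ℝ)..κ, tiltInt 0 b x)) := by
  have hc : ∀ ε, ContinuousOn (fun x : ℝ => tiltInt ε b x) (Set.uIcc 0 κ) := fun ε x hx => by
    rw [Set.uIcc_of_le hκ.le] at hx
    refine ContinuousAt.continuousWithinAt ?_
    exact ContinuousAt.comp (f := fun y : ℝ => (y : ℂ))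
      (continuousAt_tiltInt ε hb (by simpa using hx.1)) (by fun_prop)
  have hn : ∀ ε, ∀ x : ℝ, 0 < x → ‖tiltInt ε b x‖ = ‖tiltInt 0 b x‖ := fun ε x hx => by
    have h1 := norm_tiltInt ε b x 0
    have h2 := norm_tiltInt 0 b x 0
    simp at h1 h2
    rw [h1, h2]
  refine intervalIntegral.tendsto_integral_filter_of_dominated_convergence
    (fun x => ‖tiltInt 0 b x‖) ?_ ?_ ?_ ?_
  · refine .of_forall fun ε => ?_
    exact ((hc ε).mono Set.uIoc_subset_uIcc).aestronglyMeasurable measurableSet_uIoc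
  · refine .of_forall fun ε => .of_forall fun x hx => ?_
    rw [Set.uIoc_of_le hκ.le] at hx
    exact (hn ε x hx.1).le
  · exact (hc 0).norm.intervalIntegrable
  · refine .of_forall fun x _ => tendsto_nhdsWithin_of_tendsto_nhds ?_
    have : Continuous fun ε : ℝ => tiltInt ε b x := by unfold tiltInt; fun_prop
    exact this.tendsto 0
end RandomXor

namespace RandomXor
open MeasureTheory Filter

theorem tendsto_integral_tiltInt_axis {b : ℝ} (hb : 0 < b) :
    Tendsto (fun ε : ℝ => Complex.I * ∫ y in Set.Ioi (0 : ℝ), tiltInt ε b (y * Complex.I))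
      (nhdsWithin 0 (Set.Ioi 0)) (nhds (Complex.exp (Real.pi * ((b + 1) / 3 : ℝ) * Complex.I) *
        ((3 ^ ((b + 1) / 3 - 1) * Real.Gamma ((b + 1) / 3) : ℝ) : ℂ))) := by
  have h1 : Tendsto (fun ε : ℝ => Complex.I * (Complex.I ^ (b : ℂ) *
      (((ε : ℂ) + Complex.I / 3) ^ (-(((b + 1) / 3 : ℝ) : ℂ)) *
        Complex.Gamma ((b + 1) / 3 : ℝ) / 3))) (nhdsWithin 0 (Set.Ioi 0))
      (nhds (Complex.I * (Complex.I ^ (b : ℂ) *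
      ((((0 : ℝ) : ℂ) + Complex.I / 3) ^ (-(((b + 1) / 3 : ℝ) : ℂ)) *
        Complex.Gamma ((b + 1) / 3 : ℝ) / 3)))) := by
    refine tendsto_nhdsWithin_of_tendsto_nhds ?_
    refine Tendsto.const_mul _ (Tendsto.const_mul _ (Tendsto.div_const (Tendsto.mul_const _ ?_) _))
    refine ContinuousAt.tendsto (f := fun ε : ℝ =>
      ((ε : ℂ) + Complex.I / 3) ^ (-(((b + 1) / 3 : ℝ) : ℂ))) ?_
    refine ContinuousAt.cpow (by fun_prop) (by fun_prop) (Or.inr ?_)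
    simp
  have h2 : Complex.I * (Complex.I ^ (b : ℂ) *
      ((((0 : ℝ) : ℂ) + Complex.I / 3) ^ (-(((b + 1) / 3 : ℝ) : ℂ)) *
        Complex.Gamma ((b + 1) / 3 : ℝ) / 3)) =
      Complex.exp (Real.pi * ((b + 1) / 3 : ℝ) * Complex.I) *
        ((3 ^ ((b + 1) / 3 - 1) * Real.Gamma ((b + 1) / 3) : ℝ) : ℂ) := by
    have e1 : (((0 : ℝ) : ℂ) + Complex.I / 3) = ((1 / 3 : ℝ) : ℂ) * Complex.I := by push_cast; ring
    have e2 : -(((b + 1) / 3 : ℝ) : ℂ) = ((-((b + 1) / 3) : ℝ) : ℂ) := by push_cast; ring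
    have e3 : (1 / 3 : ℝ) ^ (-((b + 1) / 3)) = 3 ^ ((b + 1) / 3 - 1) * 3 := by
      rw [one_div, Real.inv_rpow (by norm_num), ← Real.rpow_neg (by norm_num), neg_neg]
      conv_rhs => rw [← Real.rpow_add_one (by norm_num)]
      congr 1; ring
    have e4 : ∀ c : ℝ, Complex.I ^ (c : ℂ) = Complex.exp (Real.pi * (c / 2) * Complex.I) := fun c => by
      rw [Complex.cpow_def_of_ne_zero Complex.I_ne_zero, Complex.log_I]; congr 1; ring
    have e5 : Complex.I = Complex.exp (Real.pi * (((1 : ℝ) : ℂ) / 2) * Complex.I) := by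
      rw [← e4]; simp
    rw [e1, e2, ofReal_mul_cpow (by norm_num) Complex.I_ne_zero, e3, Complex.Gamma_ofReal, e4, e4]
    have e6 : Complex.I * (Complex.exp (Real.pi * (b / 2) * Complex.I) *
        Complex.exp (Real.pi * ((-((b + 1) / 3) : ℝ) / 2) * Complex.I)) =
        Complex.exp (Real.pi * ((b + 1) / 3 : ℝ) * Complex.I) := by
      have e7 : Complex.exp (Real.pi * (((1 : ℝ) : ℂ) / 2) * Complex.I) * Complex.exp (Real.pi *
          (b / 2) * Complex.I + Real.pi * ((-((b + 1) / 3) : ℝ) / 2) * Complex.I) =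
          Complex.exp (Real.pi * ((b + 1) / 3 : ℝ) * Complex.I) := by
        rw [← Complex.exp_add]; congr 1; push_cast; ring
      rwa [← e5, Complex.exp_add] at e7
    rw [← e6]; push_cast; ring
  rw [h2] at h1
  refine h1.congr' ?_
  filter_upwards [self_mem_nhdsWithin] with ε hε
  rw [integral_tiltInt_mul_I hε hb]

theorem re_integral_tiltInt {b κ : ℝ} (hb : 0 < b) (hκ : 0 < κ) :
    (∫ y in Set.Ioi (0 : ℝ), tiltInt 0 b (κ + y * Complex.I)).re =
      3 ^ ((b + 1) / 3 - 1) * Real.Gamma ((b + 1) / 3) * Real.sin (Real.pi * ((b + 1) / 3)) := by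
  have t := (tendsto_integral_tiltInt_real hb hκ).add
    ((tendsto_integral_tiltInt_vline hb hκ).const_mul Complex.I)
  have h := tendsto_nhds_unique (t.congr' ?_) (tendsto_integral_tiltInt_axis hb)
  · have h1 := congrArg Complex.im h
    have h2 : (∫ x in (0 : ℝ)..κ, tiltInt 0 b x) =
        ((∫ x in (0 : ℝ)..κ, x ^ b * Real.exp (x ^ 3 / 3) : ℝ) : ℂ) := by
      rw [← intervalIntegral.integral_ofReal]
      refine intervalIntegral.integral_congr fun x hx => ?_
      rw [Set.uIcc_of_le hκ.le] at hx
      simp only [tiltInt]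
      push_cast
      rw [Complex.ofReal_cpow hx.1]
      congr 2; ring
    rw [h2, Complex.add_im, Complex.ofReal_im, Complex.I_mul_im, zero_add] at h1
    rw [h1, Complex.im_mul_ofReal, ← Complex.ofReal_mul, Complex.exp_ofReal_mul_I_im]
    ring
  · filter_upwards [Ioo_mem_nhdsGT (zero_lt_one (α := ℝ))] with ε hε
    exact tiltInt_contour hε.1 hε.2.le hb hκ

theorem conj_limInt {κ : ℝ} (hκ : 0 < κ) (lam b t : ℝ) :
    (starRingEnd ℂ) (limInt κ lam b t) = limInt κ lam b (-t) := by
  have hz : (starRingEnd ℂ) (κ - t * Complex.I : ℂ) = κ - ((-t : ℝ) : ℂ) * Complex.I := by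
    simp
  have ha : (κ - t * Complex.I : ℂ).arg ≠ Real.pi :=
    (Complex.mem_slitPlane_iff_arg.1 (vline_mem_slitPlane hκ t)).1
  rw [limInt, limInt, map_mul, ← Complex.exp_conj, ← hz, Complex.conj_cpow _ _ ha]
  simp only [Complex.conj_ofReal, map_add, map_mul, map_div₀, map_pow, map_ofNat]

theorem contourK_zero_of_pos {κ b : ℝ} (hκ : 0 < κ) (hb : 0 < b) :
    contourK κ 0 b = ((3 ^ ((b - 2) / 3) * (Real.Gamma ((2 - b) / 3))⁻¹ : ℝ) : ℂ) := by
  have hi := integrable_limInt (κ := κ) (lam := 0) (by simpa) b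
  set V := ∫ y in Set.Ioi (0 : ℝ), tiltInt 0 b (κ + y * Complex.I) with hV
  have e1 : ∫ t in Set.Iic (0 : ℝ), limInt κ 0 b t = V := by
    have := integral_comp_neg_Ioi 0 (limInt κ 0 b)
    rw [neg_zero] at this
    rw [← this, hV]
    exact setIntegral_congr_fun measurableSet_Ioi fun t _ => (tiltInt_zero κ b t).symm
  have e2 : ∫ t in Set.Ioi (0 : ℝ), limInt κ 0 b t = (starRingEnd ℂ) V := by
    rw [hV, ← integral_conj]
    refine setIntegral_congr_fun measurableSet_Ioi fun t _ => ?_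
    rw [tiltInt_zero, conj_limInt hκ, neg_neg]
  have e3 : ∫ t, limInt κ 0 b t = ((2 * V.re : ℝ) : ℂ) := by
    rw [← intervalIntegral.integral_Iic_add_Ioi hi.integrableOn hi.integrableOn, e1, e2,
      Complex.add_conj]
  have hpi := Real.pi_pos
  rw [contourK, e3, ← Complex.ofReal_inv, ← Complex.ofReal_mul, re_integral_tiltInt hb hκ]
  congr 1
  have hG := Real.Gamma_mul_Gamma_one_sub ((b + 1) / 3)
  have hs : 1 - (b + 1) / 3 = (2 - b) / 3 := by ring
  have hs' : (b + 1) / 3 - 1 = (b - 2) / 3 := by ring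
  have hGp : 0 < Real.Gamma ((b + 1) / 3) := Real.Gamma_pos_of_pos (by positivity)
  rw [hs] at hG
  rw [hs']
  by_cases h0 : Real.sin (Real.pi * ((b + 1) / 3)) = 0
  · rw [h0, div_zero, mul_eq_zero, or_iff_right hGp.ne'] at hG
    rw [h0, hG]; simp
  · rw [eq_div_iff h0] at hG
    have hne : Real.Gamma ((2 - b) / 3) ≠ 0 := fun h => by
      rw [h] at hG; simp at hG; exact hpi.ne hG
    generalize Real.sin (Real.pi * ((b + 1) / 3)) = S at hG
    field_simp
    linear_combination hG

theorem contourK_zero {κ : ℝ} (hκ : 0 < κ) {b : ℝ} (hb : ∀ k : ℕ, b + 1 + 3 * k ≠ 0) :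
    contourK κ 0 b = ((3 ^ ((b - 2) / 3) * (Real.Gamma ((2 - b) / 3))⁻¹ : ℝ) : ℂ) := by
  obtain ⟨j, hj⟩ := exists_nat_gt (-b)
  have key : ∀ j : ℕ, ∀ b : ℝ, (∀ k : ℕ, b + 1 + 3 * k ≠ 0) → 0 < b + 3 * j →
      contourK κ 0 b = ((3 ^ ((b - 2) / 3) * (Real.Gamma ((2 - b) / 3))⁻¹ : ℝ) : ℂ) := by
    intro j
    induction j with
    | zero => intro b _ h; exact contourK_zero_of_pos hκ (by simpa using h)
    | succ j ih =>
      intro b hb h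
      have h1 := ih (b + 3) (fun k => by have := hb (k + 1); push_cast at this; convert this using 1; ring)
        (by push_cast at h; linarith)
      have h2 := contourK_recursion hκ b
      have hb0 : b + 1 ≠ 0 := by simpa using hb 0
      have hc : ((b + 1 : ℝ) : ℂ) ≠ 0 := Complex.ofReal_ne_zero.2 hb0
      apply mul_left_cancel₀ hc
      rw [eq_neg_of_add_eq_zero_left h2, h1, ← Complex.ofReal_neg, ← Complex.ofReal_mul]
      congr 1
      have h3 := Real.Gamma_add_one (s := (2 - (b + 3)) / 3) (by
        intro h; apply hb0; linarith)
      have h4 : (2 - (b + 3)) / 3 + 1 = (2 - b) / 3 := by ring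
      rw [h4] at h3
      have h5 : (3 : ℝ) ^ ((b + 3 - 2) / 3) = 3 ^ ((b - 2) / 3) * 3 := by
        rw [← Real.rpow_add_one (by norm_num)]; congr 1; ring
      have h6 : (2 - (b + 3)) / 3 = -((b + 1) / 3) := by ring
      rw [h3, h5, h6, mul_inv]
      field_simp
  refine key j b hb ?_
  have : (0 : ℝ) ≤ j := by positivity
  linarith

/-- The series in the definition of `Afun`, as a function of `x = 3 ^ (2 / 3) * λ / 2`. -/
noncomputable def gammaSeries (y x : ℝ) (k : ℕ) : ℝ :=
  x ^ k / k.factorial * (Real.Gamma ((y + 1 - 2 * k) / 3))⁻¹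

theorem contourK_term {κ : ℝ} (hκ : 0 < κ) {y : ℝ} (hy : ∀ k j : ℕ, 2 - y + 2 * k + 3 * j ≠ 0)
    (lam : ℝ) (k : ℕ) : ((lam / 2) ^ k / k.factorial : ℂ) * contourK κ 0 (1 - y + 2 * k) =
      ((((3 : ℝ) ^ ((y + 1) / 3))⁻¹ * gammaSeries y (3 ^ ((2 : ℝ) / 3) * lam / 2) k : ℝ) : ℂ) := by
  rw [contourK_zero hκ fun j => by have := hy k j; convert this using 1; ring]
  have h1 : (3 : ℝ) ^ ((1 - y + 2 * k - 2) / 3) =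
      ((3 : ℝ) ^ ((y + 1) / 3))⁻¹ * ((3 : ℝ) ^ ((2 : ℝ) / 3)) ^ k := by
    rw [← Real.rpow_neg (by norm_num), ← Real.rpow_natCast, ← Real.rpow_mul (by norm_num),
      ← Real.rpow_add (by norm_num)]
    congr 1; ring
  have h2 : (2 - (1 - y + 2 * k)) / 3 = (y + 1 - 2 * k) / 3 := by ring
  rw [gammaSeries, h1, h2, mul_div_assoc, mul_pow]
  push_cast; ring

theorem summable_gammaSeries {y : ℝ} (hy : ∀ k j : ℕ, 2 - y + 2 * k + 3 * j ≠ 0) (x : ℝ) :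
    Summable (gammaSeries y x) := by
  set lam := x * 2 / 3 ^ ((2 : ℝ) / 3) with hl
  have h3 : (0 : ℝ) < 3 ^ ((2 : ℝ) / 3) := by positivity
  have hx : x = 3 ^ ((2 : ℝ) / 3) * lam / 2 := by rw [hl]; field_simp
  have h := (hasSum_contourK (κ := |lam| + 1) (lam := lam) (by linarith) (1 - y)).summable
  rw [funext fun k => contourK_term (by positivity) hy lam k, Complex.summable_ofReal,
    summable_mul_left_iff (by positivity), ← hx] at h
  exact h

theorem contourK_eq_Afun {κ lam : ℝ} (hκ : |lam| < κ) {y : ℝ}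
    (hy : ∀ k j : ℕ, 2 - y + 2 * k + 3 * j ≠ 0) :
    contourK κ lam (1 - y) = ((Real.exp (lam ^ 3 / 6) * Afun y lam : ℝ) : ℂ) := by
  have hκ0 : 0 < κ := (abs_nonneg _).trans_lt hκ
  have h := (hasSum_contourK hκ (1 - y)).tsum_eq
  rw [funext fun k => contourK_term hκ0 hy lam k, ← Complex.ofReal_tsum, tsum_mul_left] at h
  rw [← h, Afun]
  congr 1
  change _ = _ * (_ / _ * ∑' k, gammaSeries y _ k)
  rw [div_mul_eq_mul_div, ← mul_div_assoc, ← mul_assoc, ← Real.exp_add]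
  have : lam ^ 3 / 6 + -lam ^ 3 / 6 = 0 := by ring
  rw [this, Real.exp_zero, one_mul, inv_mul_eq_div]
end RandomXor

namespace RandomXor
open MeasureTheory Filter

theorem nonint_term {y : ℝ} (hy : ∀ z : ℤ, y ≠ z) (k j : ℕ) : 2 - y + 2 * k + 3 * j ≠ 0 := fun h =>
  hy (2 + 2 * k + 3 * j) (by push_cast; linarith)

theorem nonint_add_natCast {y : ℝ} (hy : ∀ z : ℤ, y ≠ z) (j : ℕ) : ∀ z : ℤ, y + j ≠ z :=
  fun z h => hy (z - j) (by push_cast; linarith)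

theorem nonint_sub_natCast {y : ℝ} (hy : ∀ z : ℤ, y ≠ z) (j : ℕ) : ∀ z : ℤ, y - j ≠ z :=
  fun z h => hy (z + j) (by push_cast; linarith)

theorem tendsto_BB_real {lam y : ℝ} (hy : ∀ z : ℤ, y ≠ z) {L : ℕ → ℝ} {N : ℕ → ℝ} {m : ℕ → ℕ}
    (hL : Tendsto L atTop (nhds lam)) (hN : ∀ n : ℕ, N n = n - n * L n * dl n)
    (hm : Tendsto (fun n => (m n : ℝ) * dl n) atTop (nhds 0)) :
    Tendsto (fun n : ℕ => dl n ^ (y - 2) * Real.exp (-n - N n / 2) * BB n (N n) (m n) y) atTop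
      (nhds (Real.exp (lam ^ 3 / 6) * Afun y lam)) := by
  have h := tendsto_BB (κ := |lam| + 1) (y := y) (by linarith) hL hN hm
  rw [contourK_eq_Afun (by linarith) (nonint_term hy)] at h
  have h1 := (Complex.continuous_re.tendsto _).comp h
  simp only [Complex.ofReal_re] at h1
  exact h1.congr fun n => Complex.ofReal_re _

/-- The scale `N = n - λ n^(2/3)`. -/
noncomputable def critN (lam : ℝ) (n : ℕ) : ℝ := n - n * lam * dl n

theorem critN_nonneg (lam : ℝ) : ∀ᶠ n : ℕ in atTop, 0 ≤ critN lam n := by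
  have h : Tendsto (fun n : ℕ => lam * dl n) atTop (nhds (lam * 0)) := tendsto_dl.const_mul lam
  rw [mul_zero] at h
  filter_upwards [h.eventually_lt_const one_pos] with n hn
  rw [critN, show (n : ℝ) - n * lam * dl n = n * (1 - lam * dl n) by ring]
  exact mul_nonneg (Nat.cast_nonneg _) (by linarith)

theorem tendsto_BB_crit (lam : ℝ) {y : ℝ} (hy : ∀ z : ℤ, y ≠ z) :
    Tendsto (fun n : ℕ => dl n ^ (y - 2) * Real.exp (-n - critN lam n / 2) *
      BB n (critN lam n) 0 y) atTop (nhds (Real.exp (lam ^ 3 / 6) * Afun y lam)) :=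
  tendsto_BB_real (m := fun _ => 0) hy tendsto_const_nhds (fun _ => rfl) (by simp)

theorem Afun_nonneg (lam : ℝ) {y : ℝ} (hy : ∀ z : ℤ, y ≠ z) (h0 : 0 < y) : 0 ≤ Afun y lam := by
  refine (mul_nonneg_iff_of_pos_left (c := Real.exp (lam ^ 3 / 6)) (Real.exp_pos _)).1 ?_
  refine ge_of_tendsto (tendsto_BB_crit lam hy) ?_
  filter_upwards [critN_nonneg lam, eventually_gt_atTop 0] with n hn hn0
  have := BB_nonneg n hn 0 h0.le
  have := dl_pos hn0
  positivity

theorem Gamma_mul_Afun_sq_le (lam : ℝ) {y : ℝ} (hy : ∀ z : ℤ, y ≠ z) (h0 : 0 < y) :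
    (Real.Gamma (y + 1) * Afun (y + 1) lam) ^ 2 ≤
      (Real.Gamma y * Afun y lam) * (Real.Gamma (y + 2) * Afun (y + 2) lam) := by
  have t0 := (tendsto_BB_crit lam hy).const_mul (Real.Gamma y)
  have t1 := ((tendsto_BB_crit lam (y := y + 1) (by simpa using nonint_add_natCast hy 1)).const_mul
    (Real.Gamma (y + 1))).pow 2
  have t2 := (tendsto_BB_crit lam (y := y + 2) (by simpa using nonint_add_natCast hy 2)).const_mul
    (Real.Gamma (y + 2))
  have h := le_of_tendsto_of_tendsto t1 (t0.mul t2) ?_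
  · have hE := Real.exp_pos (lam ^ 3 / 6)
    refine le_of_mul_le_mul_left (a := Real.exp (lam ^ 3 / 6) ^ 2) ?_ (by positivity)
    linarith
  · filter_upwards [critN_nonneg lam, eventually_gt_atTop 0] with n hn hn0
    have h1 := Gamma_mul_BB_sq_le n hn 0 h0
    have hd := dl_pos hn0
    have e1 : dl n ^ (y + 1 - 2) = dl n ^ (y - 2) * dl n := by
      rw [← Real.rpow_add_one hd.ne']; congr 1; ring
    have e2 : dl n ^ (y + 2 - 2) = dl n ^ (y - 2) * dl n ^ 2 := by
      rw [← Real.rpow_natCast, ← Real.rpow_add hd]; congr 1; push_cast; ring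
    rw [e1, e2]
    have h2 := mul_le_mul_of_nonneg_left h1
      (by positivity : 0 ≤ (dl n ^ (y - 2) * dl n * Real.exp (-n - critN lam n / 2)) ^ 2)
    linarith

theorem Afun_add_natCast_eq_zero {lam y : ℝ} (hy : ∀ z : ℤ, y ≠ z) (h0 : 0 < y)
    (h : Afun y lam = 0) (j : ℕ) : Afun (y + j) lam = 0 := by
  induction j with
  | zero => simpa using h
  | succ j ih =>
    have hj : 0 < y + j := by positivity
    have h1 := Gamma_mul_Afun_sq_le lam (nonint_add_natCast hy j) hj
    rw [ih, mul_zero, zero_mul] at h1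
    have h2 := pow_eq_zero_iff (two_ne_zero) |>.1 (le_antisymm h1 (sq_nonneg _))
    rw [mul_eq_zero, or_iff_right (Real.Gamma_pos_of_pos (by linarith)).ne'] at h2
    push_cast; rw [← h2]; congr 1; ring

theorem Afun_eq_zero_iff (y lam : ℝ) :
    Afun y lam = 0 ↔ ∑' k, gammaSeries y (3 ^ ((2 : ℝ) / 3) * lam / 2) k = 0 := by
  have : Afun y lam = Real.exp (-lam ^ 3 / 6) / (3 : ℝ) ^ ((y + 1) / 3) *
    ∑' k, gammaSeries y (3 ^ ((2 : ℝ) / 3) * lam / 2) k := rfl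
  rw [this, mul_eq_zero, or_iff_right (by positivity)]

theorem tsum_gammaSeries_sub_three {y : ℝ} (hy : ∀ z : ℤ, y ≠ z) (x : ℝ) :
    ∑' k, gammaSeries (y - 3) x k = (y - 2) / 3 * ∑' k, gammaSeries y x k -
      2 / 3 * x * ∑' k, gammaSeries (y - 2) x k := by
  have s0 := summable_gammaSeries (nonint_term hy) x
  have s2 := summable_gammaSeries (y := y - 2) (nonint_term (by simpa using nonint_sub_natCast hy 2)) x
  have hk : HasSum (fun k : ℕ => (k : ℝ) * gammaSeries y x k) (x * ∑' k, gammaSeries (y - 2) x k) := by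
    refine (hasSum_nat_add_iff' 1).1 ?_
    simp only [Finset.range_one, Finset.sum_singleton, Nat.cast_zero, zero_mul, sub_zero]
    rw [funext fun k : ℕ => (?_ : ((k + 1 : ℕ) : ℝ) * gammaSeries y x (k + 1) =
      x * gammaSeries (y - 2) x k)]
    · exact s2.hasSum.mul_left x
    · have e : (y + 1 - 2 * ((k + 1 : ℕ) : ℝ)) / 3 = (y - 2 + 1 - 2 * k) / 3 := by push_cast; ring
      rw [gammaSeries, gammaSeries, e, Nat.factorial_succ, pow_succ]
      push_cast
      field_simp
  have h := (s0.hasSum.mul_left ((y - 2) / 3)).sub (hk.mul_left (2 / 3))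
  rw [mul_assoc, ← h.tsum_eq]
  refine tsum_congr fun k => ?_
  have hz : (y + 1 - 2 * k) / 3 - 1 ≠ 0 := fun h => hy (2 + 2 * k) (by push_cast; linarith)
  have hG := Real.Gamma_add_one hz
  rw [sub_add_cancel] at hG
  have e : (y - 3 + 1 - 2 * k) / 3 = (y + 1 - 2 * k) / 3 - 1 := by ring
  rw [gammaSeries, gammaSeries, e, hG, mul_inv]
  have : ((y + 1 - 2 * k) / 3 - 1) * ((y + 1 - 2 * k) / 3 - 1)⁻¹ = 1 := mul_inv_cancel₀ hz
  linear_combination (-(x ^ k / k.factorial * (Real.Gamma ((y + 1 - 2 * k) / 3 - 1))⁻¹)) * this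

theorem sum_antidiagonal_pow_div_factorial (a b : ℝ) (n : ℕ) :
    ∑ p ∈ Finset.HasAntidiagonal.antidiagonal n,
      a ^ p.1 / p.1.factorial * (b ^ p.2 / p.2.factorial) = (a + b) ^ n / n.factorial := by
  rw [add_pow, Finset.Nat.sum_antidiagonal_eq_sum_range_succ_mk, Finset.sum_div]
  refine Finset.sum_congr rfl fun i hi => ?_
  have hi' : i ≤ n := by simpa [Nat.lt_succ_iff] using hi
  rw [Nat.cast_choose ℝ hi']
  have : (n.factorial : ℝ) ≠ 0 := by positivity
  field_simp

theorem sum_antidiagonal_pow_mul (a b : ℝ) (G : ℕ → ℝ) (n : ℕ) :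
    ∑ p ∈ Finset.HasAntidiagonal.antidiagonal n,
      a ^ p.1 / p.1.factorial * (b ^ p.2 / p.2.factorial * G (p.1 + p.2)) =
      (a + b) ^ n / n.factorial * G n := by
  rw [← sum_antidiagonal_pow_div_factorial, Finset.sum_mul]
  refine Finset.sum_congr rfl fun p hp => ?_
  rw [Finset.HasAntidiagonal.mem_antidiagonal.1 hp, mul_assoc]

theorem tsum_antidiagonal_cancel {G : ℕ → ℝ} (hG : ∀ x : ℝ, Summable fun k : ℕ => x ^ k / k.factorial * G k)
    (x : ℝ) (h : ∀ i : ℕ, ∑' k : ℕ, x ^ k / k.factorial * G (i + k) = 0) : G 0 = 0 := by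
  set F : ℕ × ℕ → ℝ := fun p => (-x) ^ p.1 / p.1.factorial * (x ^ p.2 / p.2.factorial * G (p.1 + p.2))
    with hF
  have hsum : Summable F := by
    refine Summable.of_norm ?_
    rw [← Finset.HasAntidiagonal.sigmaAntidiagonalEquivProd.summable_iff]
    refine (summable_sigma_of_nonneg fun _ => norm_nonneg _).2 ⟨fun n => ?_, ?_⟩
    · exact (hasSum_fintype _).summable
    · refine ((hG (|x| + |x|)).norm).congr fun n => ?_
      rw [tsum_fintype]
      simp only [Finset.HasAntidiagonal.sigmaAntidiagonalEquivProd_apply]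
      rw [Finset.univ_eq_attach, Finset.sum_attach (Finset.HasAntidiagonal.antidiagonal n)
        (fun p => ‖F p‖)]
      simp only [hF, norm_mul, norm_div, norm_pow, norm_neg, RCLike.norm_natCast]
      rw [sum_antidiagonal_pow_mul ‖x‖ ‖x‖ (fun k => ‖G k‖)]
      simp only [Real.norm_eq_abs, abs_of_nonneg (add_nonneg (abs_nonneg x) (abs_nonneg x))]
  have h1 : ∑' p, F p = 0 := by
    rw [hsum.tsum_prod]
    simp only [hF, tsum_mul_left, h, mul_zero, tsum_zero]
  have hval : ∀ n : ℕ, ∑' p : Finset.HasAntidiagonal.antidiagonal n,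
      F (Finset.HasAntidiagonal.sigmaAntidiagonalEquivProd ⟨n, p⟩) = (-x + x) ^ n / n.factorial * G n := by
    intro n
    rw [tsum_fintype, Finset.univ_eq_attach]
    simp only [Finset.HasAntidiagonal.sigmaAntidiagonalEquivProd_apply]
    rw [Finset.sum_attach (Finset.HasAntidiagonal.antidiagonal n) F, hF, sum_antidiagonal_pow_mul]
  rw [← Finset.HasAntidiagonal.sigmaAntidiagonalEquivProd.tsum_eq, Summable.tsum_sigma'] at h1
  · rw [← h1, tsum_eq_single 0]
    · rw [hval]; simp
    · intro n hn
      rw [hval, neg_add_cancel, zero_pow hn]; simp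
  · exact fun n => (hasSum_fintype _).summable
  · exact (Finset.HasAntidiagonal.sigmaAntidiagonalEquivProd.summable_iff).2 hsum

theorem Afun_pos (lam : ℝ) {y : ℝ} (hy : ∀ z : ℤ, y ≠ z) (h0 : 0 < y) : 0 < Afun y lam := by
  refine (Afun_nonneg lam hy h0).lt_of_ne fun h => ?_
  set x := (3 : ℝ) ^ ((2 : ℝ) / 3) * lam / 2 with hx
  have hpos : ∀ j : ℕ, ∑' k, gammaSeries (y + j) x k = 0 := fun j =>
    (Afun_eq_zero_iff _ _).1 (Afun_add_natCast_eq_zero hy h0 h.symm j)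
  have hneg : ∀ i : ℕ, ∀ j : ℕ, ∑' k, gammaSeries (y - i + j) x k = 0 := by
    intro i
    induction i with
    | zero => simpa using hpos
    | succ i ih =>
      intro j
      rcases j with _ | j
      · have h1 := tsum_gammaSeries_sub_three (y := y - i + (2 : ℕ))
          (nonint_add_natCast (nonint_sub_natCast hy i) 2) x
        rw [ih 2, show y - i + (2 : ℕ) - 2 = y - i + (0 : ℕ) by push_cast; ring, ih 0,
          mul_zero, mul_zero, sub_zero] at h1
        rw [show y - (i + 1 : ℕ) + (0 : ℕ) = y - i + (2 : ℕ) - 3 by push_cast; ring]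
        exact h1
      · rw [show y - (i + 1 : ℕ) + (j + 1 : ℕ) = y - i + j by push_cast; ring]
        exact ih j
  have h2 := tsum_antidiagonal_cancel (G := fun k => (Real.Gamma ((y + 1 - 2 * k) / 3))⁻¹)
    (fun x => summable_gammaSeries (nonint_term hy) x) x fun i => by
      have := hneg (2 * i) 0
      rw [← this]
      refine tsum_congr fun k => ?_
      rw [gammaSeries]; congr 3; push_cast; ring
  simp only [Nat.cast_zero, mul_zero, sub_zero, inv_eq_zero] at h2
  exact (Real.Gamma_pos_of_pos (by linarith)).ne' h2
end RandomXor

namespace RandomXor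
open MeasureTheory Filter

theorem abs_log_one_sub_add_le {p : ℝ} (h0 : 0 < p) (h1 : p ≤ 1 / 2) :
    |Real.log (1 - p) + p + p ^ 2 / 2| ≤ 2 * p ^ 3 := by
  have h := Real.abs_log_sub_add_sum_range_le (x := p) (by rw [abs_of_pos h0]; linarith) 2
  rw [abs_of_pos h0] at h
  simp only [Finset.sum_range_succ, Finset.sum_range_zero] at h
  norm_num at h
  rw [show Real.log (1 - p) + p + p ^ 2 / 2 = p + p ^ 2 / 2 + Real.log (1 - p) by ring]
  refine h.trans ?_
  rw [div_le_iff₀ (by linarith)]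
  have : 0 < p ^ 3 := by positivity
  nlinarith

theorem abs_sigP_sub_le {p : ℝ} (h0 : 0 < p) (h1 : p ≤ 1 / 2) :
    |sigP p - p / 2 - 3 * p ^ 2 / 8| ≤ 4 * p ^ 3 := by
  have h2 := abs_log_one_sub_add_le h0 h1
  have h3 := abs_log_one_sub_add_le (p := p / 2) (by linarith) (by linarith)
  rw [sigP, Real.log_div (by linarith) (by linarith)]
  have : 0 < p ^ 3 := by positivity
  rw [abs_le] at *
  constructor <;> nlinarith

theorem natCast_mul_pN (lam : ℝ) {n : ℕ} (hn : 0 < n) : n * pN lam n = 1 + lam * dl n := by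
  have : (n : ℝ) ≠ 0 := by positivity
  rw [pN, dl]; field_simp

theorem tendsto_natCast_mul_pN (lam : ℝ) :
    Tendsto (fun n : ℕ => n * pN lam n) atTop (nhds 1) := by
  have h : Tendsto (fun n : ℕ => 1 + lam * dl n) atTop (nhds (1 + lam * 0)) :=
    (tendsto_dl.const_mul lam).const_add 1
  rw [mul_zero, add_zero] at h
  refine h.congr' ?_
  filter_upwards [eventually_gt_atTop 0] with n hn using (natCast_mul_pN lam hn).symm

theorem tendsto_pN (lam : ℝ) : Tendsto (pN lam) atTop (nhds 0) := by
  have h := (tendsto_natCast_mul_pN lam).mul (tendsto_inv_atTop_nhds_zero_nat (𝕜 := ℝ))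
  rw [mul_zero] at h
  refine h.congr' ?_
  filter_upwards [eventually_gt_atTop 0] with n hn
  have : (n : ℝ) ≠ 0 := by positivity
  field_simp

theorem eventually_pN (lam : ℝ) : ∀ᶠ n : ℕ in atTop, 0 < n ∧ 0 < pN lam n ∧ pN lam n ≤ 1 / 2 := by
  filter_upwards [eventually_gt_atTop 0, (tendsto_natCast_mul_pN lam).eventually_const_lt one_half_lt_one,
    (tendsto_pN lam).eventually_le_const (one_half_pos)] with n hn h1 h2
  refine ⟨hn, ?_, h2⟩
  have : (0 : ℝ) < n := by positivity
  exact (mul_pos_iff_of_pos_left this).1 (by linarith : 0 < n * pN lam n)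

/-- The total mass of the dominating series. -/
noncomputable def domTotal (lam : ℝ) (n : ℕ) : ℝ :=
  (1 - pN lam n) ^ (n * (n - 1) / 2) * Real.exp (sigP (pN lam n) * n ^ 2 - sigP (pN lam n) * n / 2)

theorem cast_mul_pred_div_two (n : ℕ) : ((n * (n - 1) / 2 : ℕ) : ℝ) = n * (n - 1) / 2 := by
  rw [← Nat.choose_two_right, Nat.cast_choose_two]

theorem tendsto_domTotal (lam : ℝ) : Tendsto (domTotal lam) atTop (nhds (Real.exp (3 / 8))) := by
  have t1 := tendsto_natCast_mul_pN lam
  have t0 := tendsto_pN lam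
  have t2 : Tendsto (fun n : ℕ => n * pN lam n / 4 + (n * pN lam n) ^ 2 / 8 +
      n * pN lam n * pN lam n / 16) atTop (nhds (1 / 4 + 1 ^ 2 / 8 + 1 * 0 / 16)) :=
    ((t1.div_const 4).add ((t1.pow 2).div_const 8)).add ((t1.mul t0).div_const 16)
  have t3 : Tendsto (fun n : ℕ => 6 * ((n * pN lam n) ^ 2 * pN lam n)) atTop
      (nhds (6 * (1 ^ 2 * 0))) := ((t1.pow 2).mul t0).const_mul 6
  rw [mul_zero, mul_zero] at t3
  have t4 : Tendsto (fun n : ℕ => (n * (n - 1) / 2 : ℝ) * Real.log (1 - pN lam n) +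
      (sigP (pN lam n) * n ^ 2 - sigP (pN lam n) * n / 2) - (n * pN lam n / 4 +
      (n * pN lam n) ^ 2 / 8 + n * pN lam n * pN lam n / 16)) atTop (nhds 0) := by
    refine squeeze_zero_norm' ?_ t3
    filter_upwards [eventually_pN lam] with n ⟨hn, hp0, hp1⟩
    have h1 := abs_log_one_sub_add_le hp0 hp1
    have h2 := abs_sigP_sub_le hp0 hp1
    set p := pN lam n
    have hn1 : (1 : ℝ) ≤ n := by exact_mod_cast hn
    have e : (n * (n - 1) / 2 : ℝ) * Real.log (1 - p) + (sigP p * n ^ 2 - sigP p * n / 2) -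
        (n * p / 4 + (n * p) ^ 2 / 8 + n * p * p / 16) =
        (n * (n - 1) / 2) * (Real.log (1 - p) + p + p ^ 2 / 2) +
        (n ^ 2 - n / 2) * (sigP p - p / 2 - 3 * p ^ 2 / 8) := by ring
    rw [e, Real.norm_eq_abs]
    refine (abs_add_le _ _).trans ?_
    rw [abs_mul, abs_mul, abs_of_nonneg (by nlinarith : (0 : ℝ) ≤ n * (n - 1) / 2),
      abs_of_nonneg (by nlinarith : (0 : ℝ) ≤ n ^ 2 - n / 2)]
    have h3 := mul_le_mul_of_nonneg_left h1 (by nlinarith : (0 : ℝ) ≤ n * (n - 1) / 2)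
    have h4 := mul_le_mul_of_nonneg_left h2 (by nlinarith : (0 : ℝ) ≤ n ^ 2 - n / 2)
    have h5 : 0 ≤ n * p ^ 3 := by positivity
    nlinarith
  have t5 := (Real.continuous_exp.tendsto _).comp (t4.add t2)
  rw [show (0 + (1 / 4 + 1 ^ 2 / 8 + 1 * 0 / 16) : ℝ) = 3 / 8 by norm_num] at t5
  refine t5.congr' ?_
  filter_upwards [eventually_pN lam] with n ⟨hn, hp0, hp1⟩
  rw [Function.comp, sub_add_cancel, Real.exp_add, domTotal, ← cast_mul_pred_div_two, mul_comm (_ : ℝ)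
    (Real.log _), Real.exp_mul, Real.exp_log (by linarith), Real.rpow_natCast]

theorem tendsto_sigP_scaled (lam : ℝ) :
    Tendsto (fun n : ℕ => (2 * sigP (pN lam n) * n - 1) / dl n) atTop (nhds lam) := by
  have t1 := tendsto_natCast_mul_pN lam
  have t2 : Tendsto (fun n : ℕ => 5 * (n * pN lam n) ^ 2 * dl n ^ 2) atTop
      (nhds (5 * 1 ^ 2 * 0 ^ 2)) := ((t1.pow 2).const_mul 5).mul (tendsto_dl.pow 2)
  rw [zero_pow two_ne_zero, mul_zero] at t2
  have t3 : Tendsto (fun n : ℕ => (2 * sigP (pN lam n) * n - 1) / dl n - lam) atTop (nhds 0) := by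
    refine squeeze_zero_norm' ?_ t2
    filter_upwards [eventually_pN lam] with n ⟨hn, hp0, hp1⟩
    have h2 := abs_sigP_sub_le hp0 hp1
    have hnp := natCast_mul_pN lam hn
    have hd := dl_pos hn
    have h3 := mul_dl_pow hn
    set p := pN lam n
    have hn1 : (0 : ℝ) < n := by exact_mod_cast hn
    have e : (2 * sigP p * n - 1) / dl n - lam =
        n ^ 2 * dl n ^ 2 * (2 * sigP p - p) := by
      have : 1 / dl n = n * dl n ^ 2 := by rw [div_eq_iff hd.ne']; linarith
      rw [div_eq_mul_one_div, this]
      linear_combination lam * h3 + (n * dl n ^ 2) * hnp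
    have h4 : |2 * sigP p - p| ≤ 5 * p ^ 2 := by
      rw [abs_le] at *
      have : p ^ 3 ≤ p ^ 2 / 2 := by nlinarith [sq_nonneg p]
      have : 0 < p ^ 3 := by positivity
      constructor <;> nlinarith [sq_nonneg p]
    rw [e, Real.norm_eq_abs, abs_mul, abs_of_nonneg (by positivity)]
    have h5 := mul_le_mul_of_nonneg_left h4 (by positivity : 0 ≤ n ^ 2 * dl n ^ 2)
    linarith
  simpa using t3.add_const lam
end RandomXor

namespace RandomXor
open MeasureTheory Filter

theorem abs_log_sub_sinh_le {u : ℝ} (hu : |u| ≤ 1 / 2) :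
    |Real.log (1 + u) - (1 + u) / 2 + 1 / (2 * (1 + u)) + u ^ 3 / 6| ≤ 3 * u ^ 4 := by
  have h := Real.abs_log_sub_add_sum_range_le (x := -u) (by rw [abs_neg]; linarith) 3
  rw [abs_neg, sub_neg_eq_add] at h
  simp only [Finset.sum_range_succ, Finset.sum_range_zero] at h
  norm_num at h
  obtain ⟨h1, h2⟩ := abs_le.1 hu
  have h4 : |u| ^ 4 / (1 - |u|) ≤ 2 * u ^ 4 := by
    rw [div_le_iff₀ (by linarith), Even.pow_abs (by decide)]
    have : 0 ≤ u ^ 4 := by positivity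
    nlinarith
  have h5 : 1 / (2 * (1 + u)) = (1 - u + u ^ 2 - u ^ 3) / 2 + u ^ 4 / (2 * (1 + u)) := by
    have : 1 + u ≠ 0 := by linarith
    field_simp; ring
  have h6 : u ^ 4 / (2 * (1 + u)) ≤ u ^ 4 := by
    rw [div_le_iff₀ (by linarith)]
    have : 0 ≤ u ^ 4 := by positivity
    nlinarith
  have h7 : 0 ≤ u ^ 4 / (2 * (1 + u)) := div_nonneg (by positivity) (by linarith)
  have h8 := abs_le.1 (h.trans h4)
  rw [h5, abs_le]
  have h9 : (-u) ^ 3 = -u ^ 3 := by ring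
  constructor <;> nlinarith [h8.1, h8.2]

theorem tendsto_mul_log_sub_sinh (lam : ℝ) :
    Tendsto (fun n : ℕ => n * (Real.log (2 * sigP (pN lam n) * n) - 2 * sigP (pN lam n) * n / 2 +
      1 / (2 * (2 * sigP (pN lam n) * n)))) atTop (nhds (-lam ^ 3 / 6)) := by
  set v : ℕ → ℝ := fun n => (2 * sigP (pN lam n) * n - 1) / dl n with hv
  have tv : Tendsto v atTop (nhds lam) := tendsto_sigP_scaled lam
  have tu : Tendsto (fun n => |v n * dl n|) atTop (nhds |lam * 0|) := (tv.mul tendsto_dl).abs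
  rw [mul_zero, abs_zero] at tu
  have t1 : Tendsto (fun n => 3 * (v n ^ 4 * dl n)) atTop (nhds (3 * (lam ^ 4 * 0))) :=
    ((tv.pow 4).mul tendsto_dl).const_mul 3
  rw [mul_zero, mul_zero] at t1
  have t2 : Tendsto (fun n : ℕ => n * (Real.log (2 * sigP (pN lam n) * n) -
      2 * sigP (pN lam n) * n / 2 + 1 / (2 * (2 * sigP (pN lam n) * n))) - -v n ^ 3 / 6) atTop
      (nhds 0) := by
    refine squeeze_zero_norm' ?_ t1
    filter_upwards [tu.eventually_le_const one_half_pos, eventually_gt_atTop 0] with n h hn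
    have hd := dl_pos hn
    have h3 := mul_dl_pow hn
    have hw : 2 * sigP (pN lam n) * n = 1 + v n * dl n := by
      rw [hv]; field_simp; ring
    rw [hw]
    have h4 := mul_le_mul_of_nonneg_left (abs_log_sub_sinh_le h) (Nat.cast_nonneg (α := ℝ) n)
    rw [← abs_of_nonneg (Nat.cast_nonneg (α := ℝ) n), ← abs_mul,
      abs_of_nonneg (Nat.cast_nonneg (α := ℝ) n)] at h4
    rw [Real.norm_eq_abs]
    have e1 : (n : ℝ) * (3 * (v n * dl n) ^ 4) = 3 * (v n ^ 4 * dl n) := by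
      linear_combination 3 * v n ^ 4 * dl n * h3
    have e2 : (n : ℝ) * (Real.log (1 + v n * dl n) - (1 + v n * dl n) / 2 +
        1 / (2 * (1 + v n * dl n)) + (v n * dl n) ^ 3 / 6) =
        n * (Real.log (1 + v n * dl n) - (1 + v n * dl n) / 2 +
        1 / (2 * (1 + v n * dl n))) - -v n ^ 3 / 6 := by
      linear_combination v n ^ 3 / 6 * h3
    rwa [e1, e2] at h4
  have t3 : Tendsto (fun n => -v n ^ 3 / 6) atTop (nhds (-lam ^ 3 / 6)) :=
    ((tv.pow 3).neg).div_const 6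
  simpa using t2.add t3

/-- The prefactor after extracting the exponential scale. -/
noncomputable def prefac (lam : ℝ) (n : ℕ) : ℝ :=
  CC (pN lam n) n * Real.exp (n + (2 * sigP (pN lam n))⁻¹ / 2) * (n : ℝ) ^ (-(1 : ℝ) / 2)

theorem tendsto_prefac (lam : ℝ) : Tendsto (prefac lam) atTop
    (nhds (Real.exp (3 / 8) * Real.sqrt (2 * Real.pi) * Real.exp (-lam ^ 3 / 6))) := by
  have t := ((Stirling.tendsto_stirlingSeq_sqrt_pi.const_mul (Real.sqrt 2)).mul
    ((Real.continuous_exp.tendsto _).comp (tendsto_mul_log_sub_sinh lam))).mul (tendsto_domTotal lam)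
  rw [show Real.exp (3 / 8) * Real.sqrt (2 * Real.pi) * Real.exp (-lam ^ 3 / 6) =
    Real.sqrt 2 * Real.sqrt Real.pi * Real.exp (-lam ^ 3 / 6) * Real.exp (3 / 8) by
      rw [Real.sqrt_mul (by norm_num)]; ring]
  refine t.congr' ?_
  filter_upwards [eventually_pN lam] with n ⟨hn, hp0, hp1⟩
  have hs := sigP_pos hp0 (by linarith)
  simp only [Function.comp]
  rw [prefac, domTotal, CC, Stirling.stirlingSeq]
  set p := pN lam n
  set s := sigP p
  have hn0 : (0 : ℝ) < n := by exact_mod_cast hn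
  have e1 : Real.exp (n * (Real.log (2 * s * n) - 2 * s * n / 2 + 1 / (2 * (2 * s * n)))) =
      (2 * s) ^ n * (n : ℝ) ^ n * Real.exp (-(s * n ^ 2)) * Real.exp ((2 * s)⁻¹ / 2) := by
    rw [← mul_pow, ← Real.exp_log (by positivity : 0 < 2 * s * n), ← Real.exp_nat_mul,
      Real.exp_log (by positivity : 0 < 2 * s * n), ← Real.exp_add, ← Real.exp_add]
    congr 1
    field_simp
    ring
  have e2 : (n : ℝ) ^ (-(1 : ℝ) / 2) = (Real.sqrt n)⁻¹ := by
    rw [Real.sqrt_eq_rpow, ← Real.rpow_neg hn0.le]; congr 1; ring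
  have e3 : Real.exp (s * n ^ 2 - s * n / 2) = Real.exp (s * n ^ 2) * Real.exp (-(s * n / 2)) := by
    rw [← Real.exp_add]; congr 1
  have e4 : Real.exp (-(s * n ^ 2)) * Real.exp (s * n ^ 2) = 1 := by rw [← Real.exp_add]; simp
  have e5 : (Real.exp 1) ^ n = Real.exp n := by rw [← Real.exp_nat_mul, mul_one]
  have h2 : Real.sqrt 2 ≠ 0 := by positivity
  have hsn : Real.sqrt n ≠ 0 := by positivity
  rw [e1, e2, e3, Real.sqrt_mul (by norm_num), div_pow, e5, Real.exp_add]
  have e6 : Real.sqrt 2 * (n.factorial / (Real.sqrt 2 * Real.sqrt n * ((n : ℝ) ^ n / Real.exp n))) *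
      (n : ℝ) ^ n = n.factorial * (Real.sqrt n)⁻¹ * Real.exp n := by
    field_simp
  linear_combination ((2 * s) ^ n * Real.exp (-(s * n ^ 2)) * Real.exp ((2 * s)⁻¹ / 2) *
    ((1 - p) ^ (n * (n - 1) / 2) * (Real.exp (s * n ^ 2) * Real.exp (-(s * n / 2))))) * e6 +
    (n.factorial * (Real.sqrt n)⁻¹ * Real.exp n * (2 * s) ^ n * Real.exp ((2 * s)⁻¹ / 2) *
    (1 - p) ^ (n * (n - 1) / 2) * Real.exp (-(s * n / 2))) * e4
end RandomXor

namespace RandomXor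
open MeasureTheory Filter

/-- The parameter `(2σ)⁻¹` of the coefficient functionals. -/
noncomputable def sigInv (lam : ℝ) (n : ℕ) : ℝ := (2 * sigP (pN lam n))⁻¹

/-- The window variable of `sigInv`. -/
noncomputable def windowVar (lam : ℝ) (n : ℕ) : ℝ := (n - sigInv lam n) / (n * dl n)

theorem sigInv_eq (lam : ℝ) (n : ℕ) : sigInv lam n = n - n * windowVar lam n * dl n := by
  rcases Nat.eq_zero_or_pos n with rfl | hn
  · simp [sigInv, pN, sigP]
  · have := dl_pos hn
    have hn0 : (n : ℝ) ≠ 0 := by exact_mod_cast hn.ne'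
    rw [windowVar]
    field_simp
    ring

theorem tendsto_two_mul_sigP_mul (lam : ℝ) :
    Tendsto (fun n : ℕ => 2 * sigP (pN lam n) * n) atTop (nhds 1) := by
  have t := ((tendsto_sigP_scaled lam).mul tendsto_dl).add_const 1
  rw [mul_zero, zero_add] at t
  refine t.congr' ?_
  filter_upwards [eventually_gt_atTop 0] with n hn
  have := dl_pos hn
  field_simp
  ring

theorem tendsto_windowVar (lam : ℝ) : Tendsto (windowVar lam) atTop (nhds lam) := by
  have t := (tendsto_sigP_scaled lam).div (tendsto_two_mul_sigP_mul lam) one_ne_zero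
  rw [div_one] at t
  refine t.congr' ?_
  filter_upwards [eventually_pN lam] with n ⟨hn, hp0, hp1⟩
  have hs := sigP_pos hp0 (by linarith)
  have := dl_pos hn
  have hn0 : (0 : ℝ) < n := by exact_mod_cast hn
  simp only [Pi.div_apply]
  rw [windowVar, sigInv]
  field_simp

theorem ne_intCast_of_pos_of_lt_one {y : ℝ} (h0 : 0 < y) (h1 : y < 1) (z : ℤ) : y ≠ z := by
  rintro rfl
  have a : 0 < z := by exact_mod_cast h0
  have b : z < 1 := by exact_mod_cast h1
  omega

theorem exists_BB_quarter_le (lam : ℝ) : ∃ κ : ℝ, 0 < κ ∧ ∀ᶠ n : ℕ in atTop, ∀ m : ℕ,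
    (m : ℝ) * dl n ≤ 2 * dl n ^ ((3 : ℝ) / 4) →
      0 < BB n (sigInv lam n) m (1 / 2) ∧
      BB n (sigInv lam n) m (1 / 4) ≤ κ * dl n ^ ((1 : ℝ) / 4) * BB n (sigInv lam n) m (1 / 2) := by
  classical
  have hy1 := ne_intCast_of_pos_of_lt_one (y := 1 / 4) (by norm_num) (by norm_num)
  have hy2 := ne_intCast_of_pos_of_lt_one (y := 1 / 2) (by norm_num) (by norm_num)
  have hα := Afun_pos lam hy1 (by norm_num)
  have hβ := Afun_pos lam hy2 (by norm_num)
  set κ := Afun (1 / 4) lam / Afun (1 / 2) lam + 1 with hκ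
  have hκ0 : 0 < κ := by positivity
  refine ⟨κ, hκ0, ?_⟩
  set Q : ℕ → ℕ → Prop := fun n m => 0 < BB n (sigInv lam n) m (1 / 2) ∧
      BB n (sigInv lam n) m (1 / 4) ≤ κ * dl n ^ ((1 : ℝ) / 4) * BB n (sigInv lam n) m (1 / 2) with hQ
  set m : ℕ → ℕ := fun n => if h : ∃ m : ℕ, (m : ℝ) * dl n ≤ 2 * dl n ^ ((3 : ℝ) / 4) ∧ ¬ Q n m
    then h.choose else 0 with hm
  have hm1 : ∀ n, (m n : ℝ) * dl n ≤ 2 * dl n ^ ((3 : ℝ) / 4) := by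
    intro n
    by_cases h : ∃ m : ℕ, (m : ℝ) * dl n ≤ 2 * dl n ^ ((3 : ℝ) / 4) ∧ ¬ Q n m
    · simp only [hm, dif_pos h]; exact h.choose_spec.1
    · simp only [hm, dif_neg h]
      have : 0 ≤ dl n := Real.rpow_nonneg (Nat.cast_nonneg n) _
      simpa using Real.rpow_nonneg this _
  have tm : Tendsto (fun n => (m n : ℝ) * dl n) atTop (nhds 0) := by
    have t : Tendsto (fun n => 2 * dl n ^ ((3 : ℝ) / 4)) atTop (nhds 0) := by
      have := (tendsto_dl.rpow_const (p := (3 : ℝ) / 4) (Or.inr (by norm_num))).const_mul 2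
      rwa [Real.zero_rpow (by norm_num), mul_zero] at this
    exact squeeze_zero (fun n => mul_nonneg (Nat.cast_nonneg _)
      (Real.rpow_nonneg (Nat.cast_nonneg n) _)) hm1 t
  have t1 := tendsto_BB_real hy1 (tendsto_windowVar lam) (sigInv_eq lam) tm
  have t2 := tendsto_BB_real hy2 (tendsto_windowVar lam) (sigInv_eq lam) tm
  have hlt : Real.exp (lam ^ 3 / 6) * Afun (1 / 4) lam <
      κ * (Real.exp (lam ^ 3 / 6) * Afun (1 / 2) lam) := by
    have : κ * (Real.exp (lam ^ 3 / 6) * Afun (1 / 2) lam) =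
        Real.exp (lam ^ 3 / 6) * Afun (1 / 4) lam + Real.exp (lam ^ 3 / 6) * Afun (1 / 2) lam := by
      rw [hκ]; field_simp
    have : 0 < Real.exp (lam ^ 3 / 6) * Afun (1 / 2) lam := by positivity
    linarith
  filter_upwards [t1.eventually_lt (t2.const_mul κ) hlt,
    t2.eventually (lt_mem_nhds (by positivity : 0 < Real.exp (lam ^ 3 / 6) * Afun (1 / 2) lam)),
    eventually_gt_atTop 0] with n h1 h2 hn
  have hd := dl_pos hn
  have hgood : Q n (m n) := by
    have hB : 0 < BB n (sigInv lam n) (m n) (1 / 2) := by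
      by_contra hB
      exact absurd h2 (not_lt.2 (mul_nonpos_of_nonneg_of_nonpos (by positivity) (not_lt.1 hB)))
    refine ⟨hB, ?_⟩
    have e : dl n ^ ((1 : ℝ) / 2 - 2) = dl n ^ ((1 : ℝ) / 4 - 2) * dl n ^ ((1 : ℝ) / 4) := by
      rw [← Real.rpow_add hd]; norm_num
    rw [e] at h1
    have hc : 0 < dl n ^ ((1 : ℝ) / 4 - 2) * Real.exp (-n - sigInv lam n / 2) := by positivity
    refine le_of_mul_le_mul_left (le_trans h1.le (le_of_eq ?_)) hc
    ring
  intro k hk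
  by_contra hbad
  have hex : ∃ m : ℕ, (m : ℝ) * dl n ≤ 2 * dl n ^ ((3 : ℝ) / 4) ∧ ¬ Q n m := ⟨k, hk, hbad⟩
  have := hex.choose_spec.2
  simp only [hm, dif_pos hex] at hgood
  exact this hgood

/-- The terms of the expansion of the solvability probability. -/
noncomputable def solvTerm (g : ℕ → ℕ → ℝ) (lam : ℝ) (n r : ℕ) : ℝ :=
  CC (pN lam n) n * (sigP (pN lam n) ^ r *
    ∑ m ∈ Finset.range (2 * r + 1), g r m * BB n (sigInv lam n) m (r + m + 1 / 4))

theorem sigInv_nonneg {lam : ℝ} {n : ℕ} (hp0 : 0 < pN lam n) (hp1 : pN lam n < 1) : 0 ≤ sigInv lam n := by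
  have := sigP_pos hp0 hp1
  rw [sigInv]; positivity

theorem CC_nonneg {p : ℝ} (hp0 : 0 < p) (hp1 : p < 1) (n : ℕ) : 0 ≤ CC p n := by
  have := sigP_pos hp0 hp1
  have : 0 < 1 - p := by linarith
  rw [CC]; positivity

theorem solvTerm_nonneg {e g : ℕ → ℕ → ℝ} (h : CoeffArrays e g) {lam : ℝ} {n : ℕ}
    (hp0 : 0 < pN lam n) (hp1 : pN lam n < 1) (r : ℕ) : 0 ≤ solvTerm g lam n r := by
  have := sigP_pos hp0 hp1
  have := CC_nonneg hp0 hp1 n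
  exact mul_nonneg this (mul_nonneg (by positivity) (Finset.sum_nonneg fun m _ =>
    mul_nonneg (h.g_nonneg r m) (BB_nonneg n (sigInv_nonneg hp0 hp1) m (by positivity))))

theorem solvTerm_le_of_BB_le {e g : ℕ → ℕ → ℝ} (h : CoeffArrays e g) {lam : ℝ} {n : ℕ}
    (hp0 : 0 < pN lam n) (hp1 : pN lam n < 1) (r : ℕ) {c : ℝ} (hc : 0 ≤ c)
    (hB : ∀ m ≤ 2 * r, BB n (sigInv lam n) m (r + m + 1 / 4) ≤ c * BB n (sigInv lam n) m (r + m + 1 / 2)) :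
    solvTerm g lam n r ≤ c * (1 / 2) ^ r * domTotal lam n := by
  have hs := sigP_pos hp0 hp1
  have hC := CC_nonneg hp0 hp1 n
  have hN := sigInv_nonneg hp0 hp1
  have hd := h.e_nonneg
  have h1 := le_hasSum (hasSum_dominating h hp0 hp1 n) r fun j _ =>
    mul_nonneg hC (mul_nonneg (by positivity) (Finset.sum_nonneg fun m _ =>
      mul_nonneg (h.e_nonneg j m) (BB_nonneg n hN m (by positivity))))
  refine le_trans ?_ (mul_le_mul_of_nonneg_left h1 (by positivity : 0 ≤ c * (1 / 2) ^ r))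
  have h2 : ∑ m ∈ Finset.range (2 * r + 1), g r m * BB n (sigInv lam n) m (r + m + 1 / 4) ≤
      c * ∑ m ∈ Finset.range (2 * r + 1), e r m * BB n (sigInv lam n) m (r + m + 1 / 2) := by
    rw [Finset.mul_sum]
    refine Finset.sum_le_sum fun m hm => ?_
    calc g r m * BB n (sigInv lam n) m (r + m + 1 / 4)
        ≤ e r m * (c * BB n (sigInv lam n) m (r + m + 1 / 2)) :=
          mul_le_mul (h.g_le r m) (hB m (by simpa [Nat.lt_succ_iff] using hm))
            (BB_nonneg n hN m (by positivity)) (h.e_nonneg r m)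
      _ = _ := by ring
  rw [solvTerm]
  have h3 := mul_le_mul_of_nonneg_left h2 (mul_nonneg hC (pow_nonneg hs.le r))
  refine (le_of_eq (by ring)).trans (h3.trans (le_of_eq ?_))
  have e1 : (1 / 2 : ℝ) ^ r * (2 * sigP (pN lam n)) ^ r = sigP (pN lam n) ^ r := by
    rw [← mul_pow]; congr 1; ring
  rw [sigInv]
  linear_combination -(CC (pN lam n) n * c *
    ∑ m ∈ Finset.range (2 * r + 1), e r m * BB n (2 * sigP (pN lam n))⁻¹ m (r + m + 1 / 2)) * e1

theorem exists_solvTerm_bound {e g : ℕ → ℕ → ℝ} (h : CoeffArrays e g) (lam : ℝ) :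
    ∃ M : ℝ, ∀ᶠ n : ℕ in atTop, ∀ r : ℕ,
      dl n ^ (-(1 : ℝ) / 4) * solvTerm g lam n r ≤ M * ((1 + 3 * r) * (1 / 2) ^ r) := by
  obtain ⟨κ, hκ, hev⟩ := exists_BB_quarter_le lam
  have hG : 0 < Real.Gamma (1 / 4) / Real.Gamma (1 / 2) :=
    div_pos (Real.Gamma_pos_of_pos (by norm_num)) (Real.Gamma_pos_of_pos (by norm_num))
  set K := Real.Gamma (1 / 4) / Real.Gamma (1 / 2) with hK
  set C := Real.exp (3 / 8) + 1
  have hC : 0 < C := by positivity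
  refine ⟨(K * κ + 1) * C, ?_⟩
  filter_upwards [hev, (tendsto_domTotal lam).eventually_le_const (lt_add_one _),
    eventually_pN lam] with n h1 h2 ⟨hn, hp0, hp1'⟩ r
  have hp1 : pN lam n < 1 := by linarith
  have hd := dl_pos hn
  have hN := sigInv_nonneg hp0 hp1
  have hq : dl n ^ (-(1 : ℝ) / 4) * dl n ^ ((1 : ℝ) / 4) = 1 := by
    rw [← Real.rpow_add hd]; norm_num
  have hq0 : 0 < dl n ^ (-(1 : ℝ) / 4) := by positivity
  have hr0 : (0 : ℝ) ≤ r := Nat.cast_nonneg r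
  have hpos : 0 ≤ (1 + 3 * (r : ℝ)) * (1 / 2) ^ r * C := by positivity
  rcases le_total (r : ℝ) (dl n ^ (-(1 : ℝ) / 4)) with hr | hr
  · have hB : ∀ m ≤ 2 * r, BB n (sigInv lam n) m (r + m + 1 / 4) ≤
        (K * (1 + 3 * r) * (κ * dl n ^ ((1 : ℝ) / 4))) * BB n (sigInv lam n) m (r + m + 1 / 2) := by
      intro m hm
      have hm' : (m : ℝ) ≤ 2 * r := by exact_mod_cast hm
      have hmd : (m : ℝ) * dl n ≤ 2 * dl n ^ ((3 : ℝ) / 4) := by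
        have e : dl n ^ ((3 : ℝ) / 4) = dl n ^ (-(1 : ℝ) / 4) * dl n := by
          nth_rewrite 3 [← Real.rpow_one (dl n)]
          rw [← Real.rpow_add hd]; norm_num
        rw [e, ← mul_assoc]
        exact mul_le_mul_of_nonneg_right (by linarith) hd.le
      obtain ⟨hb0, hb⟩ := h1 m hmd
      have hy : (0 : ℝ) ≤ r + m := by positivity
      have h3 := BB_quarter_mul_le n hN m hy
      have hBn := BB_nonneg n hN m (y := r + m + 1 / 2) (by positivity)
      refine le_of_mul_le_mul_right (h3.trans ?_) hb0
      have h4 : 1 + ((r : ℝ) + m) ≤ 1 + 3 * r := by linarith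
      calc K * (1 + (r + m)) * (BB n (sigInv lam n) m (r + m + 1 / 2) * BB n (sigInv lam n) m (1 / 4))
          ≤ K * (1 + 3 * r) * (BB n (sigInv lam n) m (r + m + 1 / 2) *
            (κ * dl n ^ ((1 : ℝ) / 4) * BB n (sigInv lam n) m (1 / 2))) := by
            have := BB_nonneg n hN m (y := 1 / 4) (by norm_num)
            gcongr
        _ = _ := by ring
    have h5 := solvTerm_le_of_BB_le h hp0 hp1 r (by positivity) hB
    calc dl n ^ (-(1 : ℝ) / 4) * solvTerm g lam n r
        ≤ dl n ^ (-(1 : ℝ) / 4) * ((K * (1 + 3 * r) * (κ * dl n ^ ((1 : ℝ) / 4))) *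
          (1 / 2) ^ r * C) := by
          gcongr
          exact h5.trans (by gcongr)
      _ = K * κ * ((1 + 3 * r) * (1 / 2) ^ r * C) := by
          linear_combination (K * (1 + 3 * r) * κ * (1 / 2) ^ r * C) * hq
      _ ≤ _ := by nlinarith
  · have hB : ∀ m ≤ 2 * r, BB n (sigInv lam n) m (r + m + 1 / 4) ≤
        1 * BB n (sigInv lam n) m (r + m + 1 / 2) := fun m _ => by
      rw [one_mul]
      exact BB_mono n hN m (by positivity) (by norm_num)
    have h5 := solvTerm_le_of_BB_le h hp0 hp1 r zero_le_one hB
    rw [one_mul] at h5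
    calc dl n ^ (-(1 : ℝ) / 4) * solvTerm g lam n r
        ≤ (1 + 3 * r) * ((1 / 2) ^ r * C) := by
          refine mul_le_mul (by linarith) (h5.trans (by gcongr)) (solvTerm_nonneg h hp0 hp1 r)
            (by positivity)
      _ = 1 * ((1 + 3 * r) * (1 / 2) ^ r * C) := by ring
      _ ≤ (K * κ + 1) * ((1 + 3 * r) * (1 / 2) ^ r * C) := by
          refine mul_le_mul_of_nonneg_right ?_ hpos
          have : 0 < K * κ := by positivity
          linarith
      _ = _ := by ring

theorem tendsto_solvTerm (g : ℕ → ℕ → ℝ) (lam : ℝ) (r : ℕ) :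
    Tendsto (fun n => dl n ^ (-(1 : ℝ) / 4) * solvTerm g lam n r) atTop
      (nhds (Real.exp (3 / 8) * Real.sqrt (2 * Real.pi) *
        (g r (2 * r) / 2 ^ r * Afun (1 / 4 + 3 * r) lam))) := by
  have hy0 := ne_intCast_of_pos_of_lt_one (y := 1 / 4) (by norm_num) (by norm_num)
  have hy : ∀ m : ℕ, ∀ z : ℤ, (r + m + 1 / 4 : ℝ) ≠ z := fun m z => by
    have := nonint_add_natCast hy0 (r + m) z
    push_cast at this
    rwa [add_comm] at this
  set T : ℕ → ℕ → ℝ := fun m n => dl n ^ ((r + m + 1 / 4 : ℝ) - 2) *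
    Real.exp (-n - sigInv lam n / 2) * BB n (sigInv lam n) m (r + m + 1 / 4) with hT
  have tT : ∀ m, Tendsto (T m) atTop
      (nhds (Real.exp (lam ^ 3 / 6) * Afun (r + m + 1 / 4) lam)) := fun m => by
    refine tendsto_BB_real (hy m) (tendsto_windowVar lam) (sigInv_eq lam) (m := fun _ => m) ?_
    simpa using tendsto_dl.const_mul (m : ℝ)
  have tS : Tendsto (fun n => ∑ m ∈ Finset.range (2 * r + 1), g r m * (dl n ^ (2 * r - m) * T m n))
      atTop (nhds (∑ m ∈ Finset.range (2 * r + 1), g r m * ((0 : ℝ) ^ (2 * r - m) *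
        (Real.exp (lam ^ 3 / 6) * Afun (r + m + 1 / 4) lam)))) :=
    tendsto_finsetSum _ fun m _ => ((tendsto_dl.pow _).mul (tT m)).const_mul _
  have eS : ∑ m ∈ Finset.range (2 * r + 1), g r m * ((0 : ℝ) ^ (2 * r - m) *
        (Real.exp (lam ^ 3 / 6) * Afun (r + m + 1 / 4) lam)) =
      g r (2 * r) * (Real.exp (lam ^ 3 / 6) * Afun (1 / 4 + 3 * r) lam) := by
    rw [Finset.sum_eq_single (2 * r)]
    · rw [Nat.sub_self, pow_zero, one_mul]
      congr 3
      push_cast; ring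
    · intro m hm hne
      rw [zero_pow (by simp at hm; omega)]; ring
    · simp
  rw [eS] at tS
  have t := ((tendsto_prefac lam).mul (((tendsto_two_mul_sigP_mul lam).div_const 2).pow r)).mul tS
  have eL : Real.exp (3 / 8) * Real.sqrt (2 * Real.pi) * Real.exp (-lam ^ 3 / 6) * (1 / 2) ^ r *
      (g r (2 * r) * (Real.exp (lam ^ 3 / 6) * Afun (1 / 4 + 3 * r) lam)) =
      Real.exp (3 / 8) * Real.sqrt (2 * Real.pi) *
        (g r (2 * r) / 2 ^ r * Afun (1 / 4 + 3 * r) lam) := by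
    have : Real.exp (-lam ^ 3 / 6) * Real.exp (lam ^ 3 / 6) = 1 := by
      rw [← Real.exp_add, neg_div, neg_add_cancel, Real.exp_zero]
    rw [one_div, inv_pow]
    linear_combination (Real.exp (3 / 8) * Real.sqrt (2 * Real.pi) * ((2 : ℝ) ^ r)⁻¹ *
      g r (2 * r) * Afun (1 / 4 + 3 * r) lam) * this
  rw [eL] at t
  refine t.congr' ?_
  filter_upwards [eventually_pN lam] with n ⟨hn, hp0, hp1⟩
  have hs := sigP_pos hp0 (by linarith)
  have hd := dl_pos hn
  have hn3 := mul_dl_pow hn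
  rw [solvTerm, prefac, Finset.mul_sum, Finset.mul_sum, Finset.mul_sum, Finset.mul_sum]
  refine Finset.sum_congr rfl fun m hm => ?_
  have hm' : m ≤ 2 * r := by simpa [Nat.lt_succ_iff] using hm
  have e1 : (n : ℝ) ^ (-(1 : ℝ) / 2) = dl n ^ ((3 : ℝ) / 2) := by
    rw [← rpow_eq_dl_rpow]; norm_num
  have e2 : Real.exp (n + (2 * sigP (pN lam n))⁻¹ / 2) * Real.exp (-n - sigInv lam n / 2) = 1 := by
    rw [← Real.exp_add, sigInv]; simp
  have e3 : dl n ^ ((3 : ℝ) / 2) * (dl n ^ (2 * r - m) * dl n ^ ((r + m + 1 / 4 : ℝ) - 2)) =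
      dl n ^ (-(1 : ℝ) / 4) * (dl n ^ 3) ^ r := by
    rw [← pow_mul, ← Real.rpow_natCast, ← Real.rpow_natCast, ← Real.rpow_add hd,
      ← Real.rpow_add hd, ← Real.rpow_add hd]
    congr 1
    push_cast [Nat.cast_sub hm']
    ring
  have e4 : (2 * sigP (pN lam n) * n / 2) ^ r * (dl n ^ 3) ^ r = sigP (pN lam n) ^ r := by
    rw [← mul_pow]; congr 1; linear_combination sigP (pN lam n) * hn3
  rw [hT, e1]
  generalize sigP (pN lam n) ^ r = S at *
  generalize (2 * sigP (pN lam n) * n / 2) ^ r = W at *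
  generalize (dl n ^ 3) ^ r = D at *
  simp only
  generalize BB n (sigInv lam n) m (r + m + 1 / 4) = B at *
  generalize Real.exp (n + (2 * sigP (pN lam n))⁻¹ / 2) = E1 at *
  generalize Real.exp (-n - sigInv lam n / 2) = E2 at *
  generalize dl n ^ ((3 : ℝ) / 2) = a1 at *
  generalize dl n ^ (2 * r - m) = a2 at *
  generalize dl n ^ ((r + m + 1 / 4 : ℝ) - 2) = a3 at *
  generalize dl n ^ (-(1 : ℝ) / 4) = a4 at *
  linear_combination (CC (pN lam n) n * W * g r m * B * a1 * a2 * a3) * e2 +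
    (CC (pN lam n) n * W * g r m * B) * e3 + (CC (pN lam n) n * g r m * B * a4) * e4

theorem summable_linear_mul_half_pow : Summable fun r : ℕ => (1 + 3 * (r : ℝ)) * (1 / 2) ^ r := by
  have h1 : Summable fun r : ℕ => (1 / 2 : ℝ) ^ r := summable_geometric_two
  have h2 : Summable fun r : ℕ => (r : ℝ) ^ 1 * (1 / 2 : ℝ) ^ r :=
    summable_pow_mul_geometric_of_norm_lt_one 1 (by norm_num)
  refine (h1.add (h2.mul_left 3)).congr fun r => ?_
  ring

end RandomXor

open RandomXor

/-- with `f` the sequence determined by `f 0 = 1` and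
`Σ_{k=0}^r f k f (r-k) = ε_r` (`r ≥ 1`), the series defining
`c(λ) = e^{3/8} √(2π) Σ_r (f_r/2^r) A(1/4+3r, λ)` converges absolutely, `c(λ) > 0`, and
`n^{1/12} P_n → c(λ)`. -/
theorem solvProb_asymptotics (lam : ℝ) (f : ℕ → ℝ) (hf0 : f 0 = 1)
    (hrec : ∀ r : ℕ, 1 ≤ r → ∑ k ∈ Finset.range (r + 1), f k * f (r - k) = epsr r) :
    Summable (fun r : ℕ => |f r / 2 ^ r * Afun (1 / 4 + 3 * r) lam|) ∧
    0 < Real.exp (3 / 8) * Real.sqrt (2 * Real.pi) *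
        ∑' r : ℕ, f r / 2 ^ r * Afun (1 / 4 + 3 * r) lam ∧
    Tendsto (fun n : ℕ => (n : ℝ) ^ ((1 : ℝ) / 12) * solvProb lam n) atTop
      (nhds (Real.exp (3 / 8) * Real.sqrt (2 * Real.pi) *
        ∑' r : ℕ, f r / 2 ^ r * Afun (1 / 4 + 3 * r) lam)) := by
  obtain ⟨e, g, h⟩ := exists_coeffArrays
  obtain ⟨M, hM⟩ := exists_solvTerm_bound h lam
  have hfg : ∀ r, g r (2 * r) = f r := h.g_diag hf0 hrec
  have ht := tendsto_solvTerm g lam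
  simp only [hfg] at ht
  have hc : 0 < Real.exp (3 / 8) * Real.sqrt (2 * Real.pi) := by positivity
  set c := Real.exp (3 / 8) * Real.sqrt (2 * Real.pi)
  have hA : ∀ r : ℕ, 0 < Afun (1 / 4 + 3 * r) lam := fun r =>
    Afun_pos lam (by
      have := nonint_add_natCast (ne_intCast_of_pos_of_lt_one (y := 1 / 4) (by norm_num)
        (by norm_num)) (3 * r)
      push_cast at this
      exact this) (by positivity)
  have ha : ∀ r, 0 ≤ f r / 2 ^ r * Afun (1 / 4 + 3 * r) lam := fun r =>
    mul_nonneg (div_nonneg (by rw [← hfg]; exact h.g_nonneg _ _) (by positivity)) (hA r).le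
  have hb := summable_linear_mul_half_pow.mul_left M
  have hle : ∀ r, c * (f r / 2 ^ r * Afun (1 / 4 + 3 * r) lam) ≤
      M * ((1 + 3 * (r : ℝ)) * (1 / 2) ^ r) := fun r =>
    le_of_tendsto (ht r) (hM.mono fun n hn => hn r)
  have hs : Summable fun r : ℕ => f r / 2 ^ r * Afun (1 / 4 + 3 * r) lam :=
    (summable_mul_left_iff hc.ne').1
      (Summable.of_nonneg_of_le (fun r => mul_nonneg hc.le (ha r)) hle hb)
  refine ⟨hs.abs, mul_pos hc (hs.tsum_pos ha 0 ?_), ?_⟩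
  · rw [hf0]
    have := hA 0
    positivity
  rw [← tsum_mul_left]
  have hdom : Tendsto (fun n => ∑' r, dl n ^ (-(1 : ℝ) / 4) * solvTerm g lam n r) atTop
      (nhds (∑' r : ℕ, c * (f r / 2 ^ r * Afun (1 / 4 + 3 * r) lam))) := by
    refine tendsto_tsum_of_dominated_convergence hb ht ?_
    filter_upwards [hM, eventually_pN lam] with n h1 ⟨hn, hp0, hp1⟩ r
    have hd := dl_pos hn
    rw [Real.norm_of_nonneg (mul_nonneg (by positivity)
      (solvTerm_nonneg h hp0 (by linarith) r))]
    exact h1 r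
  refine hdom.congr' ?_
  filter_upwards [eventually_pN lam] with n ⟨hn, hp0, hp1⟩
  have e1 : (n : ℝ) ^ ((1 : ℝ) / 12) = dl n ^ (-(1 : ℝ) / 4) := by
    rw [← rpow_eq_dl_rpow]; norm_num
  rw [e1]
  exact ((hasSum_solvProb h hp0 (by linarith)).mul_left _).tsum_eq
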